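/- arXiv:1903.01315 — 2 statements merged into one kernel-verified Lean document; each statement's English description precedes it below -/
import Mathlib

section
/- Let x ∈ b(M)^3 be a parameter element of M, let U_M(0) be the unmixed component of M, and set M̄ = M/U_M(0). Then for all i ≤ d-1 one has dim_k Soc(H^i_m(M/xM)) = dim_k Soc(H^i_m(M)) + dim_k Soc(H^{i+1}_m(M̄)). -/
open IsLocalRing

universe u

namespace Paper

variable (R : Type u) [CommRing R]

/-- `dim_{R/I} Soc_I(N)` where `Soc_I(N) = (0 :_N I)`. -/
noncomputable def socDim (I : Ideal R) (N : Type u) [AddCommGroup N] [Module R N] : ℕ :=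
  Module.finrank (R ⧸ I) (Submodule.torsionBySet R N (I : Set R))

/-- Krull dimension of a module (`⊥` for the zero module). -/
noncomputable def mdim (M : Type u) [AddCommGroup M] [Module R M] : WithBot (WithTop ℕ) :=
  ringKrullDim (R ⧸ Module.annihilator R M)

/-- The index of reducibility of an ideal `q` on `M`: `dim_k Soc (M/qM)`. -/
noncomputable def ir [IsLocalRing R] (M : Type u) [AddCommGroup M] [Module R M]
    (q : Ideal R) : ℕ :=
  socDim R (maximalIdeal R) (M ⧸ (q • ⊤ : Submodule R M))

/-- `dim_k Soc (H^i_m(M))`. -/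
noncomputable def socH [IsLocalRing R] (M : Type u) [AddCommGroup M] [Module R M] (i : ℕ) : ℕ :=
  socDim R (maximalIdeal R) ((localCohomology (maximalIdeal R) i).obj (ModuleCat.of R M))

/-- A system of parameters of `M` (of length `d`): `d` elements of the maximal ideal such
that the quotient has finite length. -/
def IsSOP [IsLocalRing R] (M : Type u) [AddCommGroup M] [Module R M] (d : ℕ)
    (x : Fin d → R) : Prop :=
  (∀ i, x i ∈ maximalIdeal R) ∧
    IsFiniteLength R (M ⧸ (Ideal.span (Set.range x) • ⊤ : Submodule R M))

/-- A parameter element: an element occurring in some system of parameters of `M`. -/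
def IsParamElement [IsLocalRing R] (M : Type u) [AddCommGroup M] [Module R M] (d : ℕ)
    (a : R) : Prop :=
  ∃ x : Fin d → R, IsSOP R M d x ∧ ∃ i, x i = a

/-- The ideal `b(M) = ⋂ Ann (0 :_{M/(x_1,...,x_{i-1})M} x_i)`, the intersection running over
all systems of parameters `x_1, ..., x_d` of `M`. -/
noncomputable def bIdeal [IsLocalRing R] (M : Type u) [AddCommGroup M] [Module R M]
    (d : ℕ) : Ideal R :=
  ⨅ (x : Fin d → R) (_ : IsSOP R M d x) (i : Fin d),
    Module.annihilator R
      (Submodule.torsionBy R (M ⧸ (Ideal.span (x '' {j | j < i}) • ⊤ : Submodule R M)) (x i))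

/-- A C-system of parameters: `x_i ∈ b(M/(x_{i+1},...,x_d)M)^3` for all `i`. -/
def IsCSOP [IsLocalRing R] (M : Type u) [AddCommGroup M] [Module R M] (d : ℕ)
    (x : Fin d → R) : Prop :=
  IsSOP R M d x ∧ ∀ i : Fin d,
    x i ∈ (bIdeal R (M ⧸ (Ideal.span (x '' {j | i < j}) • ⊤ : Submodule R M)) ((i : ℕ) + 1)) ^ 3

/-- The depth of `M`: the supremum of the lengths of `M`-regular sequences contained in the
maximal ideal. -/
noncomputable def depth [IsLocalRing R] (M : Type u) [AddCommGroup M] [Module R M] :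
    WithTop ℕ :=
  sSup {n : WithTop ℕ | ∃ rs : List R, (rs.length : WithTop ℕ) = n ∧
    (∀ r ∈ rs, r ∈ maximalIdeal R) ∧ RingTheory.Sequence.IsRegular M rs}

/-- `M` is a Cohen-Macaulay module: `depth M = dim M`. -/
def IsCM [IsLocalRing R] (M : Type u) [AddCommGroup M] [Module R M] : Prop :=
  (depth R M : WithBot (WithTop ℕ)) = mdim R M

/-- A Cohen-Macaulay local ring. -/
def IsCMLocalRing (S : Type u) [CommRing S] [IsLocalRing S] : Prop :=
  IsNoetherianRing S ∧ IsCM S S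

/-- `R` is a homomorphic image of a Cohen-Macaulay (Noetherian) local ring. -/
def IsQuotientOfCMLocalRing : Prop :=
  ∃ (S : Type u) (_ : CommRing S) (_ : IsLocalRing S),
    IsCMLocalRing S ∧ ∃ f : S →+* R, Function.Surjective f

/-- The largest submodule of (the submodule) `N` whose dimension is strictly smaller than
that of `N`. -/
noncomputable def uComp (M : Type u) [AddCommGroup M] [Module R M] (N : Submodule R M) :
    Submodule R M :=
  sSup {P : Submodule R M | P ≤ N ∧ mdim R P < mdim R N}

/-- The unmixed component `U_M(0)` of `M`: the largest submodule of dimension `< dim M`. -/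
noncomputable def unmixedComp (M : Type u) [AddCommGroup M] [Module R M] : Submodule R M :=
  uComp R M ⊤

/-- The 0-th local cohomology `H^0_m(M)` realized as the submodule of elements annihilated by
some power of the maximal ideal. -/
def H0sub [IsLocalRing R] (M : Type u) [AddCommGroup M] [Module R M] : Submodule R M :=
  ⨆ n : ℕ, Submodule.torsionBySet R M (((maximalIdeal R) ^ n : Ideal R) : Set R)

/-- The quotient `P/N` of two submodules of `M`. -/
abbrev subQuot (M : Type u) [AddCommGroup M] [Module R M] (P N : Submodule R M) :=
  P ⧸ (Submodule.comap P.subtype N)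

/-- `D_0 ⊆ D_1 ⊆ ⋯ ⊆ D_t = M` is the dimension filtration of `M`:
`D_t = M`, each `D_{i-1}` is the largest submodule of `D_i` of strictly smaller dimension,
and `D_0 = H^0_m(M)`. -/
def IsDimFiltration [IsLocalRing R] (M : Type u) [AddCommGroup M] [Module R M]
    (t : ℕ) (D : Fin (t + 1) → Submodule R M) : Prop :=
  D (Fin.last t) = ⊤ ∧ (∀ i : Fin t, D i.castSucc = uComp R M (D i.succ)) ∧
    D 0 = H0sub R M

/-- `M` is sequentially Cohen-Macaulay: all quotients `D_i/D_{i-1}` of the dimension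
filtration are Cohen-Macaulay. -/
def IsSeqCM [IsLocalRing R] (M : Type u) [AddCommGroup M] [Module R M] : Prop :=
  ∃ (t : ℕ) (D : Fin (t + 1) → Submodule R M), IsDimFiltration R M t D ∧
    ∀ i : Fin t, IsCM R (subQuot R M (D i.succ) (D i.castSucc))

/-- `M` (of dimension `d`) is generalized Cohen-Macaulay: `H^i_m(M)` has finite length
for all `i < d`. -/
def IsGenCM [IsLocalRing R] (M : Type u) [AddCommGroup M] [Module R M] (d : ℕ) : Prop :=
  ∀ i < d, IsFiniteLength R ((localCohomology (maximalIdeal R) i).obj (ModuleCat.of R M))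

/-- `α_n(M)`: the minimum of the indices of reducibility of parameter ideals of `M`
contained in `m^n`. -/
noncomputable def alphaN [IsLocalRing R] (M : Type u) [AddCommGroup M] [Module R M]
    (d n : ℕ) : ℕ :=
  sInf {r : ℕ | ∃ x : Fin d → R, IsSOP R M d x ∧
    Ideal.span (Set.range x) ≤ (maximalIdeal R) ^ n ∧ r = ir R M (Ideal.span (Set.range x))}

/-- The limit value `α(M) = lim_n α_n(M)` (the supremum of the non-decreasing sequence). -/
noncomputable def alphaLim [IsLocalRing R] (M : Type u) [AddCommGroup M] [Module R M]
    (d : ℕ) : ℕ :=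
  ⨆ n : ℕ, alphaN R M d (n + 1)

/-- `M` is unmixed: `dim R/p = dim M` for all associated primes `p`. -/
def IsUnmixed (M : Type u) [AddCommGroup M] [Module R M] : Prop :=
  ∀ p ∈ associatedPrimes R M, ringKrullDim (R ⧸ p) = mdim R M

/-- Serre's condition `(S_2)` for a module. -/
def IsS2 (L : Type u) [AddCommGroup L] [Module R L] : Prop :=
  ∀ p : PrimeSpectrum R, p ∈ Module.support R L →
    min 2 (mdim (Localization.AtPrime p.asIdeal) (LocalizedModule p.asIdeal.primeCompl L)) ≤
      (depth (Localization.AtPrime p.asIdeal) (LocalizedModule p.asIdeal.primeCompl L) :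
        WithBot (WithTop ℕ))

/-- `ι : M →ₗ[R] S` exhibits `S` as an `S_2`-ification of `M`. -/
def IsS2ification [IsLocalRing R] (M S : Type u) [AddCommGroup M] [Module R M]
    [AddCommGroup S] [Module R S] (ι : M →ₗ[R] S) : Prop :=
  Function.Injective ι ∧ Module.Finite R S ∧ IsS2 R S ∧
    ∀ (p : Ideal R) [p.IsPrime], p ≠ maximalIdeal R →
      IsS2 (Localization.AtPrime p) (LocalizedModule p.primeCompl M) →
      Function.Surjective (IsLocalizedModule.map p.primeCompl
        (LocalizedModule.mkLinearMap p.primeCompl M)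
        (LocalizedModule.mkLinearMap p.primeCompl S) ι)

end Paper

open Paper IsLocalRing

namespace LC
noncomputable section
open CategoryTheory Opposite Limits
variable {R : Type u} [CommRing R]

/-- The contravariant Hom functor, covariant into the opposite category. -/
abbrev G (Y : ModuleCat.{u} R) : ModuleCat.{u} R ⥤ (ModuleCat.{u} R)ᵒᵖ :=
  ((linearYoneda R (ModuleCat.{u} R)).obj Y).rightOp

abbrev Gmap {Y Y' : ModuleCat.{u} R} (f : Y ⟶ Y') : G Y' ⟶ G Y :=
  NatTrans.rightOp ((linearYoneda R (ModuleCat.{u} R)).map f)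

abbrev K (P : ChainComplex (ModuleCat.{u} R) ℕ) (Y : ModuleCat.{u} R) :
    ChainComplex (ModuleCat.{u} R)ᵒᵖ ℕ :=
  ((G Y).mapHomologicalComplex _).obj P

abbrev Kmap (P : ChainComplex (ModuleCat.{u} R) ℕ) {Y Y' : ModuleCat.{u} R} (f : Y ⟶ Y') :
    K P Y' ⟶ K P Y :=
  (NatTrans.mapHomologicalComplex (Gmap f) _).app P

abbrev Kpre {P Q : ChainComplex (ModuleCat.{u} R) ℕ} (φ : P ⟶ Q) (Y : ModuleCat.{u} R) :
    K P Y ⟶ K Q Y :=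
  ((G Y).mapHomologicalComplex _).map φ

lemma Kmap_comp (P : ChainComplex (ModuleCat.{u} R) ℕ) {Y Y' Y'' : ModuleCat.{u} R}
    (f : Y ⟶ Y') (g : Y' ⟶ Y'') : Kmap P (f ≫ g) = Kmap P g ≫ Kmap P f := by
  simp [Kmap, Gmap]

lemma Kmap_zero (P : ChainComplex (ModuleCat.{u} R) ℕ) {Y Y' : ModuleCat.{u} R} :
    Kmap P (0 : Y ⟶ Y') = 0 := by
  ext i
  apply Quiver.Hom.unop_inj
  ext x
  exact Limits.comp_zero (C := ModuleCat.{u} R) (f := x)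

lemma Kpre_naturality {P Q : ChainComplex (ModuleCat.{u} R) ℕ} (φ : P ⟶ Q) 
    {Y Y' : ModuleCat.{u} R} (f : Y ⟶ Y') : 
    Kpre φ Y' ≫ Kmap Q f = Kmap P f ≫ Kpre φ Y := 
  (NatTrans.mapHomologicalComplex (Gmap f) _).naturality φ

/-- short complex of complexes -/
abbrev KS (P : ChainComplex (ModuleCat.{u} R) ℕ) (S : ShortComplex (ModuleCat.{u} R)) :
    ShortComplex (ChainComplex (ModuleCat.{u} R)ᵒᵖ ℕ) :=
  ShortComplex.mk (Kmap P S.g) (Kmap P S.f) (by rw [← Kmap_comp, S.zero, Kmap_zero])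

lemma KS_shortExact (P : ChainComplex (ModuleCat.{u} R) ℕ) [∀ i, Projective (P.X i)]
    (S : ShortComplex (ModuleCat.{u} R)) (hS : S.ShortExact) : (KS P S).ShortExact := by
  have := hS.mono_f
  have := hS.epi_g
  apply HomologicalComplex.shortExact_of_degreewise_shortExact
  intro i
  apply ShortComplex.ShortExact.op (S := ShortComplex.mk
    (ModuleCat.ofHom (Linear.rightComp R (P.X i) S.f))
    (ModuleCat.ofHom (Linear.rightComp R (P.X i) S.g)) (by
      apply ModuleCat.hom_ext
      apply LinearMap.ext
      intro x
      change (x ≫ S.f) ≫ S.g = 0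
      rw [Category.assoc, S.zero, Limits.comp_zero]))
  refine ShortComplex.ShortExact.mk' ?_ ?_ ?_
  · rw [ShortComplex.moduleCat_exact_iff]
    intro x hx
    exact ⟨hS.exact.lift (k := x) hx, hS.exact.lift_f x hx⟩
  · rw [ModuleCat.mono_iff_injective]
    intro x y hxy
    change x ≫ S.f = y ≫ S.f at hxy
    exact (cancel_mono S.f).1 hxy
  · rw [ModuleCat.epi_iff_surjective]
    intro x
    exact ⟨Projective.factorThru x S.g, Projective.factorThru_comp x S.g⟩

abbrev cres (X : ModuleCat.{u} R) : ChainComplex (ModuleCat.{u} R) ℕ :=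
  (projectiveResolution X).complex

abbrev E (X Y : ModuleCat.{u} R) (i : ℕ) : ModuleCat.{u} R :=
  ((Ext R (ModuleCat.{u} R) i).obj (op X)).obj Y

def isoE (X Y : ModuleCat.{u} R) (i : ℕ) : op (E X Y i) ≅ (K (cres X) Y).homology i :=
  (projectiveResolution X).isoLeftDerivedObj (G Y) i

abbrev Emap (X : ModuleCat.{u} R) {Y Y' : ModuleCat.{u} R} (f : Y ⟶ Y') (i : ℕ) :
    E X Y i ⟶ E X Y' i := ((Ext R (ModuleCat.{u} R) i).obj (op X)).map f

abbrev Epre {X X' : ModuleCat.{u} R} (g : X ⟶ X') (Y : ModuleCat.{u} R) (i : ℕ) :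
    E X' Y i ⟶ E X Y i := ((Ext R (ModuleCat.{u} R) i).map g.op).app Y

lemma Emap_op (X : ModuleCat.{u} R) {Y Y' : ModuleCat.{u} R} (f : Y ⟶ Y') (i : ℕ) :
    (Emap X f i).op = (isoE X Y' i).hom ≫
      HomologicalComplex.homologyMap (Kmap (cres X) f) i ≫ (isoE X Y i).inv :=
  (projectiveResolution X).leftDerived_app_eq (Gmap f) i

lemma Epre_op {X X' : ModuleCat.{u} R} (g : X ⟶ X') (Y : ModuleCat.{u} R) (i : ℕ)
    (φ : cres X ⟶ cres X') (comm : φ ≫ (projectiveResolution X').π =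
      (projectiveResolution X).π ≫ (ChainComplex.single₀ _).map g) :
    (Epre g Y i).op = (isoE X Y i).hom ≫ HomologicalComplex.homologyMap (Kpre φ Y) i ≫
      (isoE X' Y i).inv :=
  (G Y).leftDerived_map_eq i g φ comm

def Edelta (X : ModuleCat.{u} R) (S : ShortComplex (ModuleCat.{u} R)) (hS : S.ShortExact) (i : ℕ) :
    E X S.X₃ i ⟶ E X S.X₁ (i + 1) :=
  ((isoE X S.X₁ (i+1)).hom ≫ (KS_shortExact (cres X) S hS).δ (i+1) i (by simp) ≫
    (isoE X S.X₃ i).inv).unop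

lemma Edelta_natural (X : ModuleCat.{u} R) {S T : ShortComplex (ModuleCat.{u} R)}
    (hS : S.ShortExact) (hT : T.ShortExact) (a : S ⟶ T) (i : ℕ) :
    Emap X a.τ₃ i ≫ Edelta X T hT i = Edelta X S hS i ≫ Emap X a.τ₁ (i+1) := by
  apply Quiver.Hom.op_inj
  rw [op_comp, op_comp, Emap_op, Emap_op, Edelta, Edelta, Quiver.Hom.op_unop, Quiver.Hom.op_unop]
  let b : KS (cres X) T ⟶ KS (cres X) S :=
    { τ₁ := Kmap _ a.τ₃
      τ₂ := Kmap _ a.τ₂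
      τ₃ := Kmap _ a.τ₁
      comm₁₂ := by simp only [← Kmap_comp, a.comm₂₃]
      comm₂₃ := by simp only [← Kmap_comp, a.comm₁₂] }
  have := HomologicalComplex.HomologySequence.δ_naturality b (KS_shortExact (cres X) T hT)
    (KS_shortExact (cres X) S hS) (i+1) i (by simp)
  simp only [Category.assoc, Iso.inv_hom_id_assoc]
  simp only [b] at this
  rw [reassoc_of% this]

lemma Edelta_pre {X X' : ModuleCat.{u} R} (g : X ⟶ X') {S : ShortComplex (ModuleCat.{u} R)}
    (hS : S.ShortExact) (i : ℕ) :
    Epre g S.X₃ i ≫ Edelta X S hS i = Edelta X' S hS i ≫ Epre g S.X₁ (i+1) := by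
  apply Quiver.Hom.op_inj
  have comm := ProjectiveResolution.lift_commutes g (projectiveResolution X) (projectiveResolution X')
  rw [op_comp, op_comp, Epre_op g _ _ _ comm, Epre_op g _ _ _ comm, Edelta, Edelta,
    Quiver.Hom.op_unop, Quiver.Hom.op_unop]
  let b : KS (cres X) S ⟶ KS (cres X') S :=
    { τ₁ := Kpre (ProjectiveResolution.lift g _ _) _
      τ₂ := Kpre (ProjectiveResolution.lift g _ _) _
      τ₃ := Kpre (ProjectiveResolution.lift g _ _) _
      comm₁₂ := Kpre_naturality _ _
      comm₂₃ := Kpre_naturality _ _ }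
  have := HomologicalComplex.HomologySequence.δ_naturality b (KS_shortExact (cres X) S hS)
    (KS_shortExact (cres X') S hS) (i+1) i (by simp)
  simp only [Category.assoc, Iso.inv_hom_id_assoc]
  simp only [b] at this
  rw [← reassoc_of% this]

lemma exact_of_op {A B C : ModuleCat.{u} R} {A' B' C' : (ModuleCat.{u} R)ᵒᵖ}
    (eA : op A ≅ A') (eB : op B ≅ B') (eC : op C ≅ C') (f : A ⟶ B) (g : B ⟶ C)
    (g' : C' ⟶ B') (f' : B' ⟶ A') (w : g' ≫ f' = 0)
    (h : (ShortComplex.mk g' f' w).Exact)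
    (hf : f.op = eB.hom ≫ f' ≫ eA.inv) (hg : g.op = eC.hom ≫ g' ≫ eB.inv) :
    Function.Exact f.hom g.hom := by
  have w0 : g.op ≫ f.op = 0 := by rw [hf, hg]; simp [reassoc_of% w]
  have w1 : f ≫ g = 0 := by
    apply Quiver.Hom.op_inj
    rw [op_comp, w0]; rfl
  let e : ShortComplex.mk g' f' w ≅ ShortComplex.mk g.op f.op w0 :=
    ShortComplex.isoMk eC.symm eB.symm eA.symm (by simp [hg]) (by simp [hf])
  have h1 := ShortComplex.exact_of_iso e h
  have h2 : (ShortComplex.mk f g w1).Exact := h1.unop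
  exact (ShortComplex.ShortExact.moduleCat_exact_iff_function_exact _).1 h2

variable (X : ModuleCat.{u} R) (S : ShortComplex (ModuleCat.{u} R)) (hS : S.ShortExact) (i : ℕ)

lemma E_exact₂ (X : ModuleCat.{u} R) (S : ShortComplex (ModuleCat.{u} R)) (hS : S.ShortExact)
    (i : ℕ) : Function.Exact (Emap X S.f i).hom (Emap X S.g i).hom :=
  exact_of_op (isoE X _ i) (isoE X _ i) (isoE X _ i) _ _ _ _ _
    ((KS_shortExact (cres X) S hS).homology_exact₂ i) (Emap_op _ _ _) (Emap_op _ _ _)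

lemma E_exact₃ : Function.Exact (Emap X S.g i).hom (Edelta X S hS i).hom :=
  exact_of_op (isoE X _ i) (isoE X _ i) (isoE X _ _) _ _ _ _ _
    ((KS_shortExact (cres X) S hS).homology_exact₁ (i+1) i (by simp)) (Emap_op _ _ _)
      (Quiver.Hom.op_unop _)

lemma E_exact₁ : Function.Exact (Edelta X S hS i).hom (Emap X S.f (i+1)).hom :=
  exact_of_op (isoE X _ i) (isoE X _ _) (isoE X _ _) _ _ _ _ _
    ((KS_shortExact (cres X) S hS).homology_exact₃ (i+1) i (by simp)) 
      (Quiver.Hom.op_unop _) (Emap_op _ _ _)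

/-- vanishing on injectives -/
lemma E_injective (Y : ModuleCat.{u} R) [Injective Y] : Subsingleton (E X Y (i+1)) := by
  have hz : IsZero ((K (cres X) Y).homology (i+1)) := by
    rw [← HomologicalComplex.exactAt_iff_isZero_homology,
      HomologicalComplex.exactAt_iff' _ (i+2) (i+1) i (by simp) (by simp)]
    have hex : ((cres X).sc' (i+2) (i+1) i).Exact := by
      have := (projectiveResolution X).complex_exactAt_succ i
      rwa [HomologicalComplex.exactAt_iff' _ (i+2) (i+1) i (by simp) (by simp)] at this
    apply ShortComplex.Exact.op (S := ShortComplex.mk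
      (ModuleCat.ofHom (Linear.leftComp R Y ((cres X).d (i+1) i)))
      (ModuleCat.ofHom (Linear.leftComp R Y ((cres X).d (i+2) (i+1)))) (by
        apply ModuleCat.hom_ext
        apply LinearMap.ext
        intro x
        change (cres X).d (i+2) (i+1) ≫ (cres X).d (i+1) i ≫ x = 0
        simp))
    rw [ShortComplex.moduleCat_exact_iff]
    intro x hx
    exact ⟨hex.descToInjective x hx, hex.comp_descToInjective x hx⟩
  have h2 : IsZero (op (E X Y (i+1))) := hz.of_iso (isoE X Y (i+1))
  exact ModuleCat.subsingleton_of_isZero h2.unop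

section general
universe v₁ v₂ w₁ w₂
variable {C : Type w₁} [Category.{v₁} C] [Abelian C] [HasProjectiveResolutions C]
  {D : Type w₂} [Category.{v₂} D] [Abelian D]

lemma fromLeftDerivedZero_nat {F H : C ⥤ D} [F.Additive] [H.Additive] (α : F ⟶ H) (X : C) :
    (NatTrans.leftDerived α 0).app X ≫ H.fromLeftDerivedZero.app X =
      F.fromLeftDerivedZero.app X ≫ α.app X := by
  rw [(projectiveResolution X).leftDerived_app_eq,
    (projectiveResolution X).fromLeftDerivedZero_eq,
    (projectiveResolution X).fromLeftDerivedZero_eq]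
  rw [Category.assoc, Category.assoc, Iso.inv_hom_id_assoc, Category.assoc]
  congr 1
  have h1 : HomologicalComplex.opcyclesMap
      ((NatTrans.mapHomologicalComplex α _).app (projectiveResolution X).complex) 0 ≫
        (projectiveResolution X).fromLeftDerivedZero' H =
        (projectiveResolution X).fromLeftDerivedZero' F ≫ α.app X := by
    rw [← cancel_epi (HomologicalComplex.pOpcycles _ _)]
    rw [HomologicalComplex.p_opcyclesMap_assoc,
      ProjectiveResolution.pOpcycles_comp_fromLeftDerivedZero',
      ProjectiveResolution.pOpcycles_comp_fromLeftDerivedZero'_assoc]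
    exact (α.naturality _).symm
  have h2 := HomologicalComplex.homologyι_naturality_assoc
    ((NatTrans.mapHomologicalComplex α _).app (projectiveResolution X).complex) 0
    ((projectiveResolution X).fromLeftDerivedZero' H)
  rw [h1, ← Category.assoc (HomologicalComplex.homologyι _ _)] at h2
  exact h2

end general

instance G_preserves (Y : ModuleCat.{u} R) : PreservesFiniteColimits (G Y) := by
  have h0 : PreservesLimitsOfSize.{0,0} ((linearYoneda R (ModuleCat.{u} R)).obj Y ⋙ forget _) := by
    change PreservesLimitsOfSize.{0,0} (yoneda.obj Y)
    infer_instance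
  have : PreservesLimitsOfSize.{0,0} ((linearYoneda R (ModuleCat.{u} R)).obj Y) :=
    preservesLimits_of_reflects_of_preserves _ (forget _)
  have : PreservesFiniteLimits ((linearYoneda R (ModuleCat.{u} R)).obj Y) :=
    PreservesLimitsOfSize.preservesFiniteLimits _
  exact preservesFiniteColimits_rightOp _

/-- the map `Hom(X,Y) → Ext^0(X,Y)` -/
def theta (X Y : ModuleCat.{u} R) : ModuleCat.of R (X ⟶ Y) ⟶ E X Y 0 :=
  ((G Y).fromLeftDerivedZero.app X).unop

lemma theta_pre {X X' : ModuleCat.{u} R} (g : X ⟶ X') (Y : ModuleCat.{u} R) :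
    theta X' Y ≫ Epre g Y 0 = ModuleCat.ofHom (Linear.leftComp R Y g) ≫ theta X Y := by
  apply Quiver.Hom.op_inj
  exact (G Y).fromLeftDerivedZero.naturality g

lemma theta_map (X : ModuleCat.{u} R) {Y Y' : ModuleCat.{u} R} (f : Y ⟶ Y') :
    theta X Y ≫ Emap X f 0 = ModuleCat.ofHom (Linear.rightComp R X f) ≫ theta X Y' := by
  apply Quiver.Hom.op_inj
  exact fromLeftDerivedZero_nat (Gmap f) X

instance theta_iso (X Y : ModuleCat.{u} R) : IsIso (theta X Y) := by
  unfold theta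
  exact isIso_unop _

end
end LC

namespace LC
noncomputable section
open CategoryTheory Opposite Limits
variable {R : Type u} [CommRing R] (J : Ideal R)

abbrev Xn (n : ℕ) : ModuleCat.{u} R :=
  (localCohomology.ringModIdeals (localCohomology.idealPowersDiagram J)).obj (op n)

abbrev trX {n N : ℕ} (h : n ≤ N) : Xn J N ⟶ Xn J n :=
  (localCohomology.ringModIdeals (localCohomology.idealPowersDiagram J)).map (homOfLE h).op

abbrev H (i : ℕ) (M : ModuleCat.{u} R) : ModuleCat.{u} R := (localCohomology J i).obj M

abbrev dia (i : ℕ) := localCohomology.diagram (localCohomology.idealPowersDiagram J) i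

def iota (n i : ℕ) (M : ModuleCat.{u} R) : E (Xn J n) M i ⟶ H J i M :=
  (colimit.ι (dia J i) (op (op n))).app M

lemma iota_tr {n N : ℕ} (h : n ≤ N) (i : ℕ) (M : ModuleCat.{u} R) :
    Epre (trX J h) M i ≫ iota J N i M = iota J n i M :=
  congr_app (colimit.w (dia J i) (homOfLE h).op.op) M

lemma iota_map (n i : ℕ) {M M' : ModuleCat.{u} R} (f : M ⟶ M') :
    iota J n i M ≫ (localCohomology J i).map f = Emap (Xn J n) f i ≫ iota J n i M' :=
  ((colimit.ι (dia J i) (op (op n))).naturality f).symm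

def isColim (i : ℕ) (M : ModuleCat.{u} R) :
    IsColimit (((evaluation _ _).obj M).mapCocone (colimit.cocone (dia J i))) :=
  isColimitOfPreserves ((evaluation _ _).obj M) (colimit.isColimit _)

instance presFil : PreservesFilteredColimitsOfSize.{0,0} (forget (ModuleCat.{u} R)) :=
  preservesFilteredColimitsOfSize_shrink.{0,u,0,u} _

instance presDia (F : ℕᵒᵖᵒᵖ ⥤ ModuleCat.{u} R) :
    PreservesColimit F (forget (ModuleCat.{u} R)) := by
  have : IsFiltered ℕᵒᵖᵒᵖ := IsFiltered.of_equivalence (opOpEquivalence ℕ).symm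
  infer_instance

lemma iota_surj (i : ℕ) (M : ModuleCat.{u} R) (x : H J i M) :
    ∃ n y, iota J n i M y = x := by
  obtain ⟨n, y, h⟩ := Concrete.isColimit_exists_rep _ (isColim J i M) x
  exact ⟨n.unop.unop, y, h⟩

lemma iota_zero (i : ℕ) (M : ModuleCat.{u} R) (n : ℕ) (y : E (Xn J n) M i)
    (h : iota J n i M y = 0) : ∃ (N : ℕ) (hN : n ≤ N), Epre (trX J hN) M i y = 0 := by
  have h0 : iota J n i M y = iota J n i M 0 := by rw [h, map_zero]
  obtain ⟨k, f, g, hfg⟩ := Concrete.isColimit_exists_of_rep_eq _ (isColim J i M) y 0 h0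
  refine ⟨k.unop.unop, leOfHom f.unop.unop, ?_⟩
  rw [map_zero] at hfg
  exact hfg

/-- The connecting map -/
def delta (S : ShortComplex (ModuleCat.{u} R)) (hS : S.ShortExact) (i : ℕ) :
    H J i S.X₃ ⟶ H J (i+1) S.X₁ :=
  (isColim J i S.X₃).desc
    { pt := H J (i+1) S.X₁
      ι := 
      { app := fun n => Edelta (Xn J n.unop.unop) S hS i ≫ iota J n.unop.unop (i+1) S.X₁
        naturality := fun n N f => by
          have h1 := Edelta_pre (trX J (leOfHom f.unop.unop)) hS i
          have h2 := iota_tr J (leOfHom f.unop.unop) (i+1) S.X₁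
          exact ((reassoc_of% h1) _).trans ((congrArg _ h2).trans (Category.comp_id _).symm) } }

lemma iota_delta (S : ShortComplex (ModuleCat.{u} R)) (hS : S.ShortExact) (n i : ℕ) :
    iota J n i S.X₃ ≫ delta J S hS i = Edelta (Xn J n) S hS i ≫ iota J n (i+1) S.X₁ :=
  (isColim J i S.X₃).fac _ (op (op n))

lemma H_hom_ext {i : ℕ} {M N : ModuleCat.{u} R} (f g : H J i M ⟶ N)
    (h : ∀ n, iota J n i M ≫ f = iota J n i M ≫ g) : f = g :=
  (isColim J i M).hom_ext (fun n => h n.unop.unop)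

lemma delta_natural {S T : ShortComplex (ModuleCat.{u} R)}
    (hS : S.ShortExact) (hT : T.ShortExact) (a : S ⟶ T) (i : ℕ) :
    (localCohomology J i).map a.τ₃ ≫ delta J T hT i =
      delta J S hS i ≫ (localCohomology J (i+1)).map a.τ₁ := by
  apply H_hom_ext
  intro n
  have h1 := iota_map J n i a.τ₃
  have h2 := iota_map J n (i+1) a.τ₁
  have h3 := iota_delta J S hS n i
  have h4 := iota_delta J T hT n i
  have h5 := Edelta_natural (Xn J n) hS hT a i
  rw [reassoc_of% h1, h4, reassoc_of% h3, h2, reassoc_of% h5]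

/-- passing exactness to the colimit -/
lemma colim_exact {a b c : ℕ} {A B C : ModuleCat.{u} R}
    (f : H J a A ⟶ H J b B) (g : H J b B ⟶ H J c C)
    (f' : ∀ n, E (Xn J n) A a ⟶ E (Xn J n) B b) (g' : ∀ n, E (Xn J n) B b ⟶ E (Xn J n) C c)
    (hf : ∀ n, iota J n a A ≫ f = f' n ≫ iota J n b B)
    (hg : ∀ n, iota J n b B ≫ g = g' n ≫ iota J n c C)
    (hg' : ∀ {n N : ℕ} (h : n ≤ N), Epre (trX J h) B b ≫ g' N = g' n ≫ Epre (trX J h) C c)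
    (hex : ∀ n, Function.Exact (f' n).hom (g' n).hom) : Function.Exact f.hom g.hom := by
  have hf1 : ∀ n y, f (iota J n a A y) = iota J n b B (f' n y) := fun n y => by
    rw [← ConcreteCategory.comp_apply, hf, ConcreteCategory.comp_apply]
  have hg1 : ∀ n y, g (iota J n b B y) = iota J n c C (g' n y) := fun n y => by
    rw [← ConcreteCategory.comp_apply, hg, ConcreteCategory.comp_apply]
  intro x
  constructor
  · intro hx
    obtain ⟨n, y, rfl⟩ := iota_surj J b B x
    have hx' : g (iota J n b B y) = 0 := hx
    rw [hg1] at hx'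
    obtain ⟨N, hN, h0⟩ := iota_zero J c C n _ hx'
    rw [← ConcreteCategory.comp_apply, ← hg' hN, ConcreteCategory.comp_apply] at h0
    obtain ⟨z, hz⟩ := (hex N _).1 h0
    refine ⟨iota J N a A z, ?_⟩
    refine (hf1 N z).trans ?_
    have hz' : f' N z = Epre (trX J hN) B b y := hz
    rw [hz', ← ConcreteCategory.comp_apply, iota_tr]
  · rintro ⟨x, rfl⟩
    obtain ⟨n, y, rfl⟩ := iota_surj J a A x
    change g (f (iota J n a A y)) = 0
    have := (hex n).apply_apply_eq_zero y
    have h' : g' n (f' n y) = 0 := this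
    rw [hf1, hg1, h', map_zero]

lemma Epre_Emap {X X' : ModuleCat.{u} R} (g : X ⟶ X') {Y Y' : ModuleCat.{u} R} (f : Y ⟶ Y')
    (i : ℕ) : Epre g Y i ≫ Emap X f i = Emap X' f i ≫ Epre g Y' i :=
  (((Ext R (ModuleCat.{u} R) i).map g.op).naturality f).symm

variable (S : ShortComplex (ModuleCat.{u} R)) (hS : S.ShortExact) (i : ℕ)

lemma H_exact₂ (S : ShortComplex (ModuleCat.{u} R)) (hS : S.ShortExact) (i : ℕ) : Function.Exact ((localCohomology J i).map S.f).hom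
    ((localCohomology J i).map S.g).hom :=
  colim_exact J _ _ (fun n => Emap (Xn J n) S.f i) (fun n => Emap (Xn J n) S.g i)
    (fun n => iota_map _ _ _ _) (fun n => iota_map _ _ _ _) (fun _ => Epre_Emap _ _ _)
    (fun n => E_exact₂ _ _ hS _)

lemma H_exact₃ : Function.Exact ((localCohomology J i).map S.g).hom
    (delta J S hS i).hom :=
  colim_exact J _ _ (fun n => Emap (Xn J n) S.g i) (fun n => Edelta (Xn J n) S hS i)
    (fun n => iota_map _ _ _ _) (fun n => iota_delta _ _ _ _ _) (fun _ => Edelta_pre _ _ _)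
    (fun n => E_exact₃ _ _ hS _)

lemma H_exact₁ : Function.Exact (delta J S hS i).hom ((localCohomology J (i+1)).map S.f).hom :=
  colim_exact J _ _ (fun n => Edelta (Xn J n) S hS i) (fun n => Emap (Xn J n) S.f (i+1)) 
    (fun n => iota_delta _ _ _ _ _) (fun n => iota_map _ _ _ _) (fun _ => Epre_Emap _ _ _)
    (fun n => E_exact₁ _ _ hS _)

lemma H_injective (M : ModuleCat.{u} R) [Injective M] : Subsingleton (H J (i+1) M) := by
  constructor
  have : ∀ x : H J (i+1) M, x = 0 := by
    intro x
    obtain ⟨n, y, rfl⟩ := iota_surj J _ _ x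
    have := E_injective (Xn J n) i M
    rw [Subsingleton.elim y 0, map_zero]
  intro a b
  rw [this a, this b]

/-- The homomorphism from `R/J^n` determined by a `J^n`-torsion element. -/
def homOf (n : ℕ) (M : ModuleCat.{u} R) :
    Submodule.torsionBySet R M ((J ^ n : Ideal R) : Set R) →ₗ[R] (Xn J n ⟶ M) where
  toFun u := ModuleCat.ofHom (Submodule.liftQ (J ^ n) (LinearMap.toSpanSingleton R M u.1) (by
    intro r hr
    have := (Submodule.mem_torsionBySet_iff _ _).1 u.2 ⟨r, hr⟩
    change r • u.1 = 0
    exact this))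
  map_add' u v := by
    apply ModuleCat.hom_ext
    apply Submodule.linearMap_qext
    ext
    change (1:R) • (u.1+v.1) = (1:R) • u.1 + (1:R) • v.1
    rw [smul_add]
  map_smul' r v := by
    apply ModuleCat.hom_ext
    apply Submodule.linearMap_qext
    ext
    change (1:R) • (r • v.1) = r • ((1:R) • v.1)
    rw [one_smul, one_smul]

lemma homOf_surj (n : ℕ) (M : ModuleCat.{u} R) (f : Xn J n ⟶ M) : ∃ u, homOf J n M u = f := by
  let q : R →ₗ[R] (R ⧸ (J ^ n)) := Submodule.mkQ (J ^ n)
  let f' : (R ⧸ (J ^ n)) →ₗ[R] M := f.hom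
  refine ⟨⟨f' (q 1), ?_⟩, ?_⟩
  · rw [Submodule.mem_torsionBySet_iff]
    rintro ⟨r, hr⟩
    change r • f' (q 1) = 0
    rw [← map_smul, ← map_smul]
    have : q (r • 1) = 0 := by simpa [q] using Ideal.Quotient.eq_zero_iff_mem.2 hr
    rw [this, map_zero]
  · apply ModuleCat.hom_ext
    apply Submodule.linearMap_qext
    ext
    change (1:R) • f' (q 1) = f' (q 1)
    simp

def mk0 (n : ℕ) (M : ModuleCat.{u} R) :
    Submodule.torsionBySet R M ((J ^ n : Ideal R) : Set R) →ₗ[R] H J 0 M :=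
  (theta (Xn J n) M ≫ iota J n 0 M).hom.comp (homOf J n M)

lemma mk0_surj (M : ModuleCat.{u} R) (x : H J 0 M) : ∃ n u, mk0 J n M u = x := by
  obtain ⟨n, y, rfl⟩ := iota_surj J _ _ x
  obtain ⟨z, rfl⟩ : ∃ z, theta (Xn J n) M z = y :=
    ((ConcreteCategory.isIso_iff_bijective _).1 (theta_iso (Xn J n) M)).2 y
  obtain ⟨u, rfl⟩ := homOf_surj J n M z
  exact ⟨n, u, rfl⟩

lemma mk0_le {n N : ℕ} (h : n ≤ N) (M : ModuleCat.{u} R) (u : M) (hu hu') :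
    mk0 J n M ⟨u, hu⟩ = mk0 J N M ⟨u, hu'⟩ := by
  change iota J n 0 M (theta (Xn J n) M (homOf J n M ⟨u, hu⟩)) =
    iota J N 0 M (theta (Xn J N) M (homOf J N M ⟨u, hu'⟩))
  rw [← iota_tr J h, ConcreteCategory.comp_apply, ← ConcreteCategory.comp_apply (theta _ _),
    theta_pre, ConcreteCategory.comp_apply]
  congr 2
  change trX J h ≫ homOf J n M ⟨u, hu⟩ = _
  apply ModuleCat.hom_ext
  apply Submodule.linearMap_qext
  ext
  rfl

lemma mk0_map (n : ℕ) {M N : ModuleCat.{u} R} (f : M ⟶ N) (u : M) (hu hu') :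
    (localCohomology J 0).map f (mk0 J n M ⟨u, hu⟩) = mk0 J n N ⟨f u, hu'⟩ := by
  change (localCohomology J 0).map f (iota J n 0 M (theta (Xn J n) M (homOf J n M ⟨u, hu⟩))) =
    iota J n 0 N (theta (Xn J n) N (homOf J n N ⟨f u, hu'⟩))
  rw [← ConcreteCategory.comp_apply, iota_map, ConcreteCategory.comp_apply,
    ← ConcreteCategory.comp_apply (theta _ _),
    theta_map, ConcreteCategory.comp_apply]
  congr 2
  change homOf J n M ⟨u, hu⟩ ≫ f = _
  apply ModuleCat.hom_ext
  apply Submodule.linearMap_qext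
  ext
  change f ((1 : R) • u) = (1 : R) • f u
  simp

end
end LC

namespace LC
noncomputable section
open CategoryTheory Opposite Limits
section mods
variable {R : Type u} [CommRing R] (J : Ideal R)

abbrev Hm (i : ℕ) (M : Type u) [AddCommGroup M] [Module R M] : Type u :=
  (localCohomology J i).obj (ModuleCat.of R M)

variable {M N P A B C A' B' C' : Type u} [AddCommGroup M] [Module R M] [AddCommGroup N] [Module R N]
  [AddCommGroup P] [Module R P]
  [AddCommGroup A] [Module R A] [AddCommGroup B] [Module R B] [AddCommGroup C] [Module R C]
  [AddCommGroup A'] [Module R A'] [AddCommGroup B'] [Module R B'] [AddCommGroup C'] [Module R C']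

def hmap (i : ℕ) (f : M →ₗ[R] N) : Hm J i M →ₗ[R] Hm J i N :=
  ((localCohomology J i).map (ModuleCat.ofHom f)).hom

lemma hmap_id (i : ℕ) (x : Hm J i M) : hmap J i (LinearMap.id : M →ₗ[R] M) x = x := by
  have : (localCohomology J i).map (ModuleCat.ofHom (LinearMap.id : M →ₗ[R] M)) = 𝟙 _ :=
    (localCohomology J i).map_id _
  simp only [hmap, this]
  rfl

lemma hmap_comp (i : ℕ) (f : M →ₗ[R] N) (g : N →ₗ[R] P) (x : Hm J i M) :
    hmap J i (g ∘ₗ f) x = hmap J i g (hmap J i f x) := by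
  have : (localCohomology J i).map (ModuleCat.ofHom (g ∘ₗ f)) = _ :=
    (localCohomology J i).map_comp (ModuleCat.ofHom f) (ModuleCat.ofHom g)
  simp only [hmap, this]
  rfl

structure SES (f : A →ₗ[R] B) (g : B →ₗ[R] C) : Prop where
  inj : Function.Injective f
  surj : Function.Surjective g
  ex : Function.Exact f g

variable {f : A →ₗ[R] B} {g : B →ₗ[R] C} {f' : A' →ₗ[R] B'} {g' : B' →ₗ[R] C'}

def SES.sc (h : SES f g) : ShortComplex (ModuleCat.{u} R) :=
  ShortComplex.mk (ModuleCat.ofHom f) (ModuleCat.ofHom g) (by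
    ext x; exact h.ex.apply_apply_eq_zero x)

lemma SES.se (h : SES f g) : h.sc.ShortExact where
  exact := (ShortComplex.ShortExact.moduleCat_exact_iff_function_exact _).2 h.ex
  mono_f := (ModuleCat.mono_iff_injective _).2 h.inj
  epi_g := (ModuleCat.epi_iff_surjective _).2 h.surj

def SES.del (h : SES f g) (i : ℕ) : Hm J i C →ₗ[R] Hm J (i+1) A := (delta J h.sc h.se i).hom

lemma SES.exact₁ (h : SES f g) (i : ℕ) : Function.Exact (h.del J i) (hmap J (i+1) f) :=
  H_exact₁ J h.sc h.se i
lemma SES.exact₂ (h : SES f g) (i : ℕ) : Function.Exact (hmap J i f) (hmap J i g) :=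
  H_exact₂ J h.sc h.se i
lemma SES.exact₃ (h : SES f g) (i : ℕ) : Function.Exact (hmap J i g) (h.del J i) :=
  H_exact₃ J h.sc h.se i

lemma SES.del_nat (h : SES f g) (h' : SES f' g') (a : A →ₗ[R] A') (b : B →ₗ[R] B')
    (c : C →ₗ[R] C') (hab : b ∘ₗ f = f' ∘ₗ a) (hbc : c ∘ₗ g = g' ∘ₗ b) (i : ℕ) (x : Hm J i C) :
    h'.del J i (hmap J i c x) = hmap J (i+1) a (h.del J i x) := by
  have := delta_natural J h.se h'.se (ShortComplex.Hom.mk (ModuleCat.ofHom a) (ModuleCat.ofHom b)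
    (ModuleCat.ofHom c) (by apply ModuleCat.hom_ext; exact hab.symm)
    (by apply ModuleCat.hom_ext; exact hbc.symm)) i
  exact congrArg (fun φ => φ.hom x) this

lemma sub_inj (E : Type u) [AddCommGroup E] [Module R E] (hE : Module.Injective R E) (i : ℕ) :
    Subsingleton (Hm J (i+1) E) := by
  have : Injective (ModuleCat.of R E) := Module.injective_object_of_injective_module R E
  exact H_injective J i _

lemma exists_emb (R : Type u) [CommRing R] (M : Type u) [AddCommGroup M] [Module R M] :
    ∃ (E : Type u) (_ : AddCommGroup E) (_ : Module R E) (j : M →ₗ[R] E),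
    Module.Injective R E ∧ Function.Injective j := by
  let I := Injective.under (ModuleCat.of R M)
  refine ⟨I, inferInstance, inferInstance, (Injective.ι (ModuleCat.of R M)).hom, ?_, ?_⟩
  · have : Injective (ModuleCat.of R I) := inferInstanceAs (Injective (Injective.under _))
    exact Module.injective_module_of_injective_object R I
  · exact (ModuleCat.mono_iff_injective _).1 inferInstance

lemma ses_quot (f : A →ₗ[R] B) (hf : Function.Injective f) :
    SES f (LinearMap.range f).mkQ := by
  refine ⟨hf, Submodule.mkQ_surjective _, ?_⟩
  rw [LinearMap.exact_iff, Submodule.ker_mkQ]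

lemma ses_sub (N : Submodule R M) : SES N.subtype N.mkQ := by
  refine ⟨N.injective_subtype, Submodule.mkQ_surjective _, ?_⟩
  rw [LinearMap.exact_iff, Submodule.ker_mkQ, Submodule.range_subtype]

lemma SES.del_surj (h : SES f g) (i : ℕ) (hB : Subsingleton (Hm J (i+1) B)) :
    Function.Surjective (h.del J i) := fun x =>
  (h.exact₁ J i x).1 (Subsingleton.elim _ _)

def m0 (n : ℕ) (M : Type u) [AddCommGroup M] [Module R M] :
    Submodule.torsionBySet R M ((J ^ n : Ideal R) : Set R) →ₗ[R] Hm J 0 M :=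
  mk0 J n (ModuleCat.of R M)

lemma m0_surj (x : Hm J 0 M) : ∃ n u, m0 J n M u = x := mk0_surj J _ x

lemma tors_map (n : ℕ) (f : M →ₗ[R] N)
    (u : Submodule.torsionBySet R M ((J ^ n : Ideal R) : Set R)) :
    f u.1 ∈ Submodule.torsionBySet R N ((J ^ n : Ideal R) : Set R) := by
  rw [Submodule.mem_torsionBySet_iff]
  intro r
  rw [← map_smul, (Submodule.mem_torsionBySet_iff _ _).1 u.2 r, map_zero]

lemma m0_map (n : ℕ) (f : M →ₗ[R] N) (u : Submodule.torsionBySet R M ((J ^ n : Ideal R) : Set R)) :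
    hmap J 0 f (m0 J n M u) = m0 J n N ⟨f u.1, tors_map J n f u⟩ :=
  mk0_map J n (ModuleCat.ofHom f) u.1 u.2 (tors_map J n f u)

lemma hmap_lin (i : ℕ) : ∀ {M N : Type u} [AddCommGroup M] [Module R M] [AddCommGroup N]
    [Module R N] (r : R) (f g : M →ₗ[R] N) (x : Hm J i M),
    hmap J i (r • f + g) x = r • hmap J i f x + hmap J i g x := by
  induction i with
  | zero =>
    intro M N _ _ _ _ r f g x
    obtain ⟨n, u, rfl⟩ := m0_surj J x
    rw [m0_map, m0_map, m0_map, ← map_smul, ← map_add]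
    rfl
  | succ i ih =>
    intro M N _ _ _ _ r f g x
    obtain ⟨E, _, _, j, hE, hj⟩ := exists_emb R M
    obtain ⟨E', _, _, j', hE', hj'⟩ := exists_emb R N
    have s := ses_quot j hj
    have s' := ses_quot j' hj'
    obtain ⟨y, rfl⟩ := s.del_surj J i (sub_inj J E hE i) x
    obtain ⟨F, hF⟩ := hE'.out j hj (j' ∘ₗ f)
    obtain ⟨G, hG⟩ := hE'.out j hj (j' ∘ₗ g)
    have hF' : LinearMap.range j ≤ (LinearMap.range j').comap F := by
      rintro _ ⟨m, rfl⟩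
      exact ⟨f m, (hF m).symm⟩
    have hG' : LinearMap.range j ≤ (LinearMap.range j').comap G := by
      rintro _ ⟨m, rfl⟩
      exact ⟨g m, (hG m).symm⟩
    rw [← s.del_nat J s' f F (Submodule.mapQ _ _ F hF') (by ext m; exact hF m) (by ext m; rfl),
      ← s.del_nat J s' g G (Submodule.mapQ _ _ G hG') (by ext m; exact hG m) (by ext m; rfl),
      ← s.del_nat J s' (r • f + g) (r • F + G)
        (r • Submodule.mapQ _ _ F hF' + Submodule.mapQ _ _ G hG')
        (by ext m
            have h1 := hF m
            have h2 := hG m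
            simp only [LinearMap.comp_apply] at h1 h2
            simp [h1, h2]) (by ext m; rfl), ih, map_add, map_smul]

lemma hmap_zero (i : ℕ) (x : Hm J i M) : hmap J i (0 : M →ₗ[R] N) x = 0 := by
  have := hmap_lin J i (1 : R) (0 : M →ₗ[R] N) 0 x
  simpa using this

lemma hmap_smul (i : ℕ) (r : R) (f : M →ₗ[R] N) (x : Hm J i M) :
    hmap J i (r • f) x = r • hmap J i f x := by
  have := hmap_lin J i r f 0 x
  rwa [add_zero, hmap_zero, add_zero] at this

lemma hmap_add (i : ℕ) (f g : M →ₗ[R] N) (x : Hm J i M) :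
    hmap J i (f + g) x = hmap J i f x + hmap J i g x := by
  have := hmap_lin J i 1 f g x
  rwa [one_smul, one_smul] at this

lemma hmap_sum (i : ℕ) {ι : Type*} (s : Finset ι) (f : ι → M →ₗ[R] N) (x : Hm J i M) :
    hmap J i (∑ k ∈ s, f k) x = ∑ k ∈ s, hmap J i (f k) x := by
  classical
  induction s using Finset.induction_on with
  | empty => simp [hmap_zero]
  | insert a s ha ih => rw [Finset.sum_insert ha, Finset.sum_insert ha, hmap_add, ih]

lemma Hm_tors (i : ℕ) : ∀ {M : Type u} [AddCommGroup M] [Module R M] (x : Hm J i M),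
    ∃ n : ℕ, ∀ r ∈ J ^ n, r • x = 0 := by
  induction i with
  | zero =>
    intro M _ _ x
    obtain ⟨n, u, rfl⟩ := m0_surj J x
    refine ⟨n, fun r hr => ?_⟩
    rw [← map_smul]
    have : r • u = 0 := Subtype.ext ((Submodule.mem_torsionBySet_iff _ _).1 u.2 ⟨r, hr⟩)
    rw [this, map_zero]
  | succ i ih =>
    intro M _ _ x
    obtain ⟨E, _, _, j, hE, hj⟩ := exists_emb R M
    have s := ses_quot j hj
    obtain ⟨y, rfl⟩ := s.del_surj J i (sub_inj J E hE i) x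
    obtain ⟨n, hn⟩ := ih y
    refine ⟨n, fun r hr => ?_⟩
    rw [← map_smul, hn r hr, map_zero]

/-- every element is killed by a power of the ideal -/
def IsTors (M : Type u) [AddCommGroup M] [Module R M] : Prop :=
  ∀ u : M, ∃ n : ℕ, ∀ r ∈ J ^ n, r • u = 0

lemma hmap0_surj (f : M →ₗ[R] N) (hf : Function.Surjective f) (hM : IsTors J M) :
    Function.Surjective (hmap J 0 f) := by
  intro x
  obtain ⟨n, ⟨u, hu⟩, rfl⟩ := m0_surj J x
  obtain ⟨v, rfl⟩ := hf u
  obtain ⟨k, hk⟩ := hM v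
  have hv : v ∈ Submodule.torsionBySet R M ((J ^ (max n k) : Ideal R) : Set R) := by
    rw [Submodule.mem_torsionBySet_iff]
    exact fun r => hk _ (Ideal.pow_le_pow_right (le_max_right _ _) r.2)
  refine ⟨m0 J (max n k) M ⟨v, hv⟩, ?_⟩
  rw [m0_map]
  exact (mk0_le J (le_max_left _ _) (ModuleCat.of R N) (f v) _ _).symm

/-- the torsion submodule -/
def Gam (M : Type u) [AddCommGroup M] [Module R M] : Submodule R M where
  carrier := {u | ∃ n : ℕ, ∀ r ∈ J ^ n, r • u = 0}
  zero_mem' := ⟨0, fun r _ => smul_zero r⟩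
  add_mem' := by
    rintro a b ⟨n, hn⟩ ⟨k, hk⟩
    refine ⟨max n k, fun r hr => ?_⟩
    rw [smul_add, hn r (Ideal.pow_le_pow_right (le_max_left _ _) hr),
      hk r (Ideal.pow_le_pow_right (le_max_right _ _) hr), add_zero]
  smul_mem' := by
    rintro c a ⟨n, hn⟩
    refine ⟨n, fun r hr => ?_⟩
    rw [smul_comm, hn r hr, smul_zero]

lemma Gam_tors : IsTors J (Gam J M) := by
  rintro ⟨u, n, hn⟩
  exact ⟨n, fun r hr => Subtype.ext (hn r hr)⟩

lemma Gam_pow [IsNoetherianRing R] [Module.Finite R M] :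
    ∃ t : ℕ, ∀ u ∈ Gam J M, ∀ r ∈ J ^ t, r • u = 0 := by
  obtain ⟨s, hs⟩ := (IsNoetherian.noetherian (Gam J M) : (Gam J M).FG)
  have : ∀ s : Finset M, (↑s : Set M) ⊆ Gam J M → ∃ t : ℕ, ∀ u ∈ s, ∀ r ∈ J ^ t, r • u = 0 := by
    classical
    intro s
    induction s using Finset.induction_on with
    | empty => intro _; exact ⟨0, by simp⟩
    | insert a s ha ih =>
      intro h
      obtain ⟨t, ht⟩ := ih (fun x hx => h (by simp [Finset.mem_coe.1 hx]))
      obtain ⟨k, hk⟩ := h (show a ∈ _ by simp)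
      refine ⟨max t k, fun u hu r hr => ?_⟩
      rcases Finset.mem_insert.1 hu with rfl | hu
      · exact hk r (Ideal.pow_le_pow_right (le_max_right _ _) hr)
      · exact ht u hu r (Ideal.pow_le_pow_right (le_max_left _ _) hr)
  obtain ⟨t, ht⟩ := this s (by rw [← hs]; exact Submodule.subset_span)
  refine ⟨t, fun u hu r hr => ?_⟩
  rw [← hs] at hu
  have hle : Submodule.span R (s : Set M) ≤ LinearMap.ker (LinearMap.lsmul R M r) :=
    Submodule.span_le.2 (fun v hv => ht v hv r hr)
  exact hle hu

lemma Gam_inj [IsNoetherianRing R] (E : Type u) [AddCommGroup E] [Module R E]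
    (hE : Module.Injective R E) : Module.Injective R (Gam J E) := by
  apply Module.Baer.injective
  intro I g
  -- the image of g is killed by a power of J
  obtain ⟨t, ht⟩ : ∃ t : ℕ, ∀ r ∈ J ^ t, ∀ x : I, r • g x = 0 := by
    obtain ⟨t, ht⟩ := Gam_pow J (M := LinearMap.range g)
    refine ⟨t, fun r hr x => ?_⟩
    have := ht ⟨g x, x, rfl⟩ (by
      obtain ⟨n, hn⟩ := Gam_tors J (g x)
      exact ⟨n, fun r hr => Subtype.ext (hn r hr)⟩) r hr
    exact congrArg Subtype.val this
  obtain ⟨k, hk⟩ := Ideal.exists_pow_inf_eq_pow_smul (M := R) J I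
  have hk' := hk (k + t) (Nat.le_add_right _ _)
  rw [Nat.add_sub_cancel_left] at hk'
  have h0 : ∀ x : I, x.1 ∈ J ^ (k+t) → g x = 0 := by
    rintro ⟨x, hxI⟩ hx
    have h1 : x ∈ J ^ t • (J ^ k • (⊤ : Submodule R R) ⊓ I) := by
      rw [← hk']
      refine ⟨?_, hxI⟩
      simpa using hx
    have h2 : J ^ t • (J ^ k • (⊤ : Submodule R R) ⊓ I) ≤
        (LinearMap.ker g).map I.subtype := by
      rw [Submodule.smul_le]
      rintro r hr y ⟨_, hy⟩
      exact ⟨r • ⟨y, hy⟩, by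
        rw [SetLike.mem_coe, LinearMap.mem_ker, map_smul]; exact ht r hr _, rfl⟩
    obtain ⟨y, hy, hyx⟩ := h2 h1
    have : y = ⟨x, hxI⟩ := Subtype.ext hyx
    rw [← this]; exact hy
  -- map from (I + J^(k+t)) / J^(k+t)
  let K : Ideal R := J ^ (k + t)
  let q : I →ₗ[R] (R ⧸ K) := K.mkQ ∘ₗ I.subtype
  let g' : I →ₗ[R] E := (Gam J E).subtype ∘ₗ g
  have hker : LinearMap.ker q ≤ LinearMap.ker g' := by
    intro x hx
    have hx' : x.1 ∈ K := by
      have : K.mkQ x.1 = 0 := hx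
      rwa [← LinearMap.mem_ker, Submodule.ker_mkQ] at this
    have := h0 x hx'
    simp [g', this]
  let φ : (I ⧸ LinearMap.ker q) →ₗ[R] E := (LinearMap.ker q).liftQ g' hker
  let ψ : (I ⧸ LinearMap.ker q) →ₗ[R] (R ⧸ K) := (LinearMap.ker q).liftQ q le_rfl
  have hψ : Function.Injective ψ := by
    rw [← LinearMap.ker_eq_bot]
    exact Submodule.ker_liftQ_eq_bot _ _ _ le_rfl
  obtain ⟨h, hh⟩ := hE.out ψ hψ φ
  let e : E := h (K.mkQ 1)
  have he : e ∈ Gam J E := by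
    refine ⟨k + t, fun r hr => ?_⟩
    rw [← map_smul, ← map_smul]
    have : K.mkQ (r • 1) = 0 := by
      rw [← LinearMap.mem_ker, Submodule.ker_mkQ]; simpa using hr
    rw [this, map_zero]
  refine ⟨LinearMap.toSpanSingleton R _ ⟨e, he⟩, fun x hx => ?_⟩
  apply Subtype.ext
  change x • e = (g ⟨x, hx⟩).1
  rw [← map_smul, ← map_smul]
  have := hh (Submodule.Quotient.mk ⟨x, hx⟩)
  change h (K.mkQ x) = _ at this
  rw [smul_eq_mul, mul_one, this]
  rfl

lemma tors_quot (hM : IsTors J M) (L : Submodule R M) : IsTors J (M ⧸ L) := by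
  intro u
  obtain ⟨v, rfl⟩ := L.mkQ_surjective u
  obtain ⟨n, hn⟩ := hM v
  exact ⟨n, fun r hr => by rw [← map_smul, hn r hr, map_zero]⟩

lemma Hm_tors_zero [IsNoetherianRing R] (i : ℕ) : ∀ {M : Type u} [AddCommGroup M] [Module R M]
    (_ : IsTors J M), Subsingleton (Hm J (i+1) M) := by
  induction i with
  | zero =>
    intro M _ _ hM
    obtain ⟨E, _, _, j, hE, hj⟩ := exists_emb R M
    let j' : M →ₗ[R] Gam J E := j.codRestrict _ (fun u => by
      obtain ⟨n, hn⟩ := hM u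
      exact ⟨n, fun r hr => by rw [← map_smul, hn r hr, map_zero]⟩)
    have hj' : Function.Injective j' := fun a b h => hj (congrArg Subtype.val h)
    have s := ses_quot j' hj'
    constructor
    have : ∀ x : Hm J 1 M, x = 0 := by
      intro x
      obtain ⟨y, rfl⟩ := s.del_surj J 0 (sub_inj J _ (Gam_inj J E hE) 0) x
      obtain ⟨z, rfl⟩ := hmap0_surj J _ s.surj (Gam_tors J) y
      exact (s.exact₃ J 0).apply_apply_eq_zero z
    intro a b; rw [this a, this b]
  | succ i ih =>
    intro M _ _ hM
    obtain ⟨E, _, _, j, hE, hj⟩ := exists_emb R M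
    let j' : M →ₗ[R] Gam J E := j.codRestrict _ (fun u => by
      obtain ⟨n, hn⟩ := hM u
      exact ⟨n, fun r hr => by rw [← map_smul, hn r hr, map_zero]⟩)
    have hj' : Function.Injective j' := fun a b h => hj (congrArg Subtype.val h)
    have s := ses_quot j' hj'
    have := ih (tors_quot J (Gam_tors J (M := E)) (LinearMap.range j'))
    exact (s.del_surj J _ (sub_inj J _ (Gam_inj J E hE) _)).subsingleton

end mods
end
end LC

namespace LC
noncomputable section
open CategoryTheory Opposite Limits
section art
open IsLocalRing

lemma stab {R : Type*} [CommRing R] {N : Type*} [AddCommGroup N] [Module R N] (K : Submodule R N)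
    [IsArtinian R K] (f : ℕ → Submodule R N) (hf : Antitone f) (hK : ∀ n, f n ≤ K) :
    ∃ n, ∀ k, n ≤ k → f k = f n := by
  let F : ℕ →o (Submodule R K)ᵒᵈ :=
    ⟨fun n => OrderDual.toDual ((f n).comap K.subtype), fun a b h => by
      change (f b).comap _ ≤ (f a).comap _
      exact Submodule.comap_mono (hf h)⟩
  obtain ⟨n, hn⟩ := monotone_stabilizes_iff_artinian.2 (inferInstance : IsArtinian R K) F
  refine ⟨n, fun k hk => ?_⟩
  have h : (f n).comap K.subtype = (f k).comap K.subtype := hn k hk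
  apply le_antisymm (hf hk)
  intro u hu
  have : (⟨u, hK n hu⟩ : K) ∈ (f k).comap K.subtype := by rw [← h]; exact hu
  exact this

lemma melkersson {R : Type*} [CommRing R] {N : Type*} [AddCommGroup N] [Module R N] (x : R)
    (hx : ∀ u : N, ∃ n : ℕ, x ^ n • u = 0)
    (hK : IsArtinian R (Submodule.torsionBy R N x)) : IsArtinian R N := by
  rw [← monotone_stabilizes_iff_artinian]
  intro F
  let f : ℕ → Submodule R N := fun n => OrderDual.ofDual (F n)
  have hf : Antitone f := fun a b h => F.monotone h
  let A : ℕ → ℕ → Submodule R N := fun n j =>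
    (f j ⊓ Submodule.torsionBy R N (x ^ (n+1))).map (LinearMap.lsmul R N (x ^ n))
  have memA : ∀ n j v, v ∈ A n j ↔ ∃ u ∈ f j, x ^ (n+1) • u = 0 ∧ x ^ n • u = v := by
    intro n j v
    constructor
    · rintro ⟨u, ⟨h1, h2⟩, h3⟩
      exact ⟨u, h1, by simpa using h2, h3⟩
    · rintro ⟨u, h1, h2, h3⟩
      exact ⟨u, ⟨h1, by simpa using h2⟩, h3⟩
  have hAj : ∀ n, Antitone (A n) := fun n a b h => Submodule.map_mono (inf_le_inf_right _ (hf h))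
  have hAn1 : ∀ j n, A (n+1) j ≤ A n j := by
    intro j n v hv
    obtain ⟨u, h1, h2, h3⟩ := (memA _ _ _).1 hv
    refine (memA _ _ _).2 ⟨x • u, (f j).smul_mem _ h1, ?_, ?_⟩
    · rw [← mul_smul, ← pow_succ]; exact h2
    · rw [← mul_smul, ← pow_succ]; exact h3
  have hAn : ∀ j, Antitone (fun n => A n j) := fun j => antitone_nat_of_succ_le (hAn1 j)
  have hAK : ∀ n j, A n j ≤ Submodule.torsionBy R N x := by
    intro n j v hv
    obtain ⟨u, h1, h2, rfl⟩ := (memA _ _ _).1 hv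
    rw [Submodule.mem_torsionBy_iff, ← mul_smul, ← pow_succ']; exact h2
  obtain ⟨j0, hj0⟩ := stab _ (fun n => A n n) (fun a b h => (hAj b h).trans (hAn a h))
    (fun n => hAK n n)
  choose g hg using fun n => stab _ (A n) (hAj n) (hAK n)
  have key : ∃ k, ∀ n j, k ≤ j → A n j = A n k := by
    refine ⟨j0 + ∑ n ∈ Finset.range j0, g n, fun n j hj => ?_⟩
    by_cases hn : n < j0
    · have : g n ≤ j0 + ∑ n ∈ Finset.range j0, g n :=
        (Finset.single_le_sum (f := g) (fun _ _ => Nat.zero_le _)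
          (Finset.mem_range.2 hn)).trans (Nat.le_add_left _ _)
      rw [hg n _ (this.trans hj), hg n _ this]
    · have : ∀ j, j0 ≤ j → A n j = A j0 j0 := by
        intro j hj
        apply le_antisymm ((hAj n hj).trans (hAn j0 (not_lt.1 hn)))
        change A j0 j0 ≤ A n j
        rw [← hj0 (max n j) (hj.trans (le_max_right _ _))]
        exact (hAj _ (le_max_right _ _)).trans (hAn j (le_max_left _ _))
      rw [this j (by omega), this _ (by omega)]
  obtain ⟨k, hk⟩ := key
  refine ⟨k, fun j hj => ?_⟩
  change f k = f j
  apply le_antisymm _ (hf hj)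
  have : ∀ n : ℕ, ∀ u ∈ f k, x ^ n • u = 0 → u ∈ f j := by
    intro n
    induction n with
    | zero => intro u _ h; simp at h; rw [h]; exact zero_mem _
    | succ n ih =>
      intro u hu h
      have h1 : x ^ n • u ∈ A n k := (memA _ _ _).2 ⟨u, hu, h, rfl⟩
      rw [← hk n j hj] at h1
      obtain ⟨v, hv, hv2, hv3⟩ := (memA _ _ _).1 h1
      have := ih (u - v) (sub_mem hu (hf hj hv)) (by rw [smul_sub, hv3, sub_self])
      simpa using add_mem this hv
  intro u hu
  obtain ⟨n, hn⟩ := hx u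
  exact this n u hu hn

variable {R : Type u} [CommRing R] [IsLocalRing R] [IsNoetherianRing R]
local notation "𝔪" => maximalIdeal R

lemma art_of_pow (t : ℕ) : ∀ {M : Type u} [AddCommGroup M] [Module R M] [Module.Finite R M],
    (∀ u : M, ∀ r ∈ 𝔪 ^ t, r • u = 0) → IsArtinian R M := by
  induction t with
  | zero =>
    intro M _ _ _ h
    have : Subsingleton M := ⟨fun a b => by
      have h1 := h a 1 (by simp)
      have h2 := h b 1 (by simp)
      rw [one_smul] at h1 h2
      rw [h1, h2]⟩
    infer_instance
  | succ t ih =>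
    intro M _ _ _ h
    rw [isArtinian_iff_submodule_quotient (𝔪 • ⊤ : Submodule R M)]
    constructor
    · apply ih
      rintro ⟨u, hu⟩ r hr
      apply Subtype.ext
      change r • u = 0
      have : 𝔪 • (⊤ : Submodule R M) ≤ LinearMap.ker (LinearMap.lsmul R M r) := by
        rw [Submodule.smul_le]
        intro s hs v _
        change r • s • v = 0
        rw [← mul_smul]
        exact h v _ (by rw [pow_succ]; exact Ideal.mul_mem_mul hr hs)
      exact this hu
    · have : Module.Finite (R ⧸ 𝔪) (M ⧸ (𝔪 • ⊤ : Submodule R M)) :=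
        Module.Finite.of_restrictScalars_finite R _ _
      letI := Ideal.Quotient.field 𝔪
      have : IsArtinian (R ⧸ 𝔪) (M ⧸ (𝔪 • ⊤ : Submodule R M)) := inferInstance
      exact isArtinian_of_surjective_algebraMap (S := R) (R := R ⧸ 𝔪) Ideal.Quotient.mk_surjective

lemma soc_finite {N : Type u} [AddCommGroup N] [Module R N] (h : IsArtinian R N) :
    Module.Finite (R ⧸ 𝔪) (Submodule.torsionBySet R N (𝔪 : Set R)) := by
  letI := Ideal.Quotient.field 𝔪
  have : IsArtinian (R ⧸ 𝔪) (Submodule.torsionBySet R N (𝔪 : Set R)) := isArtinian_of_tower R inferInstance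
  exact ((IsSemisimpleModule.finite_tfae (R := R ⧸ 𝔪)).out 2 0).1 this

lemma avoid (T : Set (Ideal R)) (hT : T.Finite) (hp : ∀ p ∈ T, p.IsPrime) (I : Ideal R)
    (hI : ∀ p ∈ T, ¬ I ≤ p) : ∃ x ∈ I, ∀ p ∈ T, x ∉ p := by
  by_contra hcon
  push Not at hcon
  obtain ⟨p, hp, hIp⟩ := (Ideal.subset_union_prime_finite hT (f := id) ⊤ ⊤
    (fun p h _ _ => hp p h) (I := I)).1 (by
      intro x hx
      obtain ⟨p, h1, h2⟩ := hcon x hx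
      exact Set.mem_biUnion h1 h2)
  exact hI p hp hIp

/-- existence of filter regular elements avoiding finitely many nonmaximal primes -/
lemma exists_filter (M : Type u) [AddCommGroup M] [Module R M] [Module.Finite R M]
    (T : Set (Ideal R)) (hT : T.Finite) (hp : ∀ p ∈ T, p.IsPrime ∧ p ≠ 𝔪) :
    ∃ x ∈ 𝔪, (∀ p ∈ T, x ∉ p) ∧ ∀ u : M, x • u ∈ Gam 𝔪 M → u ∈ Gam 𝔪 M := by
  let L := Gam 𝔪 M
  obtain ⟨t, ht⟩ := Gam_pow 𝔪 (M := M)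
  have hass : ∀ p ∈ associatedPrimes R (M ⧸ L), p ≠ 𝔪 := by
    intro p hp he
    have hp' := hp
    simp only [AssociatedPrimes.mem_iff, isAssociatedPrime_iff] at hp'
    obtain ⟨hp1, v, hv⟩ := hp'
    obtain ⟨u, rfl⟩ := L.mkQ_surjective v
    have h1 : ∀ r ∈ 𝔪, r • u ∈ L := by
      intro r hr
      rw [← he, hv, Submodule.mem_colon_singleton, Submodule.mem_bot, ← map_smul,
        ← LinearMap.mem_ker, Submodule.ker_mkQ] at hr
      exact hr
    have h2 : u ∈ L := by
      refine ⟨t + 1, fun r hr => ?_⟩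
      have : 𝔪 ^ (t+1) ≤ LinearMap.ker (LinearMap.toSpanSingleton R M u) := by
        rw [pow_succ, Ideal.mul_le]
        intro r hr s hs
        change (r * s) • u = 0
        rw [mul_smul]
        exact ht _ (h1 s hs) r hr
      exact this hr
    apply hp1.ne_top
    rw [hv, Ideal.eq_top_iff_one, Submodule.mem_colon_singleton, one_smul, Submodule.mem_bot,
      ← LinearMap.mem_ker, Submodule.ker_mkQ]
    exact h2
  obtain ⟨x, hx, hxT⟩ := avoid (T ∪ associatedPrimes R (M ⧸ L))
    (hT.union (associatedPrimes.finite R _))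
    (by
      rintro p (h | h)
      · exact (hp p h).1
      · exact h.1) 𝔪
    (by
      rintro p (h | h) hle
      · exact (hp p h).2 ((maximalIdeal.isMaximal R).eq_of_le (hp p h).1.ne_top hle).symm
      · exact hass p h ((maximalIdeal.isMaximal R).eq_of_le h.1.ne_top hle).symm)
  refine ⟨x, hx, fun p h => hxT p (Or.inl h), fun u hu => ?_⟩
  by_contra hu'
  have h1 : x ∈ {r : R | ∃ v : M ⧸ L, v ≠ 0 ∧ r • v = 0} := by
    refine ⟨L.mkQ u, ?_, ?_⟩
    · rw [ne_eq, ← LinearMap.mem_ker, Submodule.ker_mkQ]; exact hu'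
    · rw [← map_smul, ← LinearMap.mem_ker, Submodule.ker_mkQ]; exact hu
  rw [← biUnion_associatedPrimes_eq_zero_divisors] at h1
  simp only [Set.mem_iUnion] at h1
  obtain ⟨p, hp, hxp⟩ := h1
  exact hxT p (Or.inr hp) hxp

lemma filter_pow {M : Type u} [AddCommGroup M] [Module R M] {x : R}
    (h : ∀ u : M, x • u ∈ Gam 𝔪 M → u ∈ Gam 𝔪 M) (n : ℕ) :
    ∀ u : M, x ^ n • u ∈ Gam 𝔪 M → u ∈ Gam 𝔪 M := by
  induction n with
  | zero => intro u hu; simpa using hu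
  | succ n ih => intro u hu; rw [pow_succ, mul_smul] at hu; exact h _ (ih _ hu)

/-- multiplication by x as a map onto xM -/
def toX (M : Type u) [AddCommGroup M] [Module R M] (x : R) :
    M →ₗ[R] (Ideal.span {x} • ⊤ : Submodule R M) :=
  (LinearMap.lsmul R M x).codRestrict _ (fun u =>
    Submodule.smul_mem_smul (Ideal.mem_span_singleton_self x) trivial)

lemma toX_surj (M : Type u) [AddCommGroup M] [Module R M] (x : R) :
    Function.Surjective (toX M x) := by
  rintro ⟨v, hv⟩
  rw [Submodule.ideal_span_singleton_smul] at hv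
  obtain ⟨u, -, hu⟩ := hv
  exact ⟨u, Subtype.ext hu⟩

lemma toX_inj (M : Type u) [AddCommGroup M] [Module R M] (x : R)
    (hx : ∀ u : M, x • u ∈ Gam 𝔪 M → u ∈ Gam 𝔪 M) (i : ℕ) :
    Function.Injective (hmap 𝔪 (i+1) (toX M x)) := by
  rw [injective_iff_map_eq_zero]
  intro ξ hξ
  have s : SES (LinearMap.ker (toX M x)).subtype (toX M x) :=
    ⟨Submodule.injective_subtype _, toX_surj M x, by
      rw [LinearMap.exact_iff, Submodule.range_subtype]⟩
  obtain ⟨η, rfl⟩ := (s.exact₂ 𝔪 (i+1) ξ).1 hξ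
  have ht : IsTors 𝔪 (LinearMap.ker (toX M x)) := by
    rintro ⟨u, hu⟩
    have : x • u = 0 := congrArg Subtype.val hu
    obtain ⟨n, hn⟩ := hx u (by rw [this]; exact zero_mem _)
    exact ⟨n, fun r hr => Subtype.ext (hn r hr)⟩
  have := Hm_tors_zero 𝔪 i ht
  rw [Subsingleton.elim η 0, map_zero]

lemma toX_key (M : Type u) [AddCommGroup M] [Module R M] (x : R) (i : ℕ) (ξ : Hm 𝔪 (i+1) M)
    (hξ : x • ξ = 0) : ∃ η, (ses_sub (Ideal.span {x} • ⊤ : Submodule R M)).del 𝔪 i η =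
      hmap 𝔪 (i+1) (toX M x) ξ := by
  apply ((ses_sub (Ideal.span {x} • ⊤ : Submodule R M)).exact₁ 𝔪 i _).1
  rw [← hmap_comp]
  have : (Submodule.subtype _) ∘ₗ toX M x = x • LinearMap.id := by ext u; rfl
  rw [this, hmap_smul, hmap_id, hξ]

lemma Hm_art (i : ℕ) : ∀ (M : Type u) [AddCommGroup M] [Module R M] [Module.Finite R M],
    IsArtinian R (Hm 𝔪 i M) := by
  induction i with
  | zero =>
    intro M _ _ _
    obtain ⟨t, ht⟩ := Gam_pow 𝔪 (M := M)
    have h1 : IsArtinian R (Submodule.torsionBySet R M ((𝔪 ^ t : Ideal R) : Set R)) :=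
      art_of_pow t (fun u r hr =>
        Subtype.ext ((Submodule.mem_torsionBySet_iff _ _).1 u.2 ⟨r, hr⟩))
    refine isArtinian_of_surjective _ (m0 𝔪 t M) (fun x => ?_)
    obtain ⟨n, ⟨u, hu⟩, rfl⟩ := m0_surj 𝔪 x
    have hG : u ∈ Gam 𝔪 M := ⟨n, fun r hr => (Submodule.mem_torsionBySet_iff _ _).1 hu ⟨r, hr⟩⟩
    have h2 : ∀ k, t ≤ k → u ∈ Submodule.torsionBySet R M ((𝔪 ^ k : Ideal R) : Set R) := by
      intro k hk
      rw [Submodule.mem_torsionBySet_iff]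
      exact fun r => ht u hG r (Ideal.pow_le_pow_right hk r.2)
    refine ⟨⟨u, h2 t le_rfl⟩, ?_⟩
    exact (mk0_le 𝔪 (le_max_left t n) (ModuleCat.of R M) u _ (h2 _ (le_max_left t n))).trans
      (mk0_le 𝔪 (le_max_right t n) (ModuleCat.of R M) u _ _).symm
  | succ i ih =>
    intro M _ _ _
    obtain ⟨x, hx, -, hreg⟩ := exists_filter (R := R) M ∅ Set.finite_empty (by simp)
    apply melkersson x
    · intro ξ
      obtain ⟨n, hn⟩ := Hm_tors 𝔪 (i+1) ξ
      exact ⟨n, hn _ (Ideal.pow_mem_pow hx n)⟩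
    · have := ih (M ⧸ (Ideal.span {x} • ⊤ : Submodule R M))
      let D := (ses_sub (Ideal.span {x} • ⊤ : Submodule R M)).del 𝔪 i
      let φ : Submodule.torsionBy R (Hm 𝔪 (i+1) M) x →ₗ[R] LinearMap.range D :=
        ((hmap 𝔪 (i+1) (toX M x)) ∘ₗ Submodule.subtype _).codRestrict _ (fun ξ => by
          obtain ⟨η, hη⟩ := toX_key M x i ξ.1 ((Submodule.mem_torsionBy_iff _ _).1 ξ.2)
          exact ⟨η, hη⟩)
      apply isArtinian_of_injective φ
      intro a b h
      exact Subtype.ext (toX_inj M x hreg i (congrArg Subtype.val h))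

end art
end
end LC

namespace LC
noncomputable section
open CategoryTheory Opposite Limits
section dims
variable {R : Type u} [CommRing R] [IsLocalRing R] [IsNoetherianRing R]
local notation "𝔪" => maximalIdeal R

lemma mdim_eq (M : Type u) [AddCommGroup M] [Module R M] [Module.Finite R M] :
    mdim R M = Module.supportDim R M :=
  (Module.supportDim_eq_ringKrullDim_quotient_annihilator R M).symm

lemma mem_supp_quot {M : Type u} [AddCommGroup M] [Module R M] [Module.Finite R M] (I : Ideal R)
    (p : PrimeSpectrum R) : p ∈ Module.support R (M ⧸ (I • ⊤ : Submodule R M)) ↔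
      Module.annihilator R M ≤ p.asIdeal ∧ I ≤ p.asIdeal := by
  rw [Module.support_quotient, Set.mem_inter_iff, Module.mem_support_iff_of_finite,
    PrimeSpectrum.mem_zeroLocus]
  rfl

lemma len_le {α : Type*} [Preorder α] (p : LTSeries α) : (p.length : WithBot ℕ∞) ≤ Order.krullDim α :=
  le_iSup (fun p : LTSeries α => (p.length : WithBot ℕ∞)) p

lemma castle {a b : ℕ} : ((a : ℕ) : WithBot ℕ∞) ≤ ((b : ℕ) : WithBot ℕ∞) ↔ a ≤ b :=
  WithBot.coe_le_coe.trans Nat.cast_le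

lemma lt_succ_le {x : WithBot ℕ∞} {d : ℕ} (h : x < ((d + 1 : ℕ) : WithBot ℕ∞)) :
    x ≤ (d : WithBot ℕ∞) := by
  induction x using WithBot.recBotCoe with
  | bot => exact bot_le
  | coe x =>
    have h1 : x < ((d + 1 : ℕ) : ℕ∞) := WithBot.coe_lt_coe.1 h
    rw [Nat.cast_add, Nat.cast_one] at h1
    exact WithBot.coe_le_coe.2 ((ENat.lt_add_one_iff (ENat.coe_ne_top d)).1 h1)

lemma dimD (M : Type u) [AddCommGroup M] [Module R M] [Module.Finite R M] (d : ℕ)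
    (hM : mdim R M ≤ ((d + 1 : ℕ) : WithBot ℕ∞)) (y : R)
    (hy : ∀ p ∈ (Module.annihilator R M).minimalPrimes, y ∈ p →
      ringKrullDim (R ⧸ p) ≤ (d : WithBot ℕ∞)) :
    mdim R (M ⧸ (Ideal.span {y} • ⊤ : Submodule R M)) ≤ (d : WithBot ℕ∞) := by
  rw [mdim_eq] at hM ⊢
  refine iSup_le (fun p => ?_)
  have hs : ∀ q : Module.support R (M ⧸ (Ideal.span {y} • ⊤ : Submodule R M)),
      q.1 ∈ Module.support R M := fun q => by
    rw [Module.mem_support_iff_of_finite]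
    exact ((mem_supp_quot _ _).1 q.2).1
  obtain ⟨r, hrm, hr⟩ := Ideal.exists_minimalPrimes_le ((mem_supp_quot _ _).1 p.head.2).1
  by_cases hyr : y ∈ r
  · have h1 := hy r hrm hyr
    rw [ringKrullDim_quotient] at h1
    refine le_trans ?_ h1
    have hp : ∀ k, r ≤ (p k).1.asIdeal := fun k => hr.trans (p.head_le k)
    let q : LTSeries (PrimeSpectrum.zeroLocus (R := R) (r : Set R)) :=
      { length := p.length
        toFun := fun k => ⟨(p k).1, hp k⟩
        step := fun k => p.step k }
    exact len_le q
  · let q : LTSeries (Module.support R M) :=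
      p.map (fun q => ⟨q.1, hs q⟩) (fun _ _ h => h)
    let r' : Module.support R M := ⟨⟨r, hrm.1.1⟩, by
      rw [Module.mem_support_iff_of_finite]; exact hrm.1.2⟩
    have hlt : r' < q.head := by
      refine lt_of_le_of_ne hr (fun h => hyr ?_)
      have h2 : y ∈ p.head.1.asIdeal := ((mem_supp_quot _ _).1 p.head.2).2
        (Ideal.mem_span_singleton_self y)
      have h3 : r = p.head.1.asIdeal := congrArg (fun z => z.1.asIdeal) h
      rw [h3]; exact h2
    have := (len_le (q.cons r' hlt)).trans hM
    have h4 : ((p.length + 1 : ℕ) : WithBot ℕ∞) ≤ ((d + 1 : ℕ) : WithBot ℕ∞) := by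
      have hl : (q.cons r' hlt).length = p.length + 1 := RelSeries.cons_length _ _ _
      rw [hl] at this
      exact this
    have h5 : p.length + 1 ≤ d + 1 := castle.1 h4
    have h6 : p.length ≤ d := by omega
    exact castle.2 h6

/-- properties of good elements -/
lemma dim_good (M : Type u) [AddCommGroup M] [Module R M] [Module.Finite R M] (d : ℕ)
    (hM : mdim R M ≤ ((d + 1 : ℕ) : WithBot ℕ∞)) (y : R)
    (hy : ∀ p ∈ (Module.annihilator R M).minimalPrimes, p ≠ 𝔪 → y ∉ p) :
    mdim R (M ⧸ (Ideal.span {y} • ⊤ : Submodule R M)) ≤ (d : WithBot ℕ∞) := by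
  apply dimD M d hM
  intro p hp hyp
  have : p = 𝔪 := by
    by_contra h
    exact hy p hp h hyp
  subst this
  letI := Ideal.Quotient.field 𝔪
  rw [ringKrullDim_eq_zero_of_field]
  exact_mod_cast Nat.zero_le d

lemma exists_good (M : Type u) [AddCommGroup M] [Module R M] [Module.Finite R M] :
    ∃ x ∈ 𝔪, ∀ n : ℕ, (∀ p ∈ (Module.annihilator R M).minimalPrimes, p ≠ 𝔪 → x ^ n ∉ p) ∧
      ∀ u : M, x ^ n • u ∈ Gam 𝔪 M → u ∈ Gam 𝔪 M := by
  obtain ⟨x, hx, h1, h2⟩ := exists_filter M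
    {p | p ∈ (Module.annihilator R M).minimalPrimes ∧ p ≠ 𝔪}
    ((Ideal.finite_minimalPrimes_of_isNoetherianRing R _).subset (fun p h => h.1))
    (fun p h => ⟨h.1.1.1, h.2⟩)
  refine ⟨x, hx, fun n => ⟨fun p hp hpm h => ?_, filter_pow h2 n⟩⟩
  have := hp.1.1
  exact h1 p ⟨hp, hpm⟩ (this.mem_of_pow_mem n h)

lemma sop_iff (M : Type u) [AddCommGroup M] [Module R M] [Module.Finite R M] (d : ℕ)
    (x : Fin d → R) : IsSOP R M d x ↔ (∀ i, x i ∈ 𝔪) ∧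
      ∃ t : ℕ, 𝔪 ^ t • (⊤ : Submodule R M) ≤ Ideal.span (Set.range x) • ⊤ := by
  refine and_congr_right (fun _ => ?_)
  set N : Submodule R M := Ideal.span (Set.range x) • ⊤
  constructor
  · intro h
    have hA := (isFiniteLength_iff_isNoetherian_isArtinian.1 h).2
    obtain ⟨t, ht⟩ := stab (⊤ : Submodule R (M ⧸ N)) (fun t => 𝔪 ^ t • ⊤)
      (fun a b h => Submodule.smul_mono_left (Ideal.pow_le_pow_right h)) (fun _ => le_top)
    refine ⟨t, ?_⟩
    have h1 : (𝔪 ^ t • ⊤ : Submodule R (M ⧸ N)) = ⊥ := by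
      apply Submodule.eq_bot_of_le_smul_of_le_jacobson_bot 𝔪 _ (IsNoetherian.noetherian _)
      · rw [← mul_smul, ← pow_succ']
        exact (ht (t+1) (Nat.le_succ t)).ge
      · rw [IsLocalRing.jacobson_eq_maximalIdeal _ bot_ne_top]
    have h2 : Submodule.map N.mkQ (𝔪 ^ t • ⊤) = ⊥ := by
      rw [Submodule.map_smul'', Submodule.map_top, Submodule.range_mkQ, h1]
    rw [← le_bot_iff, Submodule.map_le_iff_le_comap] at h2
    rwa [← Submodule.ker_mkQ N]
  · rintro ⟨t, ht⟩
    refine isFiniteLength_iff_isNoetherian_isArtinian.2 ⟨inferInstance, art_of_pow t ?_⟩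
    intro u r hr
    obtain ⟨v, rfl⟩ := N.mkQ_surjective u
    rw [← map_smul, ← LinearMap.mem_ker, Submodule.ker_mkQ]
    exact ht (Submodule.smul_mem_smul hr trivial)

lemma comap_quot {M : Type u} [AddCommGroup M] [Module R M] (I : Ideal R) (N : Submodule R M)
    (u : M) : N.mkQ u ∈ (I • ⊤ : Submodule R (M ⧸ N)) ↔ u ∈ N ⊔ I • ⊤ := by
  rw [← Submodule.comap_map_mkQ, Submodule.mem_comap, Submodule.map_smul'', Submodule.map_top,
    Submodule.range_mkQ]

lemma sop_cons (M : Type u) [AddCommGroup M] [Module R M] [Module.Finite R M] (d : ℕ)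
    (y : R) (hy : y ∈ 𝔪) (z : Fin d → R)
    (hz : IsSOP R (M ⧸ (Ideal.span {y} • ⊤ : Submodule R M)) d z) :
    IsSOP R M (d+1) (Fin.cons y z) := by
  rw [sop_iff] at hz ⊢
  obtain ⟨h1, t, ht⟩ := hz
  refine ⟨fun i => ?_, t, ?_⟩
  · refine Fin.cases ?_ (fun j => ?_) i
    · exact hy
    · exact h1 j
  · rw [Fin.range_cons, Set.insert_eq, Ideal.span_union, Submodule.sup_smul]
    intro u hu
    rw [← comap_quot]
    apply ht
    rw [comap_quot]
    exact Submodule.mem_sup_right hu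

lemma exists_sop (d : ℕ) : ∀ (M : Type u) [AddCommGroup M] [Module R M] [Module.Finite R M],
    mdim R M ≤ (d : WithBot ℕ∞) → ∃ x, IsSOP R M d x := by
  induction d with
  | zero =>
    intro M _ _ _ hM
    refine ⟨Fin.elim0, ?_⟩
    rw [sop_iff]
    refine ⟨fun i => i.elim0, ?_⟩
    rw [mdim_eq] at hM
    have : 𝔪 ≤ (Module.annihilator R M).radical := by
      rw [Ideal.radical_eq_sInf]
      refine le_sInf (fun q ⟨hq, hp⟩ => ?_)
      by_contra hne
      have hlt : q < 𝔪 := lt_of_le_of_ne (le_maximalIdeal hp.ne_top) (fun h => hne h.ge)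
      let a : Module.support R M := ⟨⟨q, hp⟩, by
        rw [Module.mem_support_iff_of_finite]; exact hq⟩
      let b : Module.support R M := ⟨⟨𝔪, inferInstance⟩, by
        rw [Module.mem_support_iff_of_finite]; exact hq.trans hlt.le⟩
      have hab : a < b := hlt
      let s : LTSeries (Module.support R M) := (RelSeries.singleton _ b).cons a hab
      have h1 := (len_le s).trans hM
      have h2 : ((1 : ℕ) : WithBot ℕ∞) ≤ ((0 : ℕ) : WithBot ℕ∞) := h1
      have h3 : 1 ≤ 0 := by exact_mod_cast h2
      omega
    obtain ⟨t, ht⟩ := Ideal.exists_pow_le_of_le_radical_of_fg this (IsNoetherian.noetherian _)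
    refine ⟨t, ?_⟩
    rw [Submodule.smul_le]
    intro r hr u _
    rw [Module.mem_annihilator.1 (ht hr) u]
    exact zero_mem _
  | succ d ih =>
    intro M _ _ _ hM
    obtain ⟨x, hx, h⟩ := exists_good (R := R) M
    obtain ⟨z, hz⟩ := ih _ (dim_good M d hM (x ^ 1) (h 1).1)
    exact ⟨_, sop_cons M d (x ^ 1) (by simpa using hx) z hz⟩

lemma mem_b (M : Type u) [AddCommGroup M] [Module R M] (d : ℕ) (c : R) :
    c ∈ bIdeal R M d ↔ ∀ x : Fin d → R, IsSOP R M d x → ∀ (i : Fin d) (u : M),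
      x i • u ∈ (Ideal.span (x '' {j | j < i}) • ⊤ : Submodule R M) →
      c • u ∈ (Ideal.span (x '' {j | j < i}) • ⊤ : Submodule R M) := by
  simp only [bIdeal, Submodule.mem_iInf, Module.mem_annihilator]
  refine forall_congr' fun x => forall_congr' fun hx => forall_congr' fun i => ?_
  set N : Submodule R M := Ideal.span (x '' {j | j < i}) • ⊤
  constructor
  · intro h u hu
    have h1 : N.mkQ u ∈ Submodule.torsionBy R (M ⧸ N) (x i) := by
      rw [Submodule.mem_torsionBy_iff, ← map_smul, ← LinearMap.mem_ker, Submodule.ker_mkQ]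
      exact hu
    have h2 := congrArg Subtype.val (h ⟨_, h1⟩)
    have h3 : c • N.mkQ u = 0 := h2
    rwa [← map_smul, ← LinearMap.mem_ker, Submodule.ker_mkQ] at h3
  · rintro h ⟨v, hv⟩
    obtain ⟨u, rfl⟩ := N.mkQ_surjective v
    apply Subtype.ext
    change c • N.mkQ u = 0
    rw [Submodule.mem_torsionBy_iff, ← map_smul, ← LinearMap.mem_ker, Submodule.ker_mkQ] at hv
    rw [← map_smul, ← LinearMap.mem_ker, Submodule.ker_mkQ]
    exact h u hv

lemma image_cons (d : ℕ) (y : R) (z : Fin d → R) (i : Fin d) :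
    Ideal.span ((Fin.cons y z : Fin (d+1) → R) '' {j | j < i.succ}) =
      Ideal.span {y} ⊔ Ideal.span (z '' {j | j < i}) := by
  rw [← Ideal.span_union]
  congr 1
  ext r
  simp only [Set.mem_image, Set.mem_setOf_eq, Set.mem_union, Set.mem_singleton_iff]
  constructor
  · rintro ⟨j, hj, rfl⟩
    revert hj
    refine Fin.cases ?_ (fun k => ?_) j
    · intro _; left; rfl
    · intro hk; right; exact ⟨k, by simpa using hk, rfl⟩
  · rintro (rfl | ⟨j, hj, rfl⟩)
    · exact ⟨0, Fin.succ_pos i, rfl⟩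
    · exact ⟨j.succ, by simpa using hj, rfl⟩

lemma b_quot (M : Type u) [AddCommGroup M] [Module R M] [Module.Finite R M] (d : ℕ) (c : R)
    (hc : c ∈ bIdeal R M (d+1)) (y : R) (hy : y ∈ 𝔪) :
    c ∈ bIdeal R (M ⧸ (Ideal.span {y} • ⊤ : Submodule R M)) d := by
  rw [mem_b] at hc ⊢
  intro z hz i v hv
  obtain ⟨u, rfl⟩ := Submodule.mkQ_surjective _ v
  rw [← map_smul, comap_quot] at hv ⊢
  have := hc _ (sop_cons M d y hy z hz) i.succ u
  rw [image_cons, Submodule.sup_smul] at this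
  exact this hv

lemma b_kills (M : Type u) [AddCommGroup M] [Module R M] [Module.Finite R M] (d : ℕ) (c : R)
    (hc : c ∈ bIdeal R M (d+1)) (y : R) (hy : y ∈ 𝔪)
    (hdim : mdim R (M ⧸ (Ideal.span {y} • ⊤ : Submodule R M)) ≤ (d : WithBot ℕ∞))
    (u : M) (hu : y • u = 0) : c • u = 0 := by
  obtain ⟨z, hz⟩ := exists_sop d _ hdim
  rw [mem_b] at hc
  have := hc _ (sop_cons M d y hy z hz) 0 u
  have he : {j : Fin (d+1) | j < 0} = ∅ := by ext j; simp
  simp only [he, Set.image_empty, Ideal.span_empty, Submodule.bot_smul, Submodule.mem_bot,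
    Fin.cons_zero] at this
  exact this hu

/-- Schenzel: b kills the lower local cohomology -/
lemma schenzel (i : ℕ) : ∀ (M : Type u) [AddCommGroup M] [Module R M] [Module.Finite R M] (d : ℕ),
    i < d → mdim R M ≤ (d : WithBot ℕ∞) → ∀ c ∈ bIdeal R M d, ∀ ξ : Hm 𝔪 i M, c • ξ = 0 := by
  induction i with
  | zero =>
    intro M _ _ _ d hd hM c hc ξ
    obtain ⟨d, rfl⟩ : ∃ e, d = e + 1 := ⟨d - 1, by omega⟩
    obtain ⟨n, u, rfl⟩ := m0_surj 𝔪 ξ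
    obtain ⟨x, hx, h⟩ := exists_good (R := R) M
    rw [← map_smul]
    have : c • u = 0 := by
      apply Subtype.ext
      refine b_kills M d c hc (x ^ (n+1)) (Ideal.pow_mem_of_mem _ hx _ (Nat.succ_pos n))
        (dim_good M d hM _ (h _).1) u.1 ?_
      exact (Submodule.mem_torsionBySet_iff _ _).1 u.2
        ⟨_, Ideal.pow_le_pow_right (Nat.le_succ n) (Ideal.pow_mem_pow hx (n+1))⟩
    rw [this, map_zero]
  | succ i ih =>
    intro M _ _ _ d hd hM c hc ξ
    obtain ⟨d, rfl⟩ : ∃ e, d = e + 1 := ⟨d - 1, by omega⟩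
    obtain ⟨x, hx, h⟩ := exists_good (R := R) M
    obtain ⟨n, hn⟩ := Hm_tors 𝔪 (i+1) ξ
    have hxm : x ^ (n+1) ∈ 𝔪 := Ideal.pow_mem_of_mem _ hx _ (Nat.succ_pos n)
    obtain ⟨η, hη⟩ := toX_key M (x ^ (n+1)) i ξ
      (hn _ (Ideal.pow_le_pow_right (Nat.le_succ n) (Ideal.pow_mem_pow hx (n+1))))
    apply toX_inj M (x ^ (n+1)) (h (n+1)).2 i
    rw [map_zero, map_smul, ← hη, ← map_smul,
      ih _ d (by omega) (dim_good M d hM _ (h _).1) c (b_quot M d c hc _ hxm) η, map_zero]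

lemma b_unmixed (M : Type u) [AddCommGroup M] [Module R M] [Module.Finite R M] (d : ℕ)
    (hM : mdim R M = ((d+1 : ℕ) : WithBot ℕ∞)) (c : R) (hc : c ∈ bIdeal R M (d+1)) (u : M)
    (hu : u ∈ unmixedComp R M) : c • u = 0 := by
  have : unmixedComp R M ≤ Submodule.torsionBy R M c := by
    refine sSup_le ?_
    rintro P ⟨-, hP⟩
    have htop : mdim R (⊤ : Submodule R M) = mdim R M := by
      rw [mdim_eq, mdim_eq, Module.supportDim_eq_of_equiv Submodule.topEquiv]
    rw [htop, hM] at hP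
    intro v hv
    rw [Submodule.mem_torsionBy_iff]
    by_cases hv0 : v = 0
    · rw [hv0, smul_zero]
    set A := Module.annihilator R P
    have hA : A ≤ 𝔪 := by
      apply le_maximalIdeal
      intro h
      have := Module.mem_annihilator.1 (show (1 : R) ∈ A by rw [h]; trivial) ⟨v, hv⟩
      rw [one_smul] at this
      exact hv0 (congrArg Subtype.val this)
    obtain ⟨y, hyA, hy⟩ := avoid {p | p ∈ (Module.annihilator R M).minimalPrimes ∧ ¬ A ≤ p}
      ((Ideal.finite_minimalPrimes_of_isNoetherianRing R _).subset (fun p h => h.1))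
      (fun p h => h.1.1.1) A (fun p h => h.2)
    refine b_kills M d c hc y (hA hyA) (dimD M d hM.le y ?_) v ?_
    · intro p hp hyp
      have hAp : A ≤ p := by
        by_contra h
        exact hy p ⟨hp, h⟩ hyp
      have h1 : ringKrullDim (R ⧸ p) ≤ mdim R P :=
        ringKrullDim_le_of_surjective (Ideal.Quotient.factor hAp)
          (Ideal.Quotient.factor_surjective hAp)
      have h2 := lt_of_le_of_lt h1 hP
      exact lt_succ_le h2
    · exact congrArg Subtype.val (Module.mem_annihilator.1 hyA ⟨v, hv⟩)
  exact (Submodule.mem_torsionBy_iff _ _).1 (this hu)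

lemma param_unmixed (M : Type u) [AddCommGroup M] [Module R M] [Module.Finite R M] (d : ℕ)
    (hM : mdim R M = ((d+1 : ℕ) : WithBot ℕ∞)) (a : R) (ha : IsParamElement R M (d+1) a) :
    Submodule.torsionBy R M a ≤ unmixedComp R M := by
  refine le_sSup ⟨le_top, ?_⟩
  have htop : mdim R (⊤ : Submodule R M) = mdim R M := by
    rw [mdim_eq, mdim_eq, Module.supportDim_eq_of_equiv Submodule.topEquiv]
  rw [htop, hM]
  obtain ⟨x, hx, i, rfl⟩ := ha
  obtain ⟨hxm, t, ht⟩ := (sop_iff _ _ _).1 hx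
  set N := Submodule.torsionBy R M (x i)
  set A := Module.annihilator R N with hA
  refine lt_of_le_of_lt (b := ((d : ℕ) : WithBot ℕ∞)) ?_ (by exact_mod_cast Nat.lt_succ_self d)
  change ringKrullDim (R ⧸ A) ≤ _
  by_cases hAt : A = ⊤
  · have : Subsingleton (R ⧸ A) := Ideal.Quotient.subsingleton_iff.2 hAt
    rw [ringKrullDim_eq_bot_of_subsingleton]
    exact bot_le
  have : Nontrivial (R ⧸ A) := Ideal.Quotient.nontrivial_iff.2 hAt
  have hloc : IsLocalRing (R ⧸ A) :=
    IsLocalRing.of_surjective' (Ideal.Quotient.mk A) Ideal.Quotient.mk_surjective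
  classical
  let S : Finset (R ⧸ A) := (Finset.univ.erase i).image (fun j => Ideal.Quotient.mk A (x j))
  have hS : (S : Set (R ⧸ A)) ⊆ maximalIdeal (R ⧸ A) := by
    intro s hs
    obtain ⟨j, -, rfl⟩ := Finset.mem_image.1 (Finset.mem_coe.1 hs)
    have : IsLocalHom (Ideal.Quotient.mk A) := IsLocalHom.of_surjective _ Ideal.Quotient.mk_surjective
    exact (IsLocalRing.mem_maximalIdeal _).2 (fun hu =>
      (IsLocalRing.mem_maximalIdeal _).1 (hxm j)
        (isUnit_of_map_unit (Ideal.Quotient.mk A) _ hu))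
  refine (ringKrullDim_le_ringKrullDim_add_card hS).trans ?_
  have hcard : S.card ≤ d := by
    refine Finset.card_image_le.trans ?_
    rw [Finset.card_erase_of_mem (Finset.mem_univ _)]
    simp
  have h0 : ringKrullDim ((R ⧸ A) ⧸ Ideal.span (S : Set (R ⧸ A))) ≤ 0 := by
    have : Ring.KrullDimLE 0 ((R ⧸ A) ⧸ Ideal.span (S : Set (R ⧸ A))) := by
      refine Ring.KrullDimLE.mk₀ (fun q hq => ?_)
      let f : R →+* ((R ⧸ A) ⧸ Ideal.span (S : Set (R ⧸ A))) :=
        (Ideal.Quotient.mk _).comp (Ideal.Quotient.mk A)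
      have hf : Function.Surjective f :=
        Ideal.Quotient.mk_surjective.comp Ideal.Quotient.mk_surjective
      let p : Ideal R := q.comap f
      have hp : p.IsPrime := Ideal.IsPrime.comap f
      have hAp : A ≤ p := by
        intro r hr
        change f r ∈ q
        have : f r = 0 := by
          change Ideal.Quotient.mk _ (Ideal.Quotient.mk A r) = 0
          rw [Ideal.Quotient.eq_zero_iff_mem.2 hr, map_zero]
        rw [this]; exact zero_mem _
      have hxp : ∀ j, x j ∈ p := by
        intro j
        by_cases hj : j = i
        · apply hAp
          rw [hj, hA, Module.mem_annihilator]
          rintro ⟨u, hu⟩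
          exact Subtype.ext ((Submodule.mem_torsionBy_iff _ _).1 hu)
        · change f (x j) ∈ q
          have : f (x j) = 0 := by
            change Ideal.Quotient.mk _ (Ideal.Quotient.mk A (x j)) = 0
            apply Ideal.Quotient.eq_zero_iff_mem.2
            apply Ideal.subset_span
            exact Finset.mem_coe.2 (Finset.mem_image.2 ⟨j, by simp [hj], rfl⟩)
          rw [this]; exact zero_mem _
      have hMA : Module.annihilator R M ≤ A := by
        intro r hr
        rw [hA, Module.mem_annihilator]
        rintro ⟨u, hu⟩
        exact Subtype.ext (Module.mem_annihilator.1 hr u)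
      have hsupp : (⟨p, hp⟩ : PrimeSpectrum R) ∈
          Module.support R (M ⧸ (Ideal.span (Set.range x) • ⊤ : Submodule R M)) := by
        rw [mem_supp_quot]
        refine ⟨hMA.trans hAp, Ideal.span_le.2 ?_⟩
        rintro _ ⟨j, rfl⟩
        exact hxp j
      rw [Module.mem_support_iff_of_finite] at hsupp
      have hmp : 𝔪 ≤ p := by
        refine Ideal.IsPrime.le_of_pow_le (hP := hp) (n := t) (le_trans ?_ hsupp)
        intro r hr
        rw [Module.mem_annihilator]
        intro v
        obtain ⟨u, rfl⟩ := Submodule.mkQ_surjective _ v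
        rw [← map_smul, ← LinearMap.mem_ker, Submodule.ker_mkQ]
        exact ht (Submodule.smul_mem_smul hr trivial)
      have hpm : p.IsMaximal := by
        rw [← (maximalIdeal.isMaximal R).eq_of_le hp.ne_top hmp]
        infer_instance
      have hmap : Ideal.map f p = q := Ideal.map_comap_of_surjective f hf q
      rcases Ideal.map_eq_top_or_isMaximal_of_surjective f hf hpm with h | h
      · exact absurd (hmap.symm.trans h) hq.ne_top
      · exact hmap ▸ h
    exact Ring.krullDimLE_iff.1 this
  calc _ ≤ (0 : WithBot ℕ∞) + (d : WithBot ℕ∞) := by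
        refine add_le_add h0 ?_
        exact_mod_cast hcard
    _ = _ := zero_add _

end dims
end
end LC

namespace LC
noncomputable section
open CategoryTheory Opposite Limits
section fin
variable {R : Type u} [CommRing R]

lemma mul_sum {I J : Ideal R} {a : R} (ha : a ∈ I * J) :
    ∃ (s : ℕ) (x y : Fin s → R), (∀ j, x j ∈ I) ∧ (∀ j, y j ∈ J) ∧ a = ∑ j, x j * y j := by
  induction ha using Submodule.mul_induction_on' with
  | mem_mul_mem m hm n hn =>
    exact ⟨1, fun _ => m, fun _ => n, fun _ => hm, fun _ => hn, by simp⟩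
  | add x hx y hy h1 h2 =>
    obtain ⟨s, p, q, hp, hq, rfl⟩ := h1
    obtain ⟨t, p', q', hp', hq', rfl⟩ := h2
    refine ⟨s + t, Fin.append p p', Fin.append q q', ?_, ?_, ?_⟩
    · intro j; refine Fin.addCases (fun k => ?_) (fun k => ?_) j
      · simpa using hp k
      · simpa using hp' k
    · intro j; refine Fin.addCases (fun k => ?_) (fun k => ?_) j
      · simpa using hq k
      · simpa using hq' k
    · simp [Fin.sum_univ_add]

/-- the map `M/U → M` given by multiplication by `e` -/
def iot {M : Type u} [AddCommGroup M] [Module R M] (U : Submodule R M) (e : R)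
    (h : ∀ u ∈ U, e • u = 0) : (M ⧸ U) →ₗ[R] M :=
  U.liftQ (e • LinearMap.id) (fun u hu => LinearMap.mem_ker.2 (h u hu))

lemma iot_mk {M : Type u} [AddCommGroup M] [Module R M] (U : Submodule R M) (e : R)
    (h : ∀ u ∈ U, e • u = 0) (u : M) : iot U e h (U.mkQ u) = e • u := rfl

/-- the map on socles -/
def socMap (I : Ideal R) {A B : Type u} [AddCommGroup A] [Module R A] [AddCommGroup B] [Module R B]
    (f : A →ₗ[R] B) : Submodule.torsionBySet R A (I : Set R) →ₗ[R ⧸ I]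
      Submodule.torsionBySet R B (I : Set R) where
  toFun x := ⟨f x.1, (Submodule.mem_torsionBySet_iff _ _).2 (fun r => by
    rw [← map_smul, (Submodule.mem_torsionBySet_iff _ _).1 x.2 r, map_zero])⟩
  map_add' x y := Subtype.ext (map_add f x.1 y.1)
  map_smul' r x := by
    obtain ⟨r, rfl⟩ := Ideal.Quotient.mk_surjective r
    exact Subtype.ext (map_smul f r x.1)

end fin

section fin2
variable {R : Type u} [CommRing R] [IsLocalRing R] [IsNoetherianRing R]
local notation "𝔪" => maximalIdeal R

lemma soc_add {A B C : Type u} [AddCommGroup A] [Module R A] [AddCommGroup B] [Module R B]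
    [AddCommGroup C] [Module R C] (f : A →ₗ[R] B) (g : B →ₗ[R] C) (hf : Function.Injective f)
    (hfg : Function.Exact f g)
    (hg : ∀ ξ : C, (∀ r ∈ 𝔪, r • ξ = 0) → ∃ ζ : B, (∀ r ∈ 𝔪, r • ζ = 0) ∧ g ζ = ξ)
    (hB : IsArtinian R B) : socDim R 𝔪 B = socDim R 𝔪 A + socDim R 𝔪 C := by
  letI := Ideal.Quotient.field 𝔪
  have := soc_finite hB
  have hsurj : LinearMap.range (socMap 𝔪 g) = ⊤ := by
    rw [LinearMap.range_eq_top]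
    rintro ⟨ξ, hξ⟩
    obtain ⟨ζ, h1, h2⟩ := hg ξ (fun r hr => (Submodule.mem_torsionBySet_iff _ _).1 hξ ⟨r, hr⟩)
    exact ⟨⟨ζ, (Submodule.mem_torsionBySet_iff _ _).2 (fun r => h1 r r.2)⟩, Subtype.ext h2⟩
  have hinj : Function.Injective (socMap 𝔪 f) := fun x y h =>
    Subtype.ext (hf (congrArg Subtype.val h))
  have hker : LinearMap.ker (socMap 𝔪 g) = LinearMap.range (socMap 𝔪 f) := by
    apply le_antisymm
    · rintro ⟨z, hz⟩ h
      have h0 : g z = 0 := congrArg Subtype.val h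
      obtain ⟨w, rfl⟩ := (hfg z).1 h0
      refine ⟨⟨w, (Submodule.mem_torsionBySet_iff _ _).2 (fun r => hf ?_)⟩, rfl⟩
      rw [map_smul, map_zero]
      exact (Submodule.mem_torsionBySet_iff _ _).1 hz r
    · rintro _ ⟨w, rfl⟩
      exact Subtype.ext (hfg.apply_apply_eq_zero w.1)
  have h := LinearMap.finrank_range_add_finrank_ker (socMap 𝔪 g)
  rw [hsurj, hker, LinearMap.finrank_range_of_inj hinj, finrank_top] at h
  unfold socDim
  rw [add_comm]
  exact h.symm

lemma kill_mul {M N : Type u} [AddCommGroup M] [Module R M] [AddCommGroup N] [Module R N]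
    (U : Submodule R M) (I b : Ideal R)
    (hb : ∀ e ∈ b, ∀ u ∈ U, e • u = 0) (i : ℕ) (ξ : Hm 𝔪 i (M ⧸ U))
    (hI : ∀ c ∈ I, ∀ f : (M ⧸ U) →ₗ[R] M, c • hmap 𝔪 i f ξ = 0) (e : R) (he : e ∈ I * b)
    (hU : ∀ u ∈ U, e • u = 0) : hmap 𝔪 i (iot U e hU) ξ = 0 := by
  have hle : I * b ≤ b := Ideal.mul_le_right
  induction he using Submodule.mul_induction_on' with
  | mem_mul_mem c hc n hn =>
    have : iot U (c * n) hU = c • iot U n (hb n hn) := by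
      ext u
      exact mul_smul c n u
    rw [this, hmap_smul, hI c hc]
  | add x hx y hy h1 h2 =>
    have hx' := hb x (hle hx)
    have hy' := hb y (hle hy)
    have : iot U (x + y) hU = iot U x hx' + iot U y hy' := by
      ext u
      exact add_smul x y u
    rw [this, hmap_add, h1, h2, add_zero]

set_option maxHeartbeats 1000000 in
theorem main (M : Type u) [AddCommGroup M] [Module R M] [Module.Finite R M] (d : ℕ)
    (hM : mdim R M = ((d+1 : ℕ) : WithBot ℕ∞)) (a : R) (ha : a ∈ (bIdeal R M (d+1)) ^ 3)
    (hpe : IsParamElement R M (d+1) a) (i : ℕ) (hi : i ≤ d) :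
    socH R (M ⧸ (Ideal.span {a} • ⊤ : Submodule R M)) i
      = socH R M i + socH R (M ⧸ unmixedComp R M) (i + 1) := by
  set b := bIdeal R M (d+1) with hbdef
  set U := unmixedComp R M with hUdef
  have hb : ∀ e ∈ b, ∀ u ∈ U, e • u = 0 := fun e he u hu => b_unmixed M d hM e he u hu
  have hs : ∀ c ∈ b, ∀ ξ : Hm 𝔪 i M, c • ξ = 0 :=
    schenzel i M (d+1) (Nat.lt_succ_of_le hi) hM.le
  have ham : a ∈ 𝔪 := by
    obtain ⟨x, hx, j, rfl⟩ := hpe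
    exact hx.1 j
  have ha1 : a ∈ b * (𝔪 * b) := by
    by_cases hbt : b = ⊤
    · rw [hbt, Ideal.top_mul, Ideal.mul_top]; exact ham
    · have : b ≤ 𝔪 := le_maximalIdeal hbt
      have h3 : b ^ 3 ≤ b * (𝔪 * b) := by
        rw [pow_succ, pow_two, mul_assoc]
        exact Ideal.mul_mono_right (Ideal.mul_mono_left this)
      exact h3 ha
  have hle1 : 𝔪 * b ≤ b := Ideal.mul_le_right
  have hle2 : b * b ≤ b := Ideal.mul_le_right
  have hle3 : b * (𝔪 * b) ≤ b * b := Ideal.mul_mono_right hle1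
  have hbb : a ∈ b * b := hle3 ha1
  have hab : a ∈ b := hle2 hbb
  -- the short exact sequence
  have hker : Function.Injective (iot U a (hb a hab)) := by
    rw [← LinearMap.ker_eq_bot, LinearMap.ker_eq_bot']
    intro v hv
    obtain ⟨v, rfl⟩ := U.mkQ_surjective v
    rw [iot_mk] at hv
    have := param_unmixed M d hM a hpe ((Submodule.mem_torsionBy_iff _ _).2 hv)
    exact (Submodule.Quotient.mk_eq_zero U).2 this
  have s : SES (iot U a (hb a hab)) (Ideal.span {a} • ⊤ : Submodule R M).mkQ := by
    refine ⟨hker, Submodule.mkQ_surjective _, ?_⟩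
    rw [LinearMap.exact_iff, Submodule.ker_mkQ]
    ext u
    rw [Submodule.ideal_span_singleton_smul, Submodule.mem_smul_pointwise_iff_exists]
    constructor
    · rintro ⟨v, -, rfl⟩
      exact ⟨U.mkQ v, rfl⟩
    · rintro ⟨v, rfl⟩
      obtain ⟨v, rfl⟩ := U.mkQ_surjective v
      exact ⟨v, trivial, rfl⟩
  have h0 : ∀ ξ, hmap 𝔪 i (iot U a (hb a hab)) ξ = 0 := fun ξ =>
    kill_mul (N := M) U b b hb i ξ (fun c hc f => hs c hc _) a hbb _
  refine soc_add (hmap 𝔪 i (Ideal.span {a} • ⊤ : Submodule R M).mkQ) (s.del 𝔪 i) ?_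
    (s.exact₃ 𝔪 i) ?_ (Hm_art i _)
  · rw [← LinearMap.ker_eq_bot, LinearMap.ker_eq_bot']
    intro x hx
    obtain ⟨y, rfl⟩ := (s.exact₂ 𝔪 i x).1 hx
    exact h0 y
  intro ξ hξ
  obtain ⟨n, x, y, hx, hy, hxy⟩ := mul_sum ha1
  have hyb : ∀ j, y j ∈ b := fun j => hle1 (hy j)
  let φ : (M ⧸ U) →ₗ[R] (Fin n → M) := LinearMap.pi (fun j => iot U (y j) (hb _ (hyb j)))
  let α : (Fin n → M) →ₗ[R] M := ∑ j, x j • LinearMap.proj j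
  have hαφ : α ∘ₗ φ = iot U a (hb a hab) := by
    ext u
    change α (φ (U.mkQ u)) = a • u
    rw [hxy, Finset.sum_smul]
    simp only [α, LinearMap.sum_apply, LinearMap.smul_apply, LinearMap.proj_apply]
    exact Finset.sum_congr rfl (fun j _ => (mul_smul (x j) (y j) u).symm)
  have hφ : Function.Injective φ := fun v w h => hker (by
    rw [← hαφ]; exact congrArg α h)
  have s' := ses_quot φ hφ
  have hφξ : hmap 𝔪 (i+1) φ ξ = 0 := by
    classical
    have : φ = ∑ j, LinearMap.single R (fun _ : Fin n => M) j ∘ₗ iot U (y j) (hb _ (hyb j)) := by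
      ext u k
      simp [φ, Pi.single_apply]
    rw [this, hmap_sum]
    refine Finset.sum_eq_zero (fun j _ => ?_)
    rw [hmap_comp, kill_mul (N := M) U 𝔪 b hb (i+1) ξ (fun c hc f => by
      rw [← map_smul, hξ c hc, map_zero]) (y j) (hy j), map_zero]
  obtain ⟨η, hη⟩ := (s'.exact₁ 𝔪 i ξ).1 hφξ
  have hr : LinearMap.range φ ≤ (Ideal.span {a} • ⊤ : Submodule R M).comap α := by
    rintro _ ⟨v, rfl⟩
    rw [Submodule.mem_comap]
    have h1 : α (φ v) = iot U a (hb a hab) v := by rw [← hαφ]; rfl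
    rw [h1, ← Submodule.ker_mkQ (Ideal.span {a} • ⊤ : Submodule R M), LinearMap.mem_ker]
    exact s.ex.apply_apply_eq_zero v
  let α' := Submodule.mapQ _ _ α hr
  have hnat := s'.del_nat 𝔪 s LinearMap.id α α' (by rw [hαφ]; rfl) (by ext v; rfl) i η
  rw [hη, hmap_id] at hnat
  refine ⟨hmap 𝔪 i α' η, fun r hrm => ?_, hnat⟩
  have h1 : s'.del 𝔪 i (r • η) = 0 := by rw [map_smul, hη, hξ r hrm]
  obtain ⟨θ, hθ⟩ := (s'.exact₃ 𝔪 i _).1 h1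
  rw [← map_smul, ← hθ, ← hmap_comp]
  have h2 : α' ∘ₗ (LinearMap.range φ).mkQ = (Ideal.span {a} • ⊤ : Submodule R M).mkQ ∘ₗ α := by
    ext v; rfl
  rw [h2, hmap_comp]
  have h3 : hmap 𝔪 i α θ = 0 := by
    rw [hmap_sum]
    refine Finset.sum_eq_zero (fun j _ => ?_)
    rw [hmap_smul, hs _ (hx j)]
  rw [h3, map_zero]

end fin2
end
end LC

/-- For a parameter element `x ∈ b(M)^3` of `M`, with `M̄ = M/U_M(0)`,
for all `i ≤ d - 1` one has
`dim_k Soc(H^i_m(M/xM)) = dim_k Soc(H^i_m(M)) + dim_k Soc(H^{i+1}_m(M̄))`. -/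
theorem stmt7 (R : Type u) [CommRing R] [IsLocalRing R] [IsNoetherianRing R]
    (hCM : IsQuotientOfCMLocalRing R)
    (M : Type u) [AddCommGroup M] [Module R M] [Module.Finite R M]
    (d : ℕ) (hd : 0 < d) (hdim : mdim R M = d)
    (a : R) (ha : a ∈ (bIdeal R M d) ^ 3) (hpe : IsParamElement R M d a) :
    ∀ i : ℕ, i ≤ d - 1 →
      socH R (M ⧸ (Ideal.span {a} • ⊤ : Submodule R M)) i =
        socH R M i + socH R (M ⧸ unmixedComp R M) (i + 1) := by
  obtain ⟨e, rfl⟩ : ∃ e, d = e + 1 := ⟨d - 1, by omega⟩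
  intro i hi
  exact LC.main M e hdim a ha hpe i (by omega)
end

section
/- dim_k Soc(H^d_m(M)) ≤ α(M) ≤ N_R(M). -/
open IsLocalRing

universe u

open Paper IsLocalRing

namespace Stmt8

/-- A resolution of `A` by finite projective modules. -/
structure Res (R : Type u) [CommRing R] (A : Type u) [AddCommGroup A] [Module R A] where
  X : ℕ → ModuleCat.{u} R
  d : ∀ n, X (n + 1) →ₗ[R] X n
  ε : X 0 →ₗ[R] A
  dd : ∀ n p, d n (d (n + 1) p) = 0
  εd : ∀ p, ε (d 0 p) = 0
  ex0 : ∀ p, ε p = 0 → ∃ q, d 0 q = p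
  ex : ∀ n p, d n p = 0 → ∃ q, d (n + 1) q = p
  surj : Function.Surjective ε
  proj : ∀ n, Module.Projective R (X n)
  fin : ∀ n, Module.Finite R (X n)

attribute [instance] Res.proj Res.fin

section
variable {R : Type u} [CommRing R]

/-- Lifting of a map from a projective through the image of a submodule. -/
lemma proj_lift {P Q B : Type u} [AddCommGroup P] [Module R P] [AddCommGroup Q] [Module R Q]
    [AddCommGroup B] [Module R B] [Module.Projective R P] (F : Submodule R Q)
    (f : Q →ₗ[R] B) (g : P →ₗ[R] B) (h : ∀ p, ∃ q ∈ F, f q = g p) :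
    ∃ k : P →ₗ[R] Q, (∀ p, k p ∈ F) ∧ ∀ p, f (k p) = g p := by
  let f' : F →ₗ[R] F.map f := (f.domRestrict F).codRestrict _ (fun x => ⟨x, x.2, rfl⟩)
  let g' : P →ₗ[R] F.map f := g.codRestrict _ (fun p => by
    obtain ⟨q, hq, e⟩ := h p
    exact ⟨q, hq, e⟩)
  have hs : Function.Surjective f' := by
    rintro ⟨_, q, hq, rfl⟩
    exact ⟨⟨q, hq⟩, rfl⟩
  obtain ⟨k, hk⟩ := Module.projective_lifting_property f' g' hs
  refine ⟨F.subtype ∘ₗ k, fun p => (k p).2, fun p => ?_⟩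
  have := congrArg Subtype.val (LinearMap.congr_fun hk p)
  exact this

lemma proj_lift' {P Q B : Type u} [AddCommGroup P] [Module R P] [AddCommGroup Q] [Module R Q]
    [AddCommGroup B] [Module R B] [Module.Projective R P]
    (f : Q →ₗ[R] B) (g : P →ₗ[R] B) (h : ∀ p, ∃ q, f q = g p) :
    ∃ k : P →ₗ[R] Q, ∀ p, f (k p) = g p := by
  obtain ⟨k, _, hk⟩ := proj_lift ⊤ f g (fun p => by
    obtain ⟨q, hq⟩ := h p
    exact ⟨q, trivial, hq⟩)
  exact ⟨k, hk⟩

/-- Dependent choice. -/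
lemma dep_choice {X : ℕ → Type u} (p : ∀ n, X n → Prop) (r : ∀ n, X n → X (n + 1) → Prop)
    (a0 : X 0) (h0 : p 0 a0) (hs : ∀ n a, p n a → ∃ b, p (n + 1) b ∧ r n a b) :
    ∃ f : ∀ n, X n, f 0 = a0 ∧ (∀ n, p n (f n)) ∧ ∀ n, r n (f n) (f (n + 1)) := by
  choose s hs using hs
  let f : ∀ n, {a : X n // p n a} := fun n =>
    Nat.rec ⟨a0, h0⟩ (fun n a => ⟨s n a.1 a.2, (hs n a.1 a.2).1⟩) n
  refine ⟨fun n => (f n).1, rfl, fun n => (f n).2, fun n => (hs n _ (f n).2).2⟩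

variable {A B : Type u} [AddCommGroup A] [Module R A] [AddCommGroup B] [Module R B]

/-- Chain maps over a given linear map. -/
structure CMap (P : Res R A) (Q : Res R B) (u : A →ₗ[R] B) where
  g : ∀ n, P.X n →ₗ[R] Q.X n
  comm0 : ∀ p, Q.ε (g 0 p) = u (P.ε p)
  comm : ∀ n p, Q.d n (g (n + 1) p) = g n (P.d n p)

def bdCond (P : Res R A) (Q : Res R B) : ∀ n, (P.X n →ₗ[R] Q.X n) → Prop
  | 0, a => ∀ p, Q.ε (a (P.d 0 p)) = 0
  | (n + 1), a => ∀ p, Q.d n (a (P.d (n + 1) p)) = 0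

def kerCond (Q : Res R B) : ∀ n, Q.X n → Prop
  | 0, a => Q.ε a = 0
  | (n + 1), a => Q.d n a = 0

lemma lift_small (P : Res R A) (Q : Res R B) (u : A →ₗ[R] B)
    (F : ∀ n, Submodule R (Q.X n)) (hF : ∀ n, ∀ q ∈ F n, kerCond Q n q → ∃ q' ∈ F (n + 1), Q.d n q' = q)
    (g0 : P.X 0 →ₗ[R] Q.X 0) (h0 : ∀ p, Q.ε (g0 p) = u (P.ε p)) (h0F : ∀ p, g0 (P.d 0 p) ∈ F 0) :
    ∃ c : CMap P Q u, c.g 0 = g0 ∧ ∀ n p, c.g (n + 1) p ∈ F (n + 1) := by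
  obtain ⟨f, hf0, hfp, hfr⟩ := dep_choice (X := fun n => P.X n →ₗ[R] Q.X n)
    (fun n a => bdCond P Q n a ∧ ∀ p, a (P.d n p) ∈ F n)
    (fun n a b => (∀ p, Q.d n (b p) = a (P.d n p)) ∧ ∀ p, b p ∈ F (n + 1)) g0
    ⟨fun p => by rw [h0, P.εd, map_zero], h0F⟩ (by
      rintro n a ⟨ha, ha'⟩
      obtain ⟨k, hk, hk'⟩ := proj_lift (F (n + 1)) (Q.d n) (a ∘ₗ P.d n) (fun p =>
        hF n _ (ha' p) (by cases n <;> exact ha p))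
      refine ⟨k, ⟨fun p => ?_, fun p => hk _⟩, hk', hk⟩
      rw [hk', LinearMap.comp_apply, P.dd, map_zero])
  exact ⟨⟨f, by rw [hf0]; exact h0, fun n p => (hfr n).1 p⟩, hf0, fun n p => (hfr n).2 p⟩

lemma exists_lift (P : Res R A) (Q : Res R B) (u : A →ₗ[R] B) : Nonempty (CMap P Q u) := by
  obtain ⟨g0, h0⟩ := proj_lift' Q.ε (u ∘ₗ P.ε) (fun p => Q.surj _)
  obtain ⟨c, _⟩ := lift_small P Q u (fun _ => ⊤) (fun n q _ h => by
    cases n with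
    | zero => obtain ⟨q', h'⟩ := Q.ex0 q h; exact ⟨q', trivial, h'⟩
    | succ n => obtain ⟨q', h'⟩ := Q.ex n q h; exact ⟨q', trivial, h'⟩) g0 h0 (fun _ => trivial)
  exact ⟨c⟩

def CMap.comp {C : Type u} [AddCommGroup C] [Module R C] {P : Res R A} {Q : Res R B}
    {S : Res R C} {u : A →ₗ[R] B} {w : B →ₗ[R] C} (a : CMap P Q u) (b : CMap Q S w) :
    CMap P S (w ∘ₗ u) where
  g n := b.g n ∘ₗ a.g n
  comm0 p := by simp [b.comm0, a.comm0]
  comm n p := by simp [b.comm, a.comm]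

def CMap.id (P : Res R A) : CMap P P LinearMap.id where
  g _ := LinearMap.id
  comm0 _ := rfl
  comm _ _ := rfl

/-- null-homotopies of multiplication by `y`. -/
lemma exists_htpy (P : Res R A) (y : R) (hy : ∀ a : A, y • a = 0) :
    ∃ h : ∀ n, P.X n →ₗ[R] P.X (n + 1), (∀ p, P.d 0 (h 0 p) = y • p) ∧
      ∀ n p, P.d (n + 1) (h (n + 1) p) = y • p - h n (P.d n p) := by
  obtain ⟨h0, hh0⟩ := proj_lift' (P.d 0) (y • LinearMap.id) (fun p => P.ex0 _ (by simp [hy]))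
  obtain ⟨f, hf0, hfp, hfr⟩ := dep_choice (X := fun n => P.X n →ₗ[R] P.X (n + 1))
    (fun n a => ∀ p, P.d n (a (P.d n p)) = y • P.d n p)
    (fun n a b => ∀ p, P.d (n + 1) (b p) = y • p - a (P.d n p)) h0
    (fun p => by simp [hh0]) (by
      intro n a ha
      obtain ⟨k, hk⟩ := proj_lift' (P.d (n + 1)) (y • LinearMap.id - a ∘ₗ P.d n)
        (fun p => P.ex n _ (by simp [ha]))
      refine ⟨k, fun p => ?_, fun p => by simp [hk]⟩
      simp [hk, P.dd])
  exact ⟨f, by rw [hf0]; simpa using hh0, hfr⟩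

variable (M : Type u) [AddCommGroup M] [Module R M]

/-- cocycles -/
def Zc (P : Res R A) (n : ℕ) : Submodule R (P.X n →ₗ[R] M) where
  carrier := {f | ∀ p, f (P.d n p) = 0}
  add_mem' ha hb p := by simp [ha p, hb p]
  zero_mem' p := rfl
  smul_mem' r f hf p := by simp [hf p]

/-- coboundaries -/
def Bc (P : Res R A) : ∀ n, Submodule R (P.X n →ₗ[R] M)
  | 0 => ⊥
  | (n + 1) => LinearMap.range (LinearMap.lcomp R M (P.d n))

end
end Stmt8

namespace Stmt8

section
variable {R : Type u} [CommRing R] (I : Ideal R)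

/-- transition maps -/
def tr {t t' : ℕ} (h : t ≤ t') : (R ⧸ I ^ t') →ₗ[R] (R ⧸ I ^ t) :=
  Submodule.mapQ _ _ LinearMap.id (Ideal.pow_le_pow_right h)

lemma tr_mk {t t' : ℕ} (h : t ≤ t') (r : R) :
    tr I h (Submodule.Quotient.mk r) = Submodule.Quotient.mk r := rfl

lemma tr_comp {t t' t'' : ℕ} (h : t ≤ t') (h' : t' ≤ t'') :
    tr I h ∘ₗ tr I h' = tr I (h.trans h') := by
  ext; rfl

lemma tr_self {t : ℕ} (h : t ≤ t) : tr I h = LinearMap.id := by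
  ext; rfl

variable {I} (P : ∀ t, Res R (R ⧸ I ^ t))

/-- the class of `f` vanishes in the colimit -/
def Dies {M : Type u} [AddCommGroup M] [Module R M] (t n : ℕ) (f : (P t).X n →ₗ[R] M) : Prop :=
  ∃ (t' : ℕ) (h : t ≤ t') (c : CMap (P t') (P t) (tr I h)), f ∘ₗ c.g n ∈ Bc M (P t') n

variable {M : Type u} [AddCommGroup M] [Module R M]

lemma dies_of_mem {t n : ℕ} {f : (P t).X n →ₗ[R] M} (hf : f ∈ Bc M (P t) n) : Dies P t n f := by
  refine ⟨t, le_rfl, ⟨fun _ => LinearMap.id, fun p => ?_, fun _ _ => rfl⟩, hf⟩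
  rw [tr_self]; rfl

lemma cocycle_comp {A B : Type u} [AddCommGroup A] [Module R A] [AddCommGroup B] [Module R B]
    {P : Res R A} {Q : Res R B} {u : A →ₗ[R] B} (c : CMap P Q u) {n : ℕ} {f : Q.X n →ₗ[R] M}
    (hf : f ∈ Zc M Q n) : f ∘ₗ c.g n ∈ Zc M P n := by
  intro p
  simp [← c.comm, hf _]

/-- Artin-Rees in convenient form. -/
lemma artin_rees [IsNoetherianRing R] {X : Type u} [AddCommGroup X] [Module R X]
    [Module.Finite R X] (N : Submodule R X) :
    ∃ k, ∀ s, (I ^ s • ⊤ : Submodule R X) ⊓ N ≤ I ^ (s - k) • N := by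
  obtain ⟨k, hk⟩ := Ideal.exists_pow_inf_eq_pow_smul I N
  refine ⟨k, fun s => ?_⟩
  by_cases h : k ≤ s
  · rw [hk s h]
    exact Submodule.smul_mono le_rfl inf_le_right
  · have : s - k = 0 := by omega
    rw [this, pow_zero, Ideal.one_eq_top, Submodule.top_smul]
    exact inf_le_right

/-- the kernel of the (augmented) differential as a submodule -/
def kerSub {A : Type u} [AddCommGroup A] [Module R A] (Q : Res R A) : ∀ n, Submodule R (Q.X n)
  | 0 => LinearMap.ker Q.ε
  | (n + 1) => LinearMap.ker (Q.d n)

lemma mem_kerSub {A : Type u} [AddCommGroup A] [Module R A] (Q : Res R A) (n : ℕ) (q : Q.X n) :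
    q ∈ kerSub Q n ↔ kerCond Q n q := by
  cases n <;> exact Iff.rfl

lemma kerSub_le {A : Type u} [AddCommGroup A] [Module R A] (Q : Res R A) (n : ℕ) :
    kerSub Q n ≤ (⊤ : Submodule R (Q.X (n + 1))).map (Q.d n) := by
  cases n with
  | zero => intro q h; obtain ⟨q', h'⟩ := Q.ex0 q h; exact ⟨q', trivial, h'⟩
  | succ n => intro q h; obtain ⟨q', h'⟩ := Q.ex n q h; exact ⟨q', trivial, h'⟩

/-- chain maps with small image -/
lemma small_chain [IsNoetherianRing R] (t n c : ℕ) :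
    ∃ (t' : ℕ) (h : t ≤ t') (g : CMap (P t') (P t) (tr I h)),
      ∀ p, g.g (n + 1) p ∈ (I ^ c • ⊤ : Submodule R ((P t).X (n + 1))) := by
  choose k hk using fun j => artin_rees (I := I) (kerSub (P t) j)
  let K : ℕ → ℕ := fun n => ∑ j ∈ Finset.range n, k j
  let t' := t + c + K (n + 1)
  have htt : t ≤ t' := by omega
  obtain ⟨p0, hp0⟩ := (P t).surj (Submodule.Quotient.mk 1)
  obtain ⟨a, ha⟩ := proj_lift' (I ^ t').mkQ (P t').ε (fun p => Submodule.mkQ_surjective _ _)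
  obtain ⟨g, -, hg⟩ := lift_small (P t') (P t) (tr I htt)
    (fun j => (I ^ (t' - K j) • ⊤ : Submodule R ((P t).X j))) (by
      intro j q hq hq'
      have h1 := hk j (t' - K j) ⟨hq, (mem_kerSub _ _ _).2 hq'⟩
      have h2 := Submodule.smul_mono (le_refl (I ^ (t' - K j - k j))) (kerSub_le (P t) j) h1
      rw [← Submodule.map_smul''] at h2
      obtain ⟨q', h3, h4⟩ := h2
      refine ⟨q', ?_, h4⟩
      have : t' - K (j + 1) = t' - K j - k j := by
        simp only [K, Finset.sum_range_succ]; omega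
      rw [this]; exact h3)
    ((LinearMap.toSpanSingleton R _ p0) ∘ₗ a) (fun p => by
      rw [← ha p, Submodule.mkQ_apply, tr_mk, LinearMap.comp_apply,
        LinearMap.toSpanSingleton_apply, map_smul, hp0, ← Submodule.Quotient.mk_smul, smul_eq_mul,
        mul_one]) (fun p => by
      have h1 := ha ((P t').d 0 p)
      rw [(P t').εd] at h1
      have h2 : a ((P t').d 0 p) ∈ I ^ t' := by
        rwa [Submodule.mkQ_apply, Submodule.Quotient.mk_eq_zero] at h1
      have : K 0 = 0 := by simp [K]
      rw [this, Nat.sub_zero]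
      exact Submodule.smul_mem_smul h2 trivial)
  refine ⟨t', htt, g, fun p => ?_⟩
  have := hg n p
  refine Submodule.smul_mono_left (Ideal.pow_le_pow_right ?_) this
  omega

lemma vanish_base [IsNoetherianRing R] (c : ℕ) (hc : ∀ r ∈ I ^ c, ∀ x : M, r • x = 0) (t n : ℕ)
    (f : (P t).X (n + 1) →ₗ[R] M) : Dies P t (n + 1) f := by
  obtain ⟨t', h, g, hg⟩ := small_chain P t n c
  refine ⟨t', h, g, ?_⟩
  have : f ∘ₗ g.g (n + 1) = 0 := by
    ext p
    have h1 : f (g.g (n + 1) p) ∈ (I ^ c • ⊤ : Submodule R M) := by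
      have := Submodule.mem_map_of_mem (f := f) (hg p)
      rw [Submodule.map_smul''] at this
      exact Submodule.smul_mono le_rfl le_top this
    have h2 : (I ^ c • ⊤ : Submodule R M) ≤ ⊥ := by
      rw [Submodule.smul_le]
      intro r hr x _
      simpa using hc r hr x
    simpa using h2 h1
  rw [this]; exact zero_mem _

/-- Control of the kernel of contraction. -/
lemma contraction {t n : ℕ} {y : R} (h : ∀ n, (P t).X n →ₗ[R] (P t).X (n + 1))
    (hh : ∀ n p, (P t).d (n + 1) (h (n + 1) p) = y • p - h n ((P t).d n p))
    (f : (P t).X (n + 1) →ₗ[R] M) (hf : f ∈ Zc M (P t) (n + 1))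
    (N : Submodule R M) (hN : N = Ideal.span {y} • ⊤)
    (h1 : Dies P t n (N.mkQ ∘ₗ f ∘ₗ h n))
    (h2 : ∀ t', ∀ e ∈ Zc (Submodule.torsionBy R M y) (P t') (n + 1), Dies P t' (n + 1) e) :
    Dies P t (n + 1) f := by
  obtain ⟨t', ht', c, hc⟩ := h1
  have hNmem : ∀ x, N.mkQ x = 0 → ∃ z, y • z = x := by
    intro x hx
    rw [Submodule.mkQ_apply, Submodule.Quotient.mk_eq_zero, hN, Submodule.ideal_span_singleton_smul] at hx
    obtain ⟨z, _, hz⟩ := hx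
    exact ⟨z, hz⟩
  have key : ∃ w : (P t').X n →ₗ[R] M,
      ∀ p, y • w ((P t').d n p) = f (h n (c.g n ((P t').d n p))) := by
    cases n with
    | zero =>
      have hc' : (N.mkQ ∘ₗ f ∘ₗ h 0) ∘ₗ c.g 0 = 0 := hc
      obtain ⟨w, hw⟩ := proj_lift' (LinearMap.lsmul R M y) (f ∘ₗ h 0 ∘ₗ c.g 0)
        (fun p => hNmem _ (LinearMap.congr_fun hc' p))
      exact ⟨w, fun p => hw _⟩
    | succ n =>
      obtain ⟨e, he⟩ := hc
      obtain ⟨e', he'⟩ := proj_lift' N.mkQ e (fun p => Submodule.mkQ_surjective _ _)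
      obtain ⟨w, hw⟩ := proj_lift' (LinearMap.lsmul R M y)
        (f ∘ₗ h (n + 1) ∘ₗ c.g (n + 1) - e' ∘ₗ (P t').d n) (fun p => hNmem _ (by
          have := LinearMap.congr_fun he p
          simp only [LinearMap.lcomp_apply', LinearMap.comp_apply] at this
          simp only [LinearMap.sub_apply, map_sub, LinearMap.comp_apply, he', this, sub_self]))
      refine ⟨w, fun p => ?_⟩
      have := hw ((P t').d (n + 1) p)
      simpa [(P t').dd] using this
  obtain ⟨w, hw⟩ := key
  have hU : ∀ p, f (c.g (n + 1) p) - w ((P t').d n p) ∈ Submodule.torsionBy R M y := by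
    intro p
    rw [Submodule.mem_torsionBy_iff, smul_sub, hw, ← c.comm]
    have := congrArg f (hh n (c.g (n + 1) p))
    rw [hf, map_sub, map_smul] at this
    rw [← this]
  let e : (P t').X (n + 1) →ₗ[R] Submodule.torsionBy R M y :=
    (f ∘ₗ c.g (n + 1) - w ∘ₗ (P t').d n).codRestrict _ hU
  obtain ⟨t'', ht'', c', v, hv⟩ := h2 t' e (fun p => by
    apply Subtype.ext
    simp [e, ← c.comm, hf _, (P t').dd])
  refine ⟨t'', ht'.trans ht'', ⟨fun n => c.g n ∘ₗ c'.g n, fun p => ?_, fun n p => ?_⟩, ?_⟩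
  · rw [← tr_comp I ht' ht'', LinearMap.comp_apply, LinearMap.comp_apply, c.comm0, c'.comm0]
  · rw [LinearMap.comp_apply, LinearMap.comp_apply, c.comm, c'.comm]
  · refine ⟨w ∘ₗ c'.g n + (Submodule.torsionBy R M y).subtype ∘ₗ v, ?_⟩
    ext p
    have h3 := congrArg Subtype.val (LinearMap.congr_fun hv p)
    have h4 := c'.comm n p
    simp [e] at h3
    simp [h3, ← h4]

/-- condition on a list being a system of "parameters" -/
def Good (I : Ideal R) (M : Type u) [AddCommGroup M] [Module R M] (l : List R) : Prop :=
  ∃ c, I ^ c ≤ Ideal.span {r | r ∈ l} ⊔ Module.annihilator R M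

lemma span_cons (y : R) (l : List R) :
    Ideal.span {r | r ∈ y :: l} = Ideal.span {y} ⊔ Ideal.span {r | r ∈ l} := by
  rw [← Ideal.span_union]
  congr 1
  ext r; simp

lemma good_of {N : Type u} [AddCommGroup N] [Module R N] {y : R} {l : List R}
    (h : Good I M (y :: l)) (h1 : Module.annihilator R M ≤ Module.annihilator R N)
    (h2 : y ∈ Module.annihilator R N) : Good I N l := by
  obtain ⟨c, hc⟩ := h
  refine ⟨c, hc.trans ?_⟩
  rw [span_cons]
  refine sup_le (sup_le ?_ le_sup_left) (h1.trans le_sup_right)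
  rw [Ideal.span_singleton_le_iff_mem]
  exact Ideal.mem_sup_right h2

lemma good_quot {y : R} {l : List R} (h : Good I M (y :: l)) :
    Good I (M ⧸ (Ideal.span {y} • ⊤ : Submodule R M)) l := by
  refine good_of h (fun r hr => ?_) ?_
  · rw [Module.mem_annihilator] at hr ⊢
    intro x
    obtain ⟨x, rfl⟩ := Submodule.Quotient.mk_surjective _ x
    rw [← Submodule.Quotient.mk_smul, hr]; rfl
  · rw [Module.mem_annihilator]
    intro x
    obtain ⟨x, rfl⟩ := Submodule.Quotient.mk_surjective _ x
    rw [← Submodule.Quotient.mk_smul, Submodule.Quotient.mk_eq_zero]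
    exact Submodule.smul_mem_smul (Ideal.mem_span_singleton_self y) trivial

lemma good_tors {y : R} {l : List R} (h : Good I M (y :: l)) :
    Good I (Submodule.torsionBy R M y) l := by
  refine good_of h (fun r hr => ?_) ?_
  · rw [Module.mem_annihilator] at hr ⊢
    intro x
    exact Subtype.ext (hr x)
  · rw [Module.mem_annihilator]
    intro x
    exact Subtype.ext x.2

lemma sup_pow_le (A J : Ideal R) (t : ℕ) : (A ⊔ J) ^ t ≤ A ^ t ⊔ J := by
  induction t with
  | zero => simp
  | succ t ih =>
    rw [pow_succ, pow_succ]
    refine (Ideal.mul_mono_left ih).trans ?_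
    rw [Ideal.mul_le]
    intro a ha b hb
    obtain ⟨a1, h1, a2, h2, rfl⟩ := Submodule.mem_sup.1 ha
    obtain ⟨b1, h3, b2, h4, rfl⟩ := Submodule.mem_sup.1 hb
    refine Submodule.mem_sup.2 ⟨a1 * b1, Ideal.mul_mem_mul h1 h3, a1 * b2 + a2 * (b1 + b2),
      J.add_mem (J.mul_mem_left _ h4) (J.mul_mem_right _ h2), by ring⟩

lemma good_pow {y : R} {l : List R} (h : Good I M (y :: l)) (t : ℕ) : Good I M (y ^ t :: l) := by
  obtain ⟨c, hc⟩ := h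
  refine ⟨c * t, ?_⟩
  rw [pow_mul]
  refine (Ideal.pow_right_mono hc t).trans ?_
  rw [span_cons, span_cons, sup_assoc, sup_assoc, ← Ideal.span_singleton_pow]
  generalize Ideal.span {r | r ∈ l} ⊔ Module.annihilator R M = J
  exact sup_pow_le _ _ t

lemma smul_zero_of_mem {t : ℕ} {y : R} (hy : y ∈ I ^ t) (a : R ⧸ I ^ t) : y • a = 0 := by
  obtain ⟨a, rfl⟩ := Submodule.Quotient.mk_surjective _ a
  rw [← Submodule.Quotient.mk_smul, Submodule.Quotient.mk_eq_zero]
  exact Ideal.mul_mem_right _ _ hy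

lemma contr_mem {A : Type u} [AddCommGroup A] [Module R A] {P : Res R A} {n : ℕ} {y : R}
    (h : ∀ n, P.X n →ₗ[R] P.X (n + 1))
    (hh : ∀ n p, P.d (n + 1) (h (n + 1) p) = y • p - h n (P.d n p))
    (f : P.X (n + 1) →ₗ[R] M) (hf : f ∈ Zc M P (n + 1)) :
    (Ideal.span {y} • ⊤ : Submodule R M).mkQ ∘ₗ f ∘ₗ h n ∈
      Zc (M ⧸ (Ideal.span {y} • ⊤ : Submodule R M)) P n := by
  intro p
  have := congrArg f (hh n p)
  rw [hf, map_sub, map_smul] at this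
  rw [LinearMap.comp_apply, LinearMap.comp_apply, ← sub_eq_zero.1 this.symm, Submodule.mkQ_apply,
    Submodule.Quotient.mk_eq_zero]
  exact Submodule.smul_mem_smul (Ideal.mem_span_singleton_self y) trivial

lemma contr_bd {A : Type u} [AddCommGroup A] [Module R A] {P : Res R A} {n : ℕ} {y : R}
    (h : ∀ n, P.X n →ₗ[R] P.X (n + 1)) (h0 : ∀ p, P.d 0 (h 0 p) = y • p)
    (hh : ∀ n p, P.d (n + 1) (h (n + 1) p) = y • p - h n (P.d n p))
    (f : P.X (n + 1) →ₗ[R] M) (hf : f ∈ Bc M P (n + 1)) :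
    (Ideal.span {y} • ⊤ : Submodule R M).mkQ ∘ₗ f ∘ₗ h n ∈
      Bc (M ⧸ (Ideal.span {y} • ⊤ : Submodule R M)) P n := by
  obtain ⟨e, rfl⟩ := hf
  have hN : ∀ x, (Ideal.span {y} • ⊤ : Submodule R M).mkQ (y • x) = 0 := fun x => by
    rw [Submodule.mkQ_apply, Submodule.Quotient.mk_eq_zero]
    exact Submodule.smul_mem_smul (Ideal.mem_span_singleton_self y) trivial
  cases n with
  | zero =>
    change _ = 0
    ext p
    simp only [LinearMap.comp_apply, LinearMap.lcomp_apply, h0]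
    rw [map_smul, hN]; rfl
  | succ n =>
    refine ⟨- ((Ideal.span {y} • ⊤ : Submodule R M).mkQ ∘ₗ e ∘ₗ h n), ?_⟩
    ext p
    simp only [LinearMap.comp_apply, LinearMap.lcomp_apply', hh,
      map_sub, LinearMap.neg_apply]
    rw [map_smul e, hN, zero_sub]

/-- Grothendieck vanishing -/
lemma vanish [IsNoetherianRing R] (l : List R) (hl : ∀ y ∈ l, y ∈ I) :
    ∀ (M : Type u) [AddCommGroup M] [Module R M] (_ : Good I M l) (t n : ℕ) (_ : l.length < n)
      (f : (P t).X n →ₗ[R] M) (_ : f ∈ Zc M (P t) n), Dies P t n f := by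
  induction l with
  | nil =>
    intro M _ _ ⟨c, hc⟩ t n hn f hf
    obtain ⟨n, rfl⟩ : ∃ k, n = k + 1 := ⟨n - 1, by simp at hn; omega⟩
    refine vanish_base P c (fun r hr x => ?_) t n f
    have := hc hr
    simp at this
    exact Module.mem_annihilator.1 this x
  | cons y l ih =>
    intro M _ _ hM t n hn f hf
    obtain ⟨n, rfl⟩ : ∃ k, n = k + 1 := ⟨n - 1, by simp at hn; omega⟩
    have hM' := good_pow hM t
    have ih := ih (fun y hy => hl y (by simp [hy]))
    have hyt : y ^ t ∈ I ^ t := Ideal.pow_mem_pow (hl y (by simp)) t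
    obtain ⟨h, -, hh⟩ := exists_htpy (P t) (y ^ t) (smul_zero_of_mem hyt)
    have hn' : l.length < n := by simpa using hn
    refine contraction P h hh f hf _ rfl ?_ ?_
    · exact ih _ (good_quot hM') t n hn' _ (contr_mem h hh f hf)
    · intro t' e he
      exact ih _ (good_tors hM') t' (n + 1) (by omega) e he

/-- M/(y,l)M -/
lemma quot_cons (y : R) (l : List R) (M : Type u) [AddCommGroup M] [Module R M] :
    ∃ j : ((M ⧸ (Ideal.span {y} • ⊤ : Submodule R M)) ⧸
      (Ideal.span {r | r ∈ l} • ⊤ : Submodule R (M ⧸ (Ideal.span {y} • ⊤ : Submodule R M)))) →ₗ[R]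
        M ⧸ (Ideal.span {r | r ∈ y :: l} • ⊤ : Submodule R M), Function.Injective j := by
  have hle : (Ideal.span {y} • ⊤ : Submodule R M) ≤ Ideal.span {r | r ∈ y :: l} • ⊤ :=
    Submodule.smul_mono (by rw [span_cons]; exact le_sup_left) le_rfl
  let a : (M ⧸ (Ideal.span {y} • ⊤ : Submodule R M)) →ₗ[R]
    M ⧸ (Ideal.span {r | r ∈ y :: l} • ⊤ : Submodule R M) := Submodule.liftQ _ (Submodule.mkQ _) (by simpa using hle)
  have hk : LinearMap.ker a = (Ideal.span {r | r ∈ l} • ⊤ :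
      Submodule R (M ⧸ (Ideal.span {y} • ⊤ : Submodule R M))) := by
    have e : (Ideal.span {r | r ∈ l} • ⊤ :
      Submodule R (M ⧸ (Ideal.span {y} • ⊤ : Submodule R M))) =
      (Ideal.span {r | r ∈ l} • ⊤ : Submodule R M).map (Submodule.mkQ _) := by
      rw [Submodule.map_smul'', Submodule.map_top, Submodule.range_mkQ]
    rw [e, Submodule.ker_liftQ, Submodule.ker_mkQ, span_cons, Submodule.sup_smul, Submodule.map_sup,
      Submodule.mkQ_map_self, bot_sup_eq]
  rw [← hk]
  exact ⟨(LinearMap.ker a).liftQ a le_rfl, by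
    rw [← LinearMap.ker_eq_bot]; exact Submodule.ker_liftQ_eq_bot _ _ _ le_rfl⟩

/-- Evaluation of top cohomology classes in `M/(l)M`. -/
lemma eval_top [IsNoetherianRing R] (t : ℕ) (l : List R) (hl : ∀ y ∈ l, y ∈ I)
    (hlt : ∀ y ∈ l, y ∈ I ^ t) :
    ∀ (M : Type u) [AddCommGroup M] [Module R M] (_ : Good I M l),
      ∃ Φ : Zc M (P t) l.length →ₗ[R] M ⧸ (Ideal.span {r | r ∈ l} • ⊤ : Submodule R M),
        (∀ f, f.1 ∈ Bc M (P t) l.length → Φ f = 0) ∧ ∀ f, Φ f = 0 → Dies P t l.length f.1 := by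
  induction l with
  | nil =>
    intro M _ _ _
    obtain ⟨p0, hp0⟩ := (P t).surj (Submodule.Quotient.mk 1)
    refine ⟨Submodule.mkQ _ ∘ₗ LinearMap.applyₗ p0 ∘ₗ (Zc M (P t) 0).subtype, fun f hf => ?_,
      fun f hf => dies_of_mem P ?_⟩
    · have : f.1 = 0 := hf
      simp [this]
    · have h0 : f.1 p0 = 0 := by simpa using hf
      change f.1 = 0
      ext p
      obtain ⟨r, hr⟩ := Submodule.Quotient.mk_surjective _ ((P t).ε p)
      obtain ⟨q, hq⟩ := (P t).ex0 (p - r • p0) (by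
        rw [map_sub, map_smul, hp0, ← hr, ← Submodule.Quotient.mk_smul, smul_eq_mul, mul_one,
          sub_self])
      have : f.1 ((P t).d 0 q) = 0 := f.2 q
      rw [hq, map_sub, map_smul, h0, smul_zero, sub_zero] at this
      exact this
  | cons y l ih =>
    intro M _ _ hM
    have hl' : ∀ y ∈ l, y ∈ I := fun y hy => hl y (by simp [hy])
    obtain ⟨Φ, h1, h2⟩ := ih hl' (fun y hy => hlt y (by simp [hy])) _ (good_quot hM)
    obtain ⟨h, h0, hh⟩ := exists_htpy (P t) y (smul_zero_of_mem (hlt y (by simp)))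
    obtain ⟨j, hj⟩ := quot_cons y l M
    let N : Submodule R M := Ideal.span {y} • ⊤
    let C : ((P t).X (l.length + 1) →ₗ[R] M) →ₗ[R] ((P t).X l.length →ₗ[R] M ⧸ N) :=
      LinearMap.compRight R N.mkQ ∘ₗ LinearMap.lcomp R M (h l.length)
    have hC : ∀ f, C f = N.mkQ ∘ₗ f ∘ₗ h l.length := fun f => rfl
    let C' : Zc M (P t) (l.length + 1) →ₗ[R] Zc (M ⧸ N) (P t) l.length :=
      C.restrict (fun f hf => contr_mem h hh f hf)
    refine ⟨j ∘ₗ Φ ∘ₗ C', fun f hf => ?_, fun f hf => ?_⟩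
    · have : Φ (C' f) = 0 := by
        apply h1
        change N.mkQ ∘ₗ f.1 ∘ₗ h l.length ∈ _
        exact contr_bd h h0 hh f.1 hf
      simp [this]
    · have h3 : Φ (C' f) = 0 := hj (by simpa using hf)
      refine contraction P h hh f.1 f.2 _ rfl (h2 _ h3) ?_
      intro t' e he
      exact vanish P l hl' _ (good_tors hM) t' _ (by simp) e he
end
end Stmt8

namespace Stmt8

section
variable {R : Type u} [CommRing R]

lemma artinian_of_pow [IsLocalRing R] [IsNoetherianRing R] (c : ℕ) :
    ∀ (N : Type u) [AddCommGroup N] [Module R N] [Module.Finite R N]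
      (_ : ((maximalIdeal R) ^ c • ⊤ : Submodule R N) = ⊥), IsArtinian R N := by
  induction c with
  | zero =>
    intro N _ _ _ h
    rw [pow_zero, Ideal.one_eq_top, Submodule.top_smul] at h
    have : Subsingleton N := (Submodule.subsingleton_iff R).1 (subsingleton_of_top_le_bot h.le)
    infer_instance
  | succ c ih =>
    intro N _ _ _ h
    let K : Submodule R N := (maximalIdeal R) • ⊤
    have h1 : IsArtinian R K := by
      refine ih K ?_
      refine Submodule.map_injective_of_injective K.injective_subtype ?_
      rw [Submodule.map_smul'', Submodule.map_top, Submodule.range_subtype, Submodule.map_bot,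
        ← Submodule.mul_smul, ← pow_succ]
      exact h
    have h2 : IsArtinian R (N ⧸ K) := by
      have ht : Module.IsTorsionBySet R (N ⧸ K) (maximalIdeal R : Set R) :=
        Module.isTorsionBySet_quotient_ideal_smul N (maximalIdeal R)
      let _ := Ideal.Quotient.field (maximalIdeal R)
      let _ := ht.module
      have : IsSemisimpleModule R (N ⧸ K) := by
        rw [← ht.isSemisimpleModule_iff]
        infer_instance
      infer_instance
    exact isArtinian_iff_submodule_quotient K |>.2 ⟨h1, h2⟩

lemma pow_of_artinian [IsLocalRing R] (N : Type u) [AddCommGroup N] [Module R N]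
    [Module.Finite R N] [IsArtinian R N] [IsNoetherianRing R] :
    ∃ c, ((maximalIdeal R) ^ c • ⊤ : Submodule R N) = ⊥ := by
  obtain ⟨c, hc⟩ := IsArtinian.monotone_stabilizes (R := R) (M := N)
    ⟨fun c => OrderDual.toDual ((maximalIdeal R) ^ c • ⊤ : Submodule R N), fun a b hab =>
      Submodule.smul_mono_left (Ideal.pow_le_pow_right hab)⟩
  refine ⟨c, ?_⟩
  have h : ((maximalIdeal R) ^ c • ⊤ : Submodule R N) = (maximalIdeal R) ^ (c + 1) • ⊤ :=
    hc (c + 1) (by omega)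
  refine Submodule.eq_bot_of_le_smul_of_le_jacobson_bot (maximalIdeal R) _
    (IsNoetherian.noetherian _) ?_ (IsLocalRing.maximalIdeal_le_jacobson _)
  rw [← Submodule.mul_smul, ← pow_succ', ← h]

lemma fl_iff [IsLocalRing R] [IsNoetherianRing R] (M : Type u) [AddCommGroup M] [Module R M]
    [Module.Finite R M] (q : Ideal R) :
    IsFiniteLength R (M ⧸ (q • ⊤ : Submodule R M)) ↔
      maximalIdeal R ≤ (q ⊔ Module.annihilator R M).radical := by
  rw [isFiniteLength_iff_isNoetherian_isArtinian]
  constructor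
  · rintro ⟨_, h⟩
    obtain ⟨c, hc⟩ := pow_of_artinian (R := R) (M ⧸ (q • ⊤ : Submodule R M))
    have h1 : (maximalIdeal R) ^ c ≤ Module.annihilator R (M ⧸ (q • ⊤ : Submodule R M)) := by
      intro r hr
      rw [Module.mem_annihilator]
      intro z
      have : r • z ∈ ((maximalIdeal R) ^ c • ⊤ : Submodule R (M ⧸ (q • ⊤ : Submodule R M))) :=
        Submodule.smul_mem_smul hr trivial
      rwa [hc] at this
    rw [Ideal.radical_eq_sInf]
    refine le_sInf ?_
    rintro p ⟨hp, hpp⟩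
    have h2 : (⟨p, hpp⟩ : PrimeSpectrum R) ∈ Module.support R (M ⧸ (q • ⊤ : Submodule R M)) := by
      rw [Module.support_quotient, Module.support_eq_zeroLocus]
      exact ⟨le_sup_right.trans hp, le_sup_left.trans hp⟩
    rw [Module.support_eq_zeroLocus] at h2
    exact hpp.le_of_pow_le (h1.trans h2)
  · intro h
    refine ⟨inferInstance, ?_⟩
    obtain ⟨c, hc⟩ := Ideal.exists_pow_le_of_le_radical_of_fg h (IsNoetherian.noetherian _)
    refine artinian_of_pow c _ ?_
    rw [eq_bot_iff, Submodule.smul_le]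
    intro r hr z _
    obtain ⟨z, rfl⟩ := Submodule.Quotient.mk_surjective _ z
    obtain ⟨a, ha, b, hb, rfl⟩ := Submodule.mem_sup.1 (hc hr)
    rw [← Submodule.Quotient.mk_smul, add_smul, Module.mem_annihilator.1 hb, add_zero,
      Submodule.mem_bot, Submodule.Quotient.mk_eq_zero]
    exact Submodule.smul_mem_smul ha trivial

/-- maps on socles -/
noncomputable def socMap (I : Ideal R) {N N' : Type u} [AddCommGroup N] [Module R N]
    [AddCommGroup N'] [Module R N'] (f : N →ₗ[R] N') :
    Submodule.torsionBySet R N (I : Set R) →ₗ[R ⧸ I] Submodule.torsionBySet R N' (I : Set R) :=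
  LinearMap.extendScalarsOfSurjective Ideal.Quotient.mk_surjective
    (f.restrict (p := Submodule.torsionBySet R N (I : Set R))
      (q := Submodule.torsionBySet R N' (I : Set R)) (fun x hx => by
        rw [Submodule.mem_torsionBySet_iff] at hx ⊢
        intro a
        rw [← map_smul, hx, map_zero]))

lemma socMap_coe (I : Ideal R) {N N' : Type u} [AddCommGroup N] [Module R N]
    [AddCommGroup N'] [Module R N'] (f : N →ₗ[R] N')
    (x : Submodule.torsionBySet R N (I : Set R)) : (socMap I f x : N') = f x := rfl

lemma socDim_congr (I : Ideal R) {N N' : Type u} [AddCommGroup N] [Module R N]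
    [AddCommGroup N'] [Module R N'] (e : N ≃ₗ[R] N') : socDim R I N = socDim R I N' := by
  unfold socDim
  refine LinearEquiv.finrank_eq (LinearEquiv.ofLinearMap (socMap I e.toLinearMap)
    (socMap I e.symm.toLinearMap) ?_ ?_)
  · ext x; simp [socMap_coe]
  · ext x; simp [socMap_coe]

instance socFin [IsNoetherianRing R] (I : Ideal R) (N : Type u) [AddCommGroup N] [Module R N]
    [Module.Finite R N] : Module.Finite (R ⧸ I) (Submodule.torsionBySet R N (I : Set R)) :=
  Module.Finite.of_restrictScalars_finite R (R ⧸ I) _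

lemma lin_alg {k A B C : Type*} [Field k] [AddCommGroup A] [Module k A] [AddCommGroup B]
    [Module k B] [AddCommGroup C] [Module k C] [Module.Finite k A] [Module.Finite k B]
    [Module.Finite k C] (i₁ : A →ₗ[k] B) (i₂ : A →ₗ[k] C) (ρ : B →ₗ[k] C)
    (h1 : Function.Injective i₁) (h2 : ∀ a, ρ (i₁ a) = 0)
    (h3 : ∀ c, ∃ b a, c = ρ b + i₂ a) : Module.finrank k C ≤ Module.finrank k B := by
  have e1 := LinearMap.finrank_range_add_finrank_ker ρ
  have e2 := LinearMap.finrank_range_le i₂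
  have e3 : Module.finrank k A ≤ Module.finrank k (LinearMap.ker ρ) := by
    rw [← LinearMap.finrank_range_of_inj h1]
    refine Submodule.finrank_mono ?_
    rintro _ ⟨a, rfl⟩
    exact h2 a
  have e4 : LinearMap.range ρ ⊔ LinearMap.range i₂ = ⊤ := by
    rw [eq_top_iff]
    rintro c -
    obtain ⟨b, a, rfl⟩ := h3 c
    exact Submodule.add_mem_sup ⟨b, rfl⟩ ⟨a, rfl⟩
  have e5 := Submodule.finrank_add_le_finrank_add_finrank (LinearMap.range ρ) (LinearMap.range i₂)
  rw [e4, finrank_top] at e5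
  omega

lemma mem_xL {L : Type u} [AddCommGroup L] [Module R L] (x : R) (l : L) :
    l ∈ (Ideal.span {x} • ⊤ : Submodule R L) ↔ ∃ z, x • z = l := by
  rw [Submodule.ideal_span_singleton_smul]
  constructor
  · rintro ⟨z, _, h⟩
    exact ⟨z, h⟩
  · rintro ⟨z, h⟩
    exact ⟨z, trivial, h⟩

lemma key_step {L : Type u} [AddCommGroup L] [Module R L] (m b : Ideal R) (x : R) (n : ℕ)
    (hb : ∀ y ∈ b, ∀ l : L, ∀ k : ℕ, x ^ k • l = 0 → y • l = 0) (u : L)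
    (hu : ∀ r ∈ m, ∃ t, x ^ n • t = r • u) (p : R) (hp : p ∈ b * m) :
    ∃ a, x ^ n • a = p • u ∧ ∀ (r : R) (t : L), r • u = x ^ n • t → r • a = p • t := by
  refine Submodule.mul_induction_on hp ?_ ?_
  · intro y hy z hz
    obtain ⟨v, hv⟩ := hu z hz
    refine ⟨y • v, ?_, fun r t h => ?_⟩
    · rw [smul_comm, hv, smul_smul]
    · have := hb y hy (r • v - z • t) n (by
        rw [smul_sub, smul_comm, hv, smul_comm (x ^ n) z, ← h, smul_comm, sub_self])
      rw [smul_sub, sub_eq_zero] at this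
      rw [smul_comm, this, smul_smul]
  · rintro p q ⟨a, h1, h2⟩ ⟨a', h1', h2'⟩
    refine ⟨a + a', ?_, fun r t h => ?_⟩
    · rw [smul_add, h1, h1', add_smul]
    · rw [smul_add, h2 r t h, h2' r t h, add_smul]

lemma D1 [IsLocalRing R] [IsNoetherianRing R] {L : Type u} [AddCommGroup L] [Module R L]
    [Module.Finite R L] (b : Ideal R) (x : R) (n : ℕ)
    (hb : ∀ y ∈ b, ∀ l : L, ∀ k : ℕ, x ^ k • l = 0 → y • l = 0)
    (hx : x ∈ b * maximalIdeal R) :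
    socDim R (maximalIdeal R) (L ⧸ (Ideal.span {x ^ (n + 1)} • ⊤ : Submodule R L)) ≤
      socDim R (maximalIdeal R) (L ⧸ (Ideal.span {x} • ⊤ : Submodule R L)) := by
  rcases n with _ | n
  · have : x ^ (0 + 1) = x := by simp
    rw [this]
  have hxb : x ∈ b := Ideal.mul_le.2 (fun r hr s _ => b.mul_mem_right s hr) hx
  let T : Submodule R L := Submodule.torsion' R L (Submonoid.powers x)
  have hT : ∀ l, l ∈ T ↔ ∃ k : ℕ, x ^ k • l = 0 := by
    intro l
    rw [Submodule.mem_torsion'_iff]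
    constructor
    · rintro ⟨⟨_, k, rfl⟩, h⟩
      exact ⟨k, h⟩
    · rintro ⟨k, h⟩
      exact ⟨⟨_, k, rfl⟩, h⟩
  let _ := Ideal.Quotient.field (maximalIdeal R)
  let N1 : Submodule R L := Ideal.span {x} • ⊤
  let N2 : Submodule R L := Ideal.span {x ^ (n + 1 + 1)} • ⊤
  let ρ : (L ⧸ N1) →ₗ[R] (L ⧸ N2) :=
    Submodule.mapQ N1 N2 (LinearMap.lsmul R L (x ^ (n + 1))) (by
      intro l hl
      obtain ⟨z, rfl⟩ := (mem_xL x l).1 hl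
      exact (mem_xL _ _).2 ⟨z, by rw [LinearMap.lsmul_apply, smul_smul, ← pow_succ]⟩)
  have hρ : ∀ l, ρ (N1.mkQ l) = N2.mkQ (x ^ (n + 1) • l) := fun l => rfl
  refine lin_alg (k := R ⧸ maximalIdeal R) (socMap (maximalIdeal R) (N1.mkQ ∘ₗ T.subtype))
    (socMap (maximalIdeal R) (N2.mkQ ∘ₗ T.subtype)) (socMap (maximalIdeal R) ρ) ?_ ?_ ?_
  · rw [← LinearMap.ker_eq_bot, LinearMap.ker_eq_bot']
    intro τ hτ
    have h1 := congrArg Subtype.val hτ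
    rw [socMap_coe] at h1
    have h2 : (τ.1.1 : L) ∈ N1 := (Submodule.Quotient.mk_eq_zero N1).1 h1
    obtain ⟨z, hz⟩ := (mem_xL _ _).1 h2
    obtain ⟨k, hk⟩ := (hT _).1 τ.1.2
    have h3 := hb x hxb z (k + 1) (by rw [pow_succ, mul_smul, hz, hk])
    apply Subtype.ext
    apply Subtype.ext
    rw [← hz, h3]; rfl
  · intro τ
    apply Subtype.ext
    rw [socMap_coe, socMap_coe]
    change ρ (N1.mkQ τ.1.1) = 0
    obtain ⟨k, hk⟩ := (hT _).1 τ.1.2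
    rw [hρ, pow_succ, mul_smul, hb x hxb _ k hk, smul_zero, map_zero]
  · intro c
    obtain ⟨u, hu⟩ := Submodule.mkQ_surjective N2 c.1
    have hc := c.2
    rw [Submodule.mem_torsionBySet_iff] at hc
    have hu' : ∀ r ∈ maximalIdeal R, ∃ t, x ^ (n + 1 + 1) • t = r • u := by
      intro r hr
      have := hc ⟨r, hr⟩
      rw [← hu] at this
      exact (mem_xL _ _).1 ((Submodule.Quotient.mk_eq_zero N2).1 this)
    obtain ⟨a, ha1, ha2⟩ := key_step (maximalIdeal R) b x _ hb u hu' x hx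
    have hτ : x • (u - x ^ (n + 1) • a) = 0 := by
      rw [smul_sub, smul_smul, ← pow_succ', ha1, sub_self]
    let τ : T := ⟨u - x ^ (n + 1) • a, (hT _).2 ⟨1, by rwa [pow_one]⟩⟩
    refine ⟨⟨N1.mkQ a, ?_⟩, ⟨τ, ?_⟩, ?_⟩
    · rw [Submodule.mem_torsionBySet_iff]
      rintro ⟨r, hr⟩
      obtain ⟨t, ht⟩ := hu' r hr
      refine (Submodule.Quotient.mk_eq_zero N1).2 ((mem_xL _ _).2 ⟨t, ?_⟩)
      exact (ha2 r t ht.symm).symm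
    · rw [Submodule.mem_torsionBySet_iff]
      rintro ⟨r, hr⟩
      obtain ⟨t, ht⟩ := hu' r hr
      apply Subtype.ext
      change r • (u - x ^ (n + 1) • a) = 0
      rw [smul_sub, ← ht, smul_comm, ha2 r t ht.symm, smul_smul, ← pow_succ, sub_self]
    · apply Subtype.ext
      change c.1 = ρ (N1.mkQ a) + N2.mkQ (u - x ^ (n + 1) • a)
      rw [hρ, ← map_add, add_sub_cancel, hu]

end
end Stmt8

namespace Stmt8

section
variable {R : Type u} [CommRing R]

lemma quotEquiv (M : Type u) [AddCommGroup M] [Module R M] (I J Q : Ideal R) (h : Q = J ⊔ I) :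
    Nonempty (((M ⧸ (J • ⊤ : Submodule R M)) ⧸
      (I • ⊤ : Submodule R (M ⧸ (J • ⊤ : Submodule R M)))) ≃ₗ[R] M ⧸ (Q • ⊤ : Submodule R M)) := by
  subst h
  have hle : (J • ⊤ : Submodule R M) ≤ (J ⊔ I) • ⊤ := Submodule.smul_mono_left le_sup_left
  let a : (M ⧸ (J • ⊤ : Submodule R M)) →ₗ[R] M ⧸ ((J ⊔ I) • ⊤ : Submodule R M) :=
    Submodule.liftQ _ (Submodule.mkQ _) (by simpa using hle)
  have ha : Function.Surjective a := by
    intro z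
    obtain ⟨z, rfl⟩ := Submodule.mkQ_surjective _ z
    exact ⟨Submodule.mkQ _ z, rfl⟩
  have hk : LinearMap.ker a = (I • ⊤ : Submodule R (M ⧸ (J • ⊤ : Submodule R M))) := by
    have e : (I • ⊤ : Submodule R (M ⧸ (J • ⊤ : Submodule R M))) =
      (I • ⊤ : Submodule R M).map (Submodule.mkQ _) := by
      rw [Submodule.map_smul'', Submodule.map_top, Submodule.range_mkQ]
    rw [e, Submodule.ker_liftQ, Submodule.ker_mkQ, Submodule.sup_smul, Submodule.map_sup,
      Submodule.mkQ_map_self, bot_sup_eq]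
  rw [← hk]
  exact ⟨a.quotKerEquivOfSurjective ha⟩

lemma ann_quot (M : Type u) [AddCommGroup M] [Module R M] (J : Ideal R) :
    J ⊔ Module.annihilator R M ≤ Module.annihilator R (M ⧸ (J • ⊤ : Submodule R M)) := by
  refine sup_le (fun r hr => ?_) (fun r hr => ?_)
  · rw [Module.mem_annihilator]
    intro z
    obtain ⟨z, rfl⟩ := Submodule.Quotient.mk_surjective _ z
    rw [← Submodule.Quotient.mk_smul, Submodule.Quotient.mk_eq_zero]
    exact Submodule.smul_mem_smul hr trivial
  · rw [Module.mem_annihilator] at hr ⊢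
    intro z
    obtain ⟨z, rfl⟩ := Submodule.Quotient.mk_surjective _ z
    rw [← Submodule.Quotient.mk_smul, hr]; rfl

variable [IsLocalRing R]

lemma bIdeal_kill {N : Type u} [AddCommGroup N] [Module R N] {D : ℕ} {z : Fin D → R}
    (hz : IsSOP R N D z) (i : Fin D) (I : Ideal R) (hI : I = Ideal.span (z '' {j | j < i}))
    (y : R) (hy : y ∈ bIdeal R N D) (l : N ⧸ (I • ⊤ : Submodule R N)) (hl : z i • l = 0) :
    y • l = 0 := by
  subst hI
  unfold bIdeal at hy
  simp only [Ideal.mem_iInf] at hy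
  have := Module.mem_annihilator.1 (hy z hz i) ⟨l, hl⟩
  exact congrArg Subtype.val this

lemma cube_le {b : Ideal R} {x : R} (hx : x ∈ b ^ 3) (hxm : x ∈ maximalIdeal R) :
    x ∈ b * maximalIdeal R := by
  by_cases h : b = ⊤
  · rw [h, Ideal.top_mul]; exact hxm
  · have h1 : b ≤ maximalIdeal R := le_maximalIdeal h
    have h2 : b ^ 3 ≤ b * maximalIdeal R := by
      rw [pow_succ']
      refine Ideal.mul_mono_right ?_
      exact (Ideal.pow_le_self two_ne_zero).trans h1
    exact h2 hx

/-- mixed sequences -/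
def mix {d : ℕ} (x : Fin d → R) (n i : ℕ) : Fin d → R :=
  fun j => if (j : ℕ) < i then x j ^ n else x j

variable [IsNoetherianRing R]

lemma step (M : Type u) [AddCommGroup M] [Module R M] [Module.Finite R M] (d : ℕ)
    (x : Fin d → R) (hx : IsCSOP R M d x) (n : ℕ) (i : Fin d) :
    ir R M (Ideal.span (Set.range (mix x (n + 1) (i + 1)))) ≤
      ir R M (Ideal.span (Set.range (mix x (n + 1) i))) := by
  let J : Ideal R := Ideal.span (x '' {j | i < j})
  let I : Ideal R := Ideal.span ((fun j => x j ^ (n + 1)) '' {j | j < i})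
  let N := M ⧸ (J • ⊤ : Submodule R M)
  let L := N ⧸ (I • ⊤ : Submodule R N)
  have hb : ∀ y ∈ bIdeal R N ((i : ℕ) + 1), ∀ l : L, ∀ k : ℕ, x i ^ k • l = 0 → y • l = 0 := by
    intro y hy l k hk
    let e : Fin ((i : ℕ) + 1) → Fin d := fun j => ⟨j, by omega⟩
    let z : Fin ((i : ℕ) + 1) → R :=
      fun j => if (j : ℕ) < i then x (e j) ^ (n + 1) else x i ^ (k + 1)
    have hz : IsSOP R N ((i : ℕ) + 1) z := by
      refine ⟨fun j => ?_, ?_⟩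
      · simp only [z]
        split_ifs
        · exact Ideal.pow_mem_of_mem _ (hx.1.1 _) _ (by omega)
        · exact Ideal.pow_mem_of_mem _ (hx.1.1 _) _ (by omega)
      · rw [fl_iff]
        refine ((fl_iff M _).1 hx.1.2).trans ?_
        rw [Ideal.radical_le_radical_iff]
        have hA := ann_quot M J
        refine sup_le ?_ ((le_sup_right.trans hA).trans (le_sup_right.trans Ideal.le_radical))
        rw [Ideal.span_le]
        rintro _ ⟨j, rfl⟩
        rcases lt_trichotomy j i with h | h | h
        · refine ⟨n + 1, Ideal.mem_sup_left (Ideal.subset_span ⟨⟨j, by omega⟩, ?_⟩)⟩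
          have : (j : ℕ) < i := h
          simp [z, e, this]
        · refine ⟨k + 1, Ideal.mem_sup_left (Ideal.subset_span ⟨⟨j, by omega⟩, ?_⟩)⟩
          simp [z, h]
        · exact Ideal.le_radical (Ideal.mem_sup_right (hA (Ideal.mem_sup_left
            (Ideal.subset_span ⟨j, h, rfl⟩))))
    refine bIdeal_kill hz (Fin.last _) I ?_ y hy l ?_
    · change Ideal.span _ = _
      congr 1
      ext r
      constructor
      · rintro ⟨j, hj, rfl⟩
        have : (j : ℕ) < i := hj
        exact ⟨⟨j, by omega⟩, Fin.lt_def.2 this, by simp [z, e, this]⟩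
      · rintro ⟨j, hj, rfl⟩
        have : (j : ℕ) < i := by simpa [Fin.lt_def] using hj
        exact ⟨e j, this, by simp [z, this]⟩
    · simp only [z, Fin.val_last, lt_irrefl, if_false]
      rw [pow_succ', mul_smul, hk, smul_zero]
  have key := D1 (L := L) (bIdeal R N ((i : ℕ) + 1)) (x i) n hb (cube_le (hx.2 i) (hx.1.1 i))
  have e1 : Ideal.span (Set.range (mix x (n + 1) i)) = J ⊔ I ⊔ Ideal.span {x i} := by
    rw [← Ideal.span_union, ← Ideal.span_union]
    congr 1
    ext r
    simp only [Set.mem_range, Set.mem_union, Set.mem_image, Set.mem_ofPred_eq, mix,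
      Set.mem_singleton_iff]
    constructor
    · rintro ⟨j, rfl⟩
      rcases lt_trichotomy j i with h | h | h
      · have : (j : ℕ) < i := h
        exact Or.inl (Or.inr ⟨j, h, by simp [this]⟩)
      · exact Or.inr (by simp [h])
      · have : ¬ (j : ℕ) < i := not_lt.2 h.le
        exact Or.inl (Or.inl ⟨j, h, by simp [this]⟩)
    · rintro ((⟨j, h, rfl⟩ | ⟨j, h, rfl⟩) | rfl)
      · have : ¬ (j : ℕ) < i := not_lt.2 h.le
        exact ⟨j, by simp [this]⟩
      · have : (j : ℕ) < i := h
        exact ⟨j, by simp [this]⟩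
      · exact ⟨i, by simp⟩
  have e2 : Ideal.span (Set.range (mix x (n + 1) (i + 1))) =
      J ⊔ I ⊔ Ideal.span {x i ^ (n + 1)} := by
    rw [← Ideal.span_union, ← Ideal.span_union]
    congr 1
    ext r
    simp only [Set.mem_range, Set.mem_union, Set.mem_image, Set.mem_ofPred_eq, mix,
      Set.mem_singleton_iff]
    constructor
    · rintro ⟨j, rfl⟩
      rcases lt_trichotomy j i with h | h | h
      · have : (j : ℕ) < i + 1 := Nat.lt_succ_of_lt h
        exact Or.inl (Or.inr ⟨j, h, by simp [this]⟩)
      · exact Or.inr (by simp [h])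
      · have : ¬ (j : ℕ) < i + 1 := not_lt.2 h
        exact Or.inl (Or.inl ⟨j, h, by simp [this]⟩)
    · rintro ((⟨j, h, rfl⟩ | ⟨j, h, rfl⟩) | rfl)
      · have : ¬ (j : ℕ) < i + 1 := not_lt.2 h
        exact ⟨j, by simp [this]⟩
      · have : (j : ℕ) < i + 1 := Nat.lt_succ_of_lt h
        exact ⟨j, by simp [this]⟩
      · exact ⟨i, by simp⟩
  have e3 : ∀ (q : Ideal R), ir R M (J ⊔ I ⊔ q) =
      socDim R (maximalIdeal R) (L ⧸ (q • ⊤ : Submodule R L)) := by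
    intro q
    obtain ⟨a⟩ := quotEquiv M (I ⊔ q) J (J ⊔ I ⊔ q) (sup_assoc _ _ _)
    obtain ⟨b⟩ := quotEquiv N q I (I ⊔ q) rfl
    exact (socDim_congr _ (b.trans a)).symm
  rw [e1, e2, e3, e3]
  exact key

lemma ir_pow_le (M : Type u) [AddCommGroup M] [Module R M] [Module.Finite R M] (d : ℕ)
    (x : Fin d → R) (hx : IsCSOP R M d x) (n : ℕ) :
    ir R M (Ideal.span (Set.range (fun j => x j ^ (n + 1)))) ≤
      ir R M (Ideal.span (Set.range x)) := by
  have h : ∀ i, i ≤ d → ir R M (Ideal.span (Set.range (mix x (n + 1) i))) ≤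
      ir R M (Ideal.span (Set.range x)) := by
    intro i
    induction i with
    | zero =>
      intro _
      have : mix x (n + 1) 0 = x := by ext j; simp [mix]
      rw [this]
    | succ i ih =>
      intro hi
      exact (step M d x hx n ⟨i, hi⟩).trans (ih (by omega))
  have : mix x (n + 1) d = fun j => x j ^ (n + 1) := by ext j; simp [mix]
  rw [← this]
  exact h d le_rfl

lemma sop_pow (M : Type u) [AddCommGroup M] [Module R M] [Module.Finite R M] (d : ℕ)
    (x : Fin d → R) (hx : IsSOP R M d x) (n : ℕ) : IsSOP R M d (fun j => x j ^ (n + 1)) := by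
  refine ⟨fun j => Ideal.pow_mem_of_mem _ (hx.1 _) _ (by omega), ?_⟩
  rw [fl_iff]
  refine ((fl_iff M _).1 hx.2).trans ?_
  rw [Ideal.radical_le_radical_iff]
  refine sup_le ?_ (le_sup_right.trans Ideal.le_radical)
  rw [Ideal.span_le]
  rintro _ ⟨j, rfl⟩
  exact ⟨n + 1, Ideal.mem_sup_left (Ideal.subset_span ⟨j, rfl⟩)⟩

lemma span_pow_le (d : ℕ) (x : Fin d → R) (hx : ∀ i, x i ∈ maximalIdeal R) (n : ℕ) :
    Ideal.span (Set.range (fun j => x j ^ n)) ≤ maximalIdeal R ^ n := by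
  rw [Ideal.span_le]
  rintro _ ⟨j, rfl⟩
  exact Ideal.pow_mem_pow (hx j) n

lemma alphaN_le (M : Type u) [AddCommGroup M] [Module R M] [Module.Finite R M] (d : ℕ)
    (x : Fin d → R) (hx : IsCSOP R M d x) (n : ℕ) :
    alphaN R M d (n + 1) ≤ ir R M (Ideal.span (Set.range x)) := by
  refine le_trans (Nat.sInf_le ?_) (ir_pow_le M d x hx n)
  exact ⟨_, sop_pow M d x hx.1 n, span_pow_le d x hx.1.1 _, rfl⟩

lemma part2 (M : Type u) [AddCommGroup M] [Module R M] [Module.Finite R M] (d : ℕ)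
    (x : Fin d → R) (hx : IsCSOP R M d x) :
    alphaLim R M d ≤ ir R M (Ideal.span (Set.range x)) :=
  ciSup_le (fun n => alphaN_le M d x hx n)

lemma le_alphaLim (M : Type u) [AddCommGroup M] [Module R M] [Module.Finite R M] (d : ℕ)
    (x : Fin d → R) (hx : IsCSOP R M d x) (s n : ℕ)
    (h : ∀ y : Fin d → R, IsSOP R M d y → Ideal.span (Set.range y) ≤ maximalIdeal R ^ (n + 1) →
      s ≤ ir R M (Ideal.span (Set.range y))) : s ≤ alphaLim R M d := by
  have h1 : s ≤ alphaN R M d (n + 1) := by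
    refine le_csInf ⟨_, _, sop_pow M d x hx.1 n, span_pow_le d x hx.1.1 _, rfl⟩ ?_
    rintro _ ⟨y, h1, h2, rfl⟩
    exact h y h1 h2
  refine h1.trans (le_ciSup (f := fun n => alphaN R M d (n + 1)) ?_ n)
  refine ⟨ir R M (Ideal.span (Set.range x)), ?_⟩
  rintro _ ⟨n, rfl⟩
  exact alphaN_le M d x hx n

end
end Stmt8

namespace Stmt8

open CategoryTheory Opposite

section
variable {R : Type u} [CommRing R]

/-- A stage in the construction of a resolution. -/
structure Stage (R : Type u) [CommRing R] where
  X : ModuleCat.{u} R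
  Y : ModuleCat.{u} R
  d : X →ₗ[R] Y
  fin : Module.Finite R X
  proj : Module.Projective R X

lemma cover [IsNoetherianRing R] {X Y : ModuleCat.{u} R} (d : X →ₗ[R] Y) [Module.Finite R X] :
    ∃ (Z : ModuleCat.{u} R) (e : Z →ₗ[R] X), Module.Finite R Z ∧ Module.Projective R Z ∧
      LinearMap.range e = LinearMap.ker d := by
  obtain ⟨n, f, hf⟩ := Module.Finite.exists_fin' R (LinearMap.ker d)
  refine ⟨ModuleCat.of R (Fin n → R), (LinearMap.ker d).subtype ∘ₗ f, ?_, ?_, ?_⟩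
  · change Module.Finite R (Fin n → R); infer_instance
  · change Module.Projective R (Fin n → R); infer_instance
  · rw [LinearMap.range_comp, LinearMap.range_eq_top.2 hf, Submodule.map_top,
      Submodule.range_subtype]

noncomputable def Stage.next [IsNoetherianRing R] (S : Stage R) : Stage R :=
  have := S.fin
  { X := (cover S.d).choose
    Y := S.X
    d := (cover S.d).choose_spec.choose
    fin := (cover S.d).choose_spec.choose_spec.1
    proj := (cover S.d).choose_spec.choose_spec.2.1 }

lemma Stage.next_range [IsNoetherianRing R] (S : Stage R) :
    LinearMap.range (S.next.d : S.next.X →ₗ[R] S.X) = LinearMap.ker S.d :=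
  have := S.fin
  (cover S.d).choose_spec.choose_spec.2.2

lemma Res.exists [IsNoetherianRing R] (A : Type u) [AddCommGroup A] [Module R A]
    [Module.Finite R A] : Nonempty (Res R A) := by
  obtain ⟨n, f, hf⟩ := Module.Finite.exists_fin' R A
  let S0 : Stage R := ⟨ModuleCat.of R (Fin n → R), ModuleCat.of R A, f,
    (inferInstance : Module.Finite R (Fin n → R)),
    (inferInstance : Module.Projective R (Fin n → R))⟩
  let S : ℕ → Stage R := fun n => Nat.rec S0 (fun _ s => s.next) n
  have hS : ∀ n, S (n + 1) = (S n).next := fun n => rfl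
  let D : ∀ n, (S (n + 1)).X →ₗ[R] (S n).X := fun n => (S n).next.d
  have h1 : ∀ n, LinearMap.range (D n) = LinearMap.ker (S n).d := fun n => (S n).next_range
  refine ⟨⟨fun n => (S n).X, D, f, fun n p => ?_, fun p => ?_, fun p hp => ?_, fun n p hp => ?_,
    hf, fun n => (S n).proj, fun n => (S n).fin⟩⟩
  · exact (h1 (n + 1)).le ⟨p, rfl⟩
  · have : D 0 p ∈ LinearMap.range (D 0) := ⟨p, rfl⟩
    rw [h1] at this
    exact this
  · have : p ∈ LinearMap.ker (S 0).d := hp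
    rw [← h1] at this
    exact this
  · exact (h1 (n + 1)).ge hp

variable {A : Type u} [AddCommGroup A] [Module R A]

noncomputable def Res.cx (P : Res R A) : ChainComplex (ModuleCat.{u} R) ℕ :=
  ChainComplex.of P.X (fun n => ModuleCat.ofHom (P.d n)) (fun n => by
    ext p
    exact P.dd n p)

lemma Res.cx_d (P : Res R A) (n : ℕ) : P.cx.d (n + 1) n = ModuleCat.ofHom (P.d n) :=
  ChainComplex.of_d P.X (fun n => ModuleCat.ofHom (P.d n)) n

lemma Res.cx_exact (P : Res R A) (n : ℕ) : P.cx.ExactAt (n + 1) := by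
  rw [HomologicalComplex.exactAt_iff' _ (n + 2) (n + 1) n (by simp) (by simp),
    ShortComplex.moduleCat_exact_iff]
  intro p hp
  change P.cx.d (n + 1) n p = 0 at hp
  rw [P.cx_d] at hp
  obtain ⟨q, hq⟩ := P.ex n p hp
  refine ⟨q, ?_⟩
  change P.cx.d (n + 2) (n + 1) q = p
  rw [P.cx_d]
  exact hq

noncomputable def Res.toPR (P : Res R A) : ProjectiveResolution (ModuleCat.of R A) where
  complex := P.cx
  projective n := by
    have := P.proj n
    exact (IsProjective.iff_projective (R := R) (P.X n)).1 this
  π := (ChainComplex.toSingle₀Equiv _ _).symm ⟨ModuleCat.ofHom P.ε, by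
    rw [P.cx_d]
    ext p
    exact P.εd p⟩
  quasiIso := ⟨fun n => by
    cases n with
    | zero =>
      rw [ChainComplex.quasiIsoAt₀_iff, ShortComplex.quasiIso_iff_of_zeros' _ rfl rfl rfl]
      constructor
      · rw [ShortComplex.moduleCat_exact_iff]
        intro p hp
        obtain ⟨q, hq⟩ := P.ex0 p (by
          simpa using! hp)
        refine ⟨q, ?_⟩
        change P.cx.d 1 0 q = p
        rw [P.cx_d]
        exact hq
      · rw [ModuleCat.epi_iff_surjective]
        intro a
        obtain ⟨p, hp⟩ := P.surj a
        refine ⟨p, ?_⟩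
        simpa using! hp
    | succ n =>
      rw [quasiIsoAt_iff_exactAt' (hL := ChainComplex.exactAt_succ_single_obj ..)]
      exact P.cx_exact n⟩

lemma Res.toPR_π (P : Res R A) : P.toPR.π.f 0 = ModuleCat.ofHom P.ε :=
  ChainComplex.toSingle₀Equiv_symm_apply_f_zero _ _

variable {B : Type u} [AddCommGroup B] [Module R B]

noncomputable def CMap.hom {P : Res R A} {Q : Res R B} {v : A →ₗ[R] B} (c : CMap P Q v) :
    P.cx ⟶ Q.cx :=
  ChainComplex.ofHom (fun n => (ModuleCat.ofHom (c.g n) : P.cx.X n ⟶ Q.cx.X n)) (fun n => by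
    rw [P.cx_d, Q.cx_d]
    ext p
    exact c.comm n p)

lemma CMap.hom_f {P : Res R A} {Q : Res R B} {v : A →ₗ[R] B} (c : CMap P Q v) (n : ℕ) :
    c.hom.f n = ModuleCat.ofHom (c.g n) := rfl

lemma CMap.hom_comm {P : Res R A} {Q : Res R B} {v : A →ₗ[R] B} (c : CMap P Q v) :
    c.hom.f 0 ≫ Q.toPR.π.f 0 = P.toPR.π.f 0 ≫ ModuleCat.ofHom v := by
  rw [P.toPR_π, Q.toPR_π, c.hom_f]
  ext p
  exact c.comm0 p

end
end Stmt8

namespace Stmt8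

open CategoryTheory Opposite

section
variable {R : Type u} [CommRing R]
variable {A : Type u} [AddCommGroup A] [Module R A]
variable (M : Type u) [AddCommGroup M] [Module R M]

/-- The contravariant hom functor into `M`. -/
noncomputable abbrev hF : ModuleCat.{u} R ⥤ (ModuleCat.{u} R)ᵒᵖ :=
  ((linearYoneda R (ModuleCat.{u} R)).obj (ModuleCat.of R M)).rightOp

/-- The hom complex. -/
noncomputable abbrev hK (P : Res R A) : ChainComplex (ModuleCat.{u} R)ᵒᵖ ℕ :=
  ((hF M).mapHomologicalComplex (ComplexShape.down ℕ)).obj P.cx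

noncomputable def kk (P : Res R A) (n : ℕ) :
    ModuleCat.of R (Zc M P n) ⟶ ((hK M P).X n).unop :=
  ModuleCat.ofHom (Y := (P.X n ⟶ ModuleCat.of R M))
    { toFun := fun f => ModuleCat.ofHom f.1
      map_add' := fun _ _ => rfl
      map_smul' := fun _ _ => rfl }

lemma hK_d (P : Res R A) (n : ℕ) (f : P.X n →ₗ[R] M) :
    ((hK M P).d (n + 1) n).unop (show (P.X n ⟶ ModuleCat.of R M) from ModuleCat.ofHom f) =
      (show (P.X (n + 1) ⟶ ModuleCat.of R M) from ModuleCat.ofHom (f ∘ₗ P.d n)) := by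
  change P.cx.d (n + 1) n ≫ ModuleCat.ofHom f = _
  rw [P.cx_d]
  rfl

lemma hK_d_kk (P : Res R A) (n : ℕ) : (hK M P).d (n + 1) n ≫ (kk M P n).op = 0 := by
  apply Quiver.Hom.unop_inj
  ext f
  have := hK_d M P n f.1
  refine this.trans ?_
  have h0 : f.1 ∘ₗ P.d n = 0 := LinearMap.ext f.2
  rw [h0]
  rfl

noncomputable def th0 (P : Res R A) (n : ℕ) :
    (hK M P).homology n ⟶ op (ModuleCat.of R (Zc M P n)) :=
  (hK M P).homologyι n ≫ (hK M P).descOpcycles (kk M P n).op (n + 1) (by simp) (hK_d_kk M P n)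

/-- The map from cocycles to `Ext`. -/
noncomputable def th (P : Res R A) (n : ℕ) :
    Zc M P n →ₗ[R]
      ((Ext R (ModuleCat.{u} R) n).obj (op (ModuleCat.of R A))).obj (ModuleCat.of R M) :=
  ModuleCat.Hom.hom ((P.toPR.isoLeftDerivedObj (hF M) n).hom ≫ th0 M P n).unop

noncomputable def desc (P : Res R A) (n : ℕ) :
    (hK M P).opcycles n ⟶ op (ModuleCat.of R (Zc M P n)) :=
  (hK M P).descOpcycles (kk M P n).op (n + 1) (by simp) (hK_d_kk M P n)

lemma p_desc (P : Res R A) (n : ℕ) (f : Zc M P n) :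
    ((hK M P).pOpcycles n).unop ((desc M P n).unop f) = kk M P n f := by
  have h : (hK M P).pOpcycles n ≫ desc M P n = (kk M P n).op :=
    HomologicalComplex.p_descOpcycles ..
  have h2 := congrArg Quiver.Hom.unop h
  exact congrArg (fun k => (ModuleCat.Hom.hom k) f) h2

lemma p_inj (P : Res R A) (n : ℕ) : Function.Injective ((hK M P).pOpcycles n).unop :=
  (ModuleCat.mono_iff_injective _).1 inferInstance

lemma desc_surj (P : Res R A) (n : ℕ) : Function.Surjective (desc M P n).unop := by
  intro w
  let f : P.X n ⟶ ModuleCat.of R M := ((hK M P).pOpcycles n).unop w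
  have hf : f.hom ∈ Zc M P n := by
    have h : (hK M P).d (n + 1) n ≫ (hK M P).pOpcycles n = 0 :=
      HomologicalComplex.d_pOpcycles ..
    have h2 := congrArg Quiver.Hom.unop h
    have h3 := congrArg (fun k => (ModuleCat.Hom.hom k) w) h2
    have h4 := (hK_d M P n f.hom).symm.trans h3
    intro p
    exact congrArg (fun (k : P.X (n + 1) ⟶ ModuleCat.of R M) => k.hom p) h4
  refine ⟨⟨f.hom, hf⟩, p_inj M P n ?_⟩
  rw [p_desc]
  rfl

lemma surj_th0 (P : Res R A) (n : ℕ) : Function.Surjective (th0 M P n).unop := by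
  intro z
  have he : Function.Surjective ((hK M P).homologyι n).unop :=
    (ModuleCat.epi_iff_surjective _).1 inferInstance
  obtain ⟨w, rfl⟩ := he z
  obtain ⟨f, rfl⟩ := desc_surj M P n w
  exact ⟨f, rfl⟩

lemma th0_zero (P : Res R A) (n : ℕ) (f : Zc M P n) : (th0 M P n).unop f = 0 ↔ f.1 ∈ Bc M P n := by
  let S : ShortComplex (ModuleCat.{u} R)ᵒᵖ := ShortComplex.mk ((hK M P).homologyι n)
    ((hK M P).fromOpcycles n ((ComplexShape.down ℕ).next n)) (by simp)
  have hS : S.Exact := S.exact_of_f_is_kernel ((hK M P).homologyIsKernel n _ rfl)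
  have hE := hS.unop
  rw [ShortComplex.moduleCat_exact_iff] at hE
  have h1 : (th0 M P n).unop f = 0 ↔
      ∃ z, ((hK M P).fromOpcycles n ((ComplexShape.down ℕ).next n)).unop z =
        (desc M P n).unop f := by
    refine ⟨fun h => hE _ h, ?_⟩
    rintro ⟨z, hz⟩
    have h0 := S.unop.zero
    have h3 := congrArg (fun k => (ModuleCat.Hom.hom k) z) h0
    change ((hK M P).homologyι n).unop ((desc M P n).unop f) = 0
    rw [← hz]
    exact h3
  have h2 : (th0 M P n).unop f = 0 ↔
      ∃ z, ((hK M P).d n ((ComplexShape.down ℕ).next n)).unop z = kk M P n f := by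
    rw [h1]
    refine exists_congr fun z => ?_
    rw [← p_desc, ← (p_inj M P n).eq_iff]
    have h := (hK M P).p_fromOpcycles n ((ComplexShape.down ℕ).next n)
    have h2 := congrArg Quiver.Hom.unop h
    have h3 := congrArg (fun k => (ModuleCat.Hom.hom k) z) h2
    exact ⟨fun e => h3.symm.trans e, fun e => h3.trans e⟩
  rw [h2]
  cases n with
  | zero =>
    rw [(hK M P).shape _ _ (by simp)]
    constructor
    · rintro ⟨z, hz⟩
      have hz' : (0 : P.X 0 ⟶ ModuleCat.of R M) = ModuleCat.ofHom f.1 := hz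
      change f.1 = 0
      exact (congrArg ModuleCat.Hom.hom hz').symm
    · intro h
      have h0 : f.1 = 0 := h
      refine ⟨0, ?_⟩
      change (0 : P.X 0 ⟶ ModuleCat.of R M) = ModuleCat.ofHom f.1
      rw [h0]
      rfl
  | succ n =>
    rw [ChainComplex.next_nat_succ]
    constructor
    · rintro ⟨z, hz⟩
      let z' : P.X n ⟶ ModuleCat.of R M := z
      have h4 := (hK_d M P n z'.hom).symm.trans hz
      exact ⟨z'.hom, congrArg (fun (k : P.X (n + 1) ⟶ ModuleCat.of R M) => k.hom) h4⟩
    · rintro ⟨z, hz⟩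
      refine ⟨(show (P.X n ⟶ ModuleCat.of R M) from ModuleCat.ofHom z), (hK_d M P n z).trans ?_⟩
      change ModuleCat.ofHom (z ∘ₗ P.d n) = ModuleCat.ofHom f.1
      rw [← hz]
      rfl

lemma iso_bij (P : Res R A) (n : ℕ) :
    Function.Bijective (P.toPR.isoLeftDerivedObj (hF M) n).hom.unop := by
  have : IsIso (P.toPR.isoLeftDerivedObj (hF M) n).hom.unop := inferInstance
  exact ConcreteCategory.bijective_of_isIso _

lemma th_apply (P : Res R A) (n : ℕ) (f : Zc M P n) :
    th M P n f = (P.toPR.isoLeftDerivedObj (hF M) n).hom.unop ((th0 M P n).unop f) := rfl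

lemma th_surj (P : Res R A) (n : ℕ) : Function.Surjective (th M P n) :=
  (iso_bij M P n).2.comp (surj_th0 M P n)

lemma th_zero (P : Res R A) (n : ℕ) (f : Zc M P n) : th M P n f = 0 ↔ f.1 ∈ Bc M P n := by
  rw [← th0_zero, th_apply]
  exact map_eq_zero_iff _ (iso_bij M P n).1

variable {B : Type u} [AddCommGroup B] [Module R B]

def pull {P : Res R A} {Q : Res R B} {v : A →ₗ[R] B} (c : CMap P Q v) (n : ℕ) :
    Zc M Q n →ₗ[R] Zc M P n where
  toFun f := ⟨f.1 ∘ₗ c.g n, cocycle_comp c f.2⟩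
  map_add' _ _ := rfl
  map_smul' _ _ := rfl

lemma th0_nat {P : Res R A} {Q : Res R B} {v : A →ₗ[R] B} (c : CMap P Q v) (n : ℕ) :
    HomologicalComplex.homologyMap
      (((hF M).mapHomologicalComplex (ComplexShape.down ℕ)).map c.hom) n ≫ th0 M Q n =
      th0 M P n ≫ (ModuleCat.ofHom (pull M c n)).op := by
  unfold th0
  rw [HomologicalComplex.homologyι_naturality_assoc,
    HomologicalComplex.opcyclesMap_comp_descOpcycles, Category.assoc]
  congr 1
  rw [← cancel_epi ((hK M P).pOpcycles n), HomologicalComplex.p_descOpcycles,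
    HomologicalComplex.p_descOpcycles_assoc]
  rfl

lemma th_nat {P : Res R A} {Q : Res R B} {v : A →ₗ[R] B} (c : CMap P Q v) (n : ℕ)
    (f : Zc M Q n) :
    ((Ext R (ModuleCat.{u} R) n).map (ModuleCat.ofHom v).op).app (ModuleCat.of R M) (th M Q n f) =
      th M P n ⟨f.1 ∘ₗ c.g n, cocycle_comp c f.2⟩ := by
  have h := ProjectiveResolution.isoLeftDerivedObj_hom_naturality (ModuleCat.ofHom v) P.toPR Q.toPR
    c.hom c.hom_comm (hF M) n
  have h2 := congrArg Quiver.Hom.unop h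
  have h3 := congrArg (fun k => (ModuleCat.Hom.hom k) ((th0 M Q n).unop f)) h2
  have h4 := congrArg Quiver.Hom.unop (th0_nat M c n)
  have h5 := congrArg (fun k => (ModuleCat.Hom.hom k) f) h4
  exact h3.trans (congrArg (fun z => (P.toPR.isoLeftDerivedObj (hF M) n).hom.unop z) h5)

end
end Stmt8

namespace Stmt8

open CategoryTheory Opposite

section
variable {R : Type u} [CommRing R]
variable {I : Ideal R} (P : ∀ t, Res R (R ⧸ I ^ t))
variable (M : Type u) [AddCommGroup M] [Module R M]

noncomputable abbrev dg (I : Ideal R) (n : ℕ) : ℕᵒᵖᵒᵖ ⥤ ModuleCat.{u} R ⥤ ModuleCat.{u} R :=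
  localCohomology.diagram (localCohomology.idealPowersDiagram I) n

noncomputable def iot (I : Ideal R) (n t : ℕ) :
    ((Ext R (ModuleCat.{u} R) n).obj (op (ModuleCat.of R (R ⧸ I ^ t)))).obj (ModuleCat.of R M) →ₗ[R]
      (localCohomology I n).obj (ModuleCat.of R M) :=
  haveI := localCohomology.hasColimitDiagram.{u, 0} (localCohomology.idealPowersDiagram I) n
  ((Limits.colimit.ι (dg I n) (op (op t))).app (ModuleCat.of R M)).hom

lemma pres : Limits.PreservesColimitsOfShape ℕᵒᵖᵒᵖ (forget (ModuleCat.{u} R)) := by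
  have : Limits.PreservesFilteredColimitsOfSize.{0, 0} (forget (ModuleCat.{u} R)) :=
    Limits.preservesFilteredColimitsOfSize_shrink.{0, u} _
  infer_instance

lemma iot_rep (I : Ideal R) (n : ℕ) (z : (localCohomology I n).obj (ModuleCat.of R M)) :
    ∃ t w, iot M I n t w = z := by
  have := pres (R := R)
  have := localCohomology.hasColimitDiagram.{u, 0} (localCohomology.idealPowersDiagram I) n
  let c := ((evaluation _ _).obj (ModuleCat.of R M)).mapCocone (Limits.colimit.cocone (dg I n))
  have hc : Limits.IsColimit c := Limits.isColimitOfPreserves _ (Limits.colimit.isColimit _)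
  obtain ⟨j, w, h⟩ := Limits.Concrete.isColimit_exists_rep _ hc z
  exact ⟨j.unop.unop, w, h⟩

lemma iot_eq (I : Ideal R) (n : ℕ) {t : ℕ} (w) (h : iot M I n t w = 0) :
    ∃ (t' : ℕ) (h : t ≤ t'), ((Ext R (ModuleCat.{u} R) n).map (ModuleCat.ofHom (tr I h)).op).app
      (ModuleCat.of R M) w = 0 := by
  have := pres (R := R)
  have := localCohomology.hasColimitDiagram.{u, 0} (localCohomology.idealPowersDiagram I) n
  let c := ((evaluation _ _).obj (ModuleCat.of R M)).mapCocone (Limits.colimit.cocone (dg I n))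
  have hc : Limits.IsColimit c := Limits.isColimitOfPreserves _ (Limits.colimit.isColimit _)
  obtain ⟨j, a, b, h⟩ := Limits.Concrete.isColimit_exists_of_rep_eq _ hc
    (i := op (op t)) (j := op (op t)) w 0 (h.trans (map_zero (iot M I n t)).symm)
  refine ⟨j.unop.unop, a.unop.unop.le, ?_⟩
  refine Eq.trans ?_ (h.trans (map_zero _))
  rfl

lemma iot_nat (I : Ideal R) (n : ℕ) {t t' : ℕ} (h : t ≤ t') (w) : iot M I n t'
    (((Ext R (ModuleCat.{u} R) n).map (ModuleCat.ofHom (tr I h)).op).app (ModuleCat.of R M) w) =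
    iot M I n t w := by
  have := localCohomology.hasColimitDiagram.{u, 0} (localCohomology.idealPowersDiagram I) n
  have h1 := Limits.colimit.w (dg I n) (homOfLE h).op.op
  have h2 := congrArg (fun k => (k.app (ModuleCat.of R M)).hom w) h1
  exact h2

noncomputable def pr (n t : ℕ) :
    Zc M (P t) n →ₗ[R] (localCohomology I n).obj (ModuleCat.of R M) :=
  iot M I n t ∘ₗ th M (P t) n

lemma pr_surj (n : ℕ) (z : (localCohomology I n).obj (ModuleCat.of R M)) :
    ∃ t f, pr P M n t f = z := by
  obtain ⟨t, w, rfl⟩ := iot_rep M I n z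
  obtain ⟨f, rfl⟩ := th_surj M (P t) n w
  exact ⟨t, f, rfl⟩

lemma pr_pull (n : ℕ) {t t' : ℕ} (h : t ≤ t') (c : CMap (P t') (P t) (tr I h)) (f) :
    pr P M n t' (pull M c n f) = pr P M n t f := by
  refine Eq.trans ?_ (iot_nat M I n h (th M (P t) n f))
  exact congrArg (iot M I n t') (th_nat M c n f).symm

lemma pr_bd (n t : ℕ) (f) (h : f.1 ∈ Bc M (P t) n) : pr P M n t f = 0 := by
  have := (th_zero M (P t) n f).2 h
  simp [pr, this]

lemma pr_zero (n t : ℕ) (f) (h : pr P M n t f = 0) : ∃ (t' : ℕ) (h : t ≤ t'), 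
    ∀ c : CMap (P t') (P t) (tr I h), (pull M c n f).1 ∈ Bc M (P t') n := by
  obtain ⟨t', h', e⟩ := iot_eq M I n _ h
  refine ⟨t', h', fun c => ?_⟩
  rw [← th_zero]
  exact (th_nat M c n f).symm.trans e

lemma pr_dies (n t : ℕ) (f) (h : Dies P t n f.1) : pr P M n t f = 0 := by
  obtain ⟨t', h', c, hc⟩ := h
  rw [← pr_pull P M n h' c]
  exact pr_bd P M n t' _ hc

end
end Stmt8

namespace Stmt8

open CategoryTheory Opposite

section
variable {R : Type u} [CommRing R]
variable {I : Ideal R} (P : ∀ t, Res R (R ⧸ I ^ t))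
variable (M : Type u) [AddCommGroup M] [Module R M]

def ccomp {t t' t'' : ℕ} {h : t ≤ t'} {h' : t' ≤ t''} (c : CMap (P t') (P t) (tr I h))
    (c' : CMap (P t'') (P t') (tr I h')) : CMap (P t'') (P t) (tr I (h.trans h')) where
  g n := c.g n ∘ₗ c'.g n
  comm0 p := by
    rw [← tr_comp I h h']
    simp [c.comm0, c'.comm0]
  comm n p := by simp [c.comm, c'.comm]

lemma pr_zero' (n t : ℕ) (f) (h : pr P M n t f = 0) : ∃ t₀ : ℕ, ∀ (t' : ℕ) (_ : t₀ ≤ t') (h : t ≤ t')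
    (c : CMap (P t') (P t) (tr I h)), (pull M c n f).1 ∈ Bc M (P t') n := by
  obtain ⟨t₀, h₀, H⟩ := pr_zero P M n t f h
  refine ⟨t₀, fun t' h₁ h₂ c => ?_⟩
  obtain ⟨c₀⟩ := exists_lift (P t₀) (P t) (tr I h₀)
  obtain ⟨c₁⟩ := exists_lift (P t') (P t₀) (tr I h₁)
  rw [← th_zero]
  have e1 := th_nat M c n f
  have e2 := th_nat M (ccomp P c₀ c₁) n f
  have e3 := th_nat M c₁ n (pull M c₀ n f)
  rw [(th_zero M (P t₀) n _).2 (H c₀)] at e3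
  refine e1.symm.trans (e2.trans (e3.symm.trans ?_))
  exact map_zero _

lemma eval_top' [IsNoetherianRing R] (t d : ℕ) (y : Fin d → R) (hl : ∀ i, y i ∈ I)
    (hlt : ∀ i, y i ∈ I ^ t)
    (hG : ∃ c, I ^ c ≤ Ideal.span (Set.range y) ⊔ Module.annihilator R M) :
    ∃ Φ : Zc M (P t) d →ₗ[R] M ⧸ (Ideal.span (Set.range y) • ⊤ : Submodule R M),
      (∀ f, f.1 ∈ Bc M (P t) d → Φ f = 0) ∧ ∀ f, Φ f = 0 → Dies P t d f.1 := by
  have hr : {r | r ∈ List.ofFn y} = Set.range y := by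
    ext r; simp [List.mem_ofFn]
  have := eval_top P t (List.ofFn y) (by
    intro r h
    obtain ⟨i, rfl⟩ := (List.mem_ofFn' _ _).1 h
    exact hl i) (by
    intro r h
    obtain ⟨i, rfl⟩ := (List.mem_ofFn' _ _).1 h
    exact hlt i) M (by
    unfold Good
    rw [hr]
    exact hG)
  rw [hr, List.length_ofFn] at this
  exact this

lemma push {ι : Type*} [Finite ι] (n : ℕ) (z : ι → (localCohomology I n).obj (ModuleCat.of R M)) :
    ∃ t, ∃ f : ι → Zc M (P t) n, ∀ i, pr P M n t (f i) = z i := by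
  cases nonempty_fintype ι
  choose t f hf using fun i => pr_surj P M n (z i)
  have hle : ∀ i, t i ≤ Finset.univ.sup t := fun i => Finset.le_sup (Finset.mem_univ i)
  have c := fun i => (exists_lift (P (Finset.univ.sup t)) (P (t i)) (tr I (hle i))).some
  exact ⟨_, fun i => pull M (c i) n (f i), fun i => (pr_pull P M n _ (c i) _).trans (hf i)⟩

lemma push_soc (hI : I.FG) {ι : Type*} [Finite ι] (n : ℕ)
    (z : ι → (localCohomology I n).obj (ModuleCat.of R M)) (hz : ∀ i, ∀ a ∈ I, a • z i = 0) :
    ∃ t, ∃ f : ι → Zc M (P (t + 1)) n, (∀ i, pr P M n (t + 1) (f i) = z i) ∧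
      ∀ i, ∀ a ∈ I, a • (f i).1 ∈ Bc M (P (t + 1)) n := by
  obtain ⟨G, hG⟩ := hI
  obtain ⟨t, f, hf⟩ := push P M n z
  choose t₀ H using fun (j : ι × G) => pr_zero' P M n t (j.2.1 • f j.1) (by
    rw [map_smul, hf]
    exact hz _ _ (hG ▸ Ideal.subset_span j.2.2))
  cases nonempty_fintype ι
  let T := Finset.univ.sup t₀ + t
  obtain ⟨c⟩ := exists_lift (P (T + 1)) (P t) (tr I (show t ≤ T + 1 by omega))
  refine ⟨T, fun i => pull M c n (f i), fun i => (pr_pull P M n _ c _).trans (hf i), fun i => ?_⟩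
  have : I ≤ (Bc M (P (T + 1)) n).comap (LinearMap.toSpanSingleton R _ (pull M c n (f i)).1) := by
    refine hG.ge.trans ?_
    refine Ideal.span_le.2 fun r hr => ?_
    have hle : t₀ (i, ⟨r, hr⟩) ≤ Finset.univ.sup t₀ := Finset.le_sup (Finset.mem_univ _)
    exact H (i, ⟨r, hr⟩) (T + 1) (by omega) _ c
  exact fun a ha => this ha

lemma mk_smul_coe (I : Ideal R) {N : Type u} [AddCommGroup N] [Module R N] (r : R)
    (x : Submodule.torsionBySet R N (I : Set R)) :
    ((Ideal.Quotient.mk I r • x : Submodule.torsionBySet R N (I : Set R)) : N) = r • (x : N) := rfl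

lemma part1 [IsLocalRing R] [IsNoetherianRing R] [Module.Finite R M] (d : ℕ)
    (x : Fin d → R) (hx : IsCSOP R M d x) : socH R M d ≤ alphaLim R M d := by
  let m := maximalIdeal R
  let : Field (R ⧸ m) := Ideal.Quotient.field m
  rcases Nat.eq_zero_or_pos (socH R M d) with h0 | hpos
  · rw [h0]; exact Nat.zero_le _
  let H := (localCohomology (maximalIdeal R) d).obj (ModuleCat.of R M)
  have hfin : Module.Finite (R ⧸ m) (Submodule.torsionBySet R H (m : Set R)) :=
    Module.finite_of_finrank_pos hpos
  let w := Module.finBasis (R ⧸ m) (Submodule.torsionBySet R H (m : Set R))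
  have P := fun t => (Res.exists (R := R) (R ⧸ m ^ t)).some
  obtain ⟨t, f, hf, hb⟩ := push_soc P M (IsNoetherian.noetherian m) d (fun i => (w i : H))
    (fun i a ha => (Submodule.mem_torsionBySet_iff _ _).1 (w i).2 ⟨a, ha⟩)
  refine le_alphaLim M d x hx _ t fun y hy hyt => ?_
  obtain ⟨Φ, h1, h2⟩ := eval_top' P M (t + 1) d y hy.1
    (fun i => hyt (Ideal.subset_span ⟨i, rfl⟩))
    (Ideal.exists_pow_le_of_le_radical_of_fg ((fl_iff M _).1 hy.2) (IsNoetherian.noetherian m))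
  let v : Fin (socH R M d) → Submodule.torsionBySet R
      (M ⧸ (Ideal.span (Set.range y) • ⊤ : Submodule R M)) (m : Set R) := fun i =>
    ⟨Φ (f i), (Submodule.mem_torsionBySet_iff _ _).2 fun a => by
      rw [← map_smul]
      exact h1 _ (hb i a.1 a.2)⟩
  have hv : LinearIndependent (R ⧸ m) v := by
    rw [Fintype.linearIndependent_iff]
    intro g hg
    choose r hr using fun i => Ideal.Quotient.mk_surjective (I := m) (g i)
    have e1 : Φ (∑ i, r i • f i) = 0 := by
      have := congrArg Subtype.val hg
      rw [AddSubmonoidClass.coe_finsetSum] at this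
      rw [map_sum]
      refine Eq.trans (Finset.sum_congr rfl fun i _ => ?_) this
      rw [← hr, mk_smul_coe, map_smul]
    have e2 := pr_dies P M d (t + 1) _ (h2 _ e1)
    have e3 : ∑ i, g i • w i = 0 := by
      apply Subtype.ext
      rw [AddSubmonoidClass.coe_finsetSum]
      rw [map_sum] at e2
      refine Eq.trans (Finset.sum_congr rfl fun i _ => ?_) e2
      rw [← hr, mk_smul_coe, map_smul]
      exact congrArg (fun z => r i • z) (hf i).symm
    exact Fintype.linearIndependent_iff.1 w.linearIndependent g e3
  have := hv.fintype_card_le_finrank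
  rw [Fintype.card_fin] at this
  exact this

end
end Stmt8

/-- `dim_k Soc(H^d_m(M)) ≤ α(M) ≤ N_R(M)`, where `N_R(M)` is realized as the
index of reducibility of (the ideal generated by) any C-system of parameters of `M`. -/
theorem stmt8 (R : Type u) [CommRing R] [IsLocalRing R] [IsNoetherianRing R]
    (hCM : IsQuotientOfCMLocalRing R)
    (M : Type u) [AddCommGroup M] [Module R M] [Module.Finite R M]
    (d : ℕ) (hd : 0 < d) (hdim : mdim R M = d)
    (x : Fin d → R) (hx : IsCSOP R M d x) :
    socH R M d ≤ alphaLim R M d ∧ alphaLim R M d ≤ ir R M (Ideal.span (Set.range x)) := by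
  exact ⟨Stmt8.part1 M d x hx, Stmt8.part2 M d x hx⟩
end
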